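/- Let ℓ ≥ 2 and w ≥ 0 be integers, let ρ be an ℓ-core partition with |ρ| = e, and for 0 ≤ i ≤ ℓ−2 set β_i = s_{(ℓ−i,1^i)} + s_{(ℓ−i−1,1^{i+1})} ∈ CF(S_ℓ), with 𝓑 = {β_0,…,β_{ℓ−2}}. Then the Cartan matrix Cart_ℓ(ℓw+e, ρ) is equivalent over ℤ to the PMap_w(𝓑)×PMap_w(𝓑)-matrix whose (λ̲, μ̲)-entry is ⟨ζ_{λ̲}, ζ_{μ̲}⟩, the scalar product of class functions on S_ℓ≀S_w. -/

import Mathlib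

open scoped BigOperators
open Classical

noncomputable section

/-- The number of maps `f` from the (indexed) parts of `mu` to the parts of `lam` such that for
every part `lam_i` of `lam`, the sum of the parts of `mu` in the fibre `f⁻¹(i)` equals `lam_i`.
This is `|𝓜_{λμ}|` and also the value of the permutation character `h_λ` on the class of cycle
type `μ`. -/
def Mcount (lam mu : Multiset ℕ) : ℕ :=
  Fintype.card {f : Fin (Multiset.card mu) → Fin (Multiset.card lam) //
    ∀ i : Fin (Multiset.card lam),
      (∑ j ∈ Finset.univ.filter (fun j => f j = i), (mu.sort (· ≤ ·)).getD j 0)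
        = (lam.sort (· ≤ ·)).getD i 0}

/-- `z_λ = ∏_i i^{m_i(λ)} m_i(λ)!`. -/
def zMult (lam : Multiset ℕ) : ℕ :=
  ∏ i ∈ lam.toFinset, i ^ lam.count i * (lam.count i).factorial

/-- The cycle type of a permutation of `Fin n`, as the multiset of parts of a partition of `n`
(including the parts equal to `1` corresponding to fixed points). -/
def cycM {n : ℕ} (g : Equiv.Perm (Fin n)) : Multiset ℕ :=
  g.cycleType + Multiset.replicate (n - g.support.card) 1

/-- The value of the irreducible character `s_λ` of the symmetric group on the conjugacy class
of cycle type `nu`, given by the Jacobi–Trudi determinant `s_λ = det(h_{λ_i - i + j})_{i,j}`,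
where `h_α` has value `Mcount α ν` on the class of cycle type `ν`. -/
def sval (lam nu : Multiset ℕ) : ℚ :=
  let L := (lam.sort (· ≤ ·)).reverse
  let l := Multiset.card lam
  ∑ σ : Equiv.Perm (Fin l),
    ((Equiv.Perm.sign σ : ℤ) : ℚ) *
      (if ∀ i : Fin l, (i : ℕ) ≤ L.getD i 0 + (σ i : ℕ) then
        (Mcount ((Multiset.map (fun i : Fin l => L.getD i 0 + (σ i : ℕ) - (i : ℕ))
            (Finset.univ.val : Multiset (Fin l))).filter (fun x => x ≠ 0)) nu : ℚ)
       else 0)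

/-- The irreducible character of `S_n` labelled by the partition `lam`, as a class function on
the symmetric group `S_n = Perm (Fin n)`. -/
def sFun {n : ℕ} (lam : Nat.Partition n) : Equiv.Perm (Fin n) → ℚ :=
  fun g => sval lam.parts (cycM g)

/-- The usual scalar product of class functions on a finite group:
`⟨f, h⟩ = |G|⁻¹ ∑_{g ∈ G} f(g) h(g⁻¹)`. -/
def sp {G : Type*} [Group G] [Fintype G] (f h : G → ℚ) : ℚ :=
  (Fintype.card G : ℚ)⁻¹ * ∑ g : G, f g * h g⁻¹

/-- Two square matrices over `ℚ` (with possibly differently labelled index sets) are equivalent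
over `ℤ` if one is obtained from the other by left and right multiplication by matrices
invertible over `ℤ`. -/
def IntEquiv {T D : Type*} [Fintype T] [Fintype D] [DecidableEq T] [DecidableEq D]
    (A : Matrix T T ℚ) (B : Matrix D D ℚ) : Prop :=
  ∃ (e : T ≃ D) (U V : Matrix T T ℤ), IsUnit U ∧ IsUnit V ∧
    (U.map (fun x : ℤ => (x : ℚ))) * A * (V.map (fun x : ℤ => (x : ℚ))) = B.submatrix e e

/-- The induced class function along an injection `ι : H → G` (underlying a subgroup inclusion):
`Ind φ (g) = |H|⁻¹ ∑_{x ∈ G} ∑_{h ∈ H, ι(h) = x g x⁻¹} φ(h)`. -/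
def IndFun {H G : Type*} [Fintype H] [Fintype G] [Group G] (ι : H → G) (φ : H → ℚ) :
    G → ℚ :=
  fun g => (Fintype.card H : ℚ)⁻¹ * ∑ x : G, ∑ h : H, if ι h = x * g * x⁻¹ then φ h else 0

/-- A bijection `Σ_i Fin (w_i) ≃ Fin w` when `∑_i w_i = w`, realising `Fin w` as the disjoint
union of blocks of sizes `w_i`. -/
def embSigma {η : Type*} [Fintype η] (ws : η → ℕ) {w : ℕ} (h : ∑ i, ws i = w) :
    (Σ i, Fin (ws i)) ≃ Fin w :=
  Fintype.equivOfCardEq (by simp [h])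

/-- The wreath product `G ≀ S_w`: pairs `(x; σ)` with `x : Fin w → G`, `σ ∈ S_w`, and
multiplication `(x; σ)(y; τ) = (i ↦ x_i y_{σ⁻¹(i)}; στ)`. -/
def Wr (G : Type*) (w : ℕ) : Type _ := (Fin w → G) × Equiv.Perm (Fin w)

instance (G : Type*) [Fintype G] (w : ℕ) : Fintype (Wr G w) :=
  inferInstanceAs (Fintype ((Fin w → G) × Equiv.Perm (Fin w)))

section WrGroup

variable {G : Type*} [Group G] {w : ℕ}

instance : Mul (Wr G w) := ⟨fun a b => (fun i => a.1 i * b.1 (a.2⁻¹ i), a.2 * b.2)⟩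
instance : One (Wr G w) := ⟨((fun _ => 1), 1)⟩
instance : Inv (Wr G w) := ⟨fun a => (fun i => (a.1 (a.2 i))⁻¹, a.2⁻¹)⟩

instance : Group (Wr G w) :=
  Group.ofLeftAxioms
    (by
      rintro ⟨x, σ⟩ ⟨y, τ⟩ ⟨z, ρ⟩
      refine Prod.ext ?_ (mul_assoc σ τ ρ)
      funext i
      show x i * y (σ⁻¹ i) * z ((σ * τ)⁻¹ i) = x i * (y (σ⁻¹ i) * z (τ⁻¹ (σ⁻¹ i)))
      rw [mul_assoc, mul_inv_rev]
      rfl)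
    (by
      rintro ⟨x, σ⟩
      refine Prod.ext ?_ (one_mul σ)
      funext i
      show 1 * x ((1 : Equiv.Perm (Fin w))⁻¹ i) = x i
      simp)
    (by
      rintro ⟨x, σ⟩
      refine Prod.ext ?_ (inv_mul_cancel σ)
      funext i
      show (x (σ i))⁻¹ * x ((σ⁻¹)⁻¹ i) = 1
      simp)

end WrGroup

/-- The product `x_i · x_{σ⁻¹(i)} ⋯ x_{σ^{-(n-1)}(i)}` along the cycle of `σ` through `i`
(`n` being the length of that cycle). -/
def cycleProd {G : Type*} [Group G] {w : ℕ} (x : Fin w → G) (σ : Equiv.Perm (Fin w))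
    (i : Fin w) : G :=
  ((List.range (Finset.univ.filter (fun j => σ.SameCycle i j)).card).map
    (fun k => x ((σ⁻¹ ^ k) i))).prod

/-- The minimal representatives of the cycles of `σ` (one point in the support of each cycle,
including `1`-cycles). -/
def basepoints {w : ℕ} (σ : Equiv.Perm (Fin w)) : Finset (Fin w) :=
  Finset.univ.filter (fun i => ∀ j, σ.SameCycle i j → i ≤ j)

/-- The class function `φ^{∼⊗w}` on `G ≀ S_w`: its value on an element equivalent to
`y_{σ_1}(x_1) ⋯ y_{σ_n}(x_n)` is `φ(x_1) ⋯ φ(x_n)`. -/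
def tilprod {G : Type*} [Group G] {w : ℕ} (φ : G → ℚ) (g : Wr G w) : ℚ :=
  ∏ i ∈ basepoints g.2, φ (cycleProd g.1 g.2 i)

/-- The embedding of `∏_i (G ≀ S_{w_i})` into `G ≀ S_w` (as the underlying function of the
block-diagonal group embedding). -/
def embWr {G : Type*} [Group G] {η : Type*} [Fintype η] (ws : η → ℕ) {w : ℕ}
    (h : ∑ i, ws i = w) (g : ∀ i, Wr G (ws i)) : Wr G w :=
  ((fun j => (g ((embSigma ws h).symm j).1).1 ((embSigma ws h).symm j).2),
   ((embSigma ws h).symm.trans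
      ((Equiv.sigmaCongrRight (fun i => ((g i).2 : Fin (ws i) ≃ Fin (ws i)))).trans
        (embSigma ws h))))

/-- The class function `ζ_Ξ` on `G ≀ S_w` attached to a tuple `Ξ = ((φ_i, f_i))_i` with
`φ_i ∈ CF(G)` and `f_i ∈ CF(S_{w_i})`:
`ζ_Ξ = Ind_{∏_i G≀S_{w_i}}^{G≀S_w} ⊗_i (φ_i^{∼⊗w_i} · Inf f_i)`. -/
def zetaTuple {G : Type*} [Group G] [Fintype G] {η : Type*} [Fintype η] (ws : η → ℕ)
    {w : ℕ} (h : ∑ i, ws i = w) (φs : η → (G → ℚ))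
    (fs : ∀ i, Equiv.Perm (Fin (ws i)) → ℚ) : Wr G w → ℚ :=
  IndFun (embWr ws h) (fun g => ∏ i, tilprod (φs i) (g i) * fs i (g i).2)

/-- The type of all partitions (of arbitrary natural numbers). -/
abbrev PttAll : Type := Σ n : ℕ, Nat.Partition n

/-- Partitions of size at most `w`, with bounded first component (a finite type). -/
abbrev PBP (w : ℕ) : Type := (m : Fin (w + 1)) × Nat.Partition m

/-- `PMap_w(T)`: the (finite) set of maps from `T` to partitions, of total size `w`. -/
abbrev PMapw (T : Type*) [Fintype T] (w : ℕ) : Type _ :=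
  {lam : T → PBP w // ∑ t, ((lam t).1 : ℕ) = w}

/-- The multiset of beta-numbers of a partition, displayed with `N` beads:
`β_i = λ_i + N - i` for `1 ≤ i ≤ N` (where `λ_i = 0` for `i > l(λ)`). -/
def betaSet (lam : Multiset ℕ) (N : ℕ) : Multiset ℕ :=
  Multiset.ofList ((List.range N).map
    (fun i => ((lam.sort (· ≤ ·)).reverse).getD i 0 + N - 1 - i))

/-- Two partitions have the same `ℓ`-core if and only if their beta-sets (displayed with a
common number of beads) have equal multisets of residues modulo `ℓ`. -/
def sameCore (l : ℕ) (lam rho : Multiset ℕ) : Prop :=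
  (betaSet lam (Multiset.card lam + Multiset.card rho)).map (· % l)
    = (betaSet rho (Multiset.card lam + Multiset.card rho)).map (· % l)

/-- `ρ` is an `ℓ`-core: no rim `ℓ`-hook can be removed, i.e. for every beta-number `b ≥ ℓ` of
`ρ`, `b - ℓ` is again a beta-number. -/
def IsCore (l : ℕ) (rho : Multiset ℕ) : Prop :=
  ∀ b ∈ betaSet rho (Multiset.card rho), l ≤ b → b - l ∈ betaSet rho (Multiset.card rho)

/-- `g ∈ S_n` is `ℓ`-singular: its cycle decomposition contains a cycle of length divisible
by `ℓ`. -/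
def IsSingular (l : ℕ) {n : ℕ} (g : Equiv.Perm (Fin n)) : Prop :=
  ∃ j ∈ cycM g, l ∣ j

/-- The `ℤ`-submodule of functions on `S_n` vanishing on all `ℓ`-singular elements. -/
def VanishSub (l n : ℕ) : Submodule ℤ (Equiv.Perm (Fin n) → ℚ) where
  carrier := {f | ∀ g, IsSingular l g → f g = 0}
  add_mem' := by
    intro f g hf hg x hx
    have h1 : f x = 0 := hf x hx
    have h2 : g x = 0 := hg x hx
    simp [Pi.add_apply, h1, h2]
  zero_mem' := by intro x _; rfl
  smul_mem' := by
    intro c f hf x hx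
    have h1 : f x = 0 := hf x hx
    simp [Pi.smul_apply, h1]

/-- `𝒞(S_n) = ℤ[Irr(S_n)]`: the `ℤ`-span of the irreducible characters of `S_n`. -/
def VirtCharS (n : ℕ) : Submodule ℤ (Equiv.Perm (Fin n) → ℚ) :=
  Submodule.span ℤ (Set.range (fun lam : Nat.Partition n => sFun lam))

/-- `𝒞(S_n, ρ) = ℤ[Irr(S_n, ρ)]`: the `ℤ`-span of the irreducible characters `s_λ` with the
`ℓ`-core of `λ` equal to `ρ`. -/
def CBlock (l n : ℕ) (rho : Multiset ℕ) : Submodule ℤ (Equiv.Perm (Fin n) → ℚ) :=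
  Submodule.span ℤ ((fun lam : Nat.Partition n => sFun lam) ''
    {lam | IsCore l rho ∧ sameCore l lam.parts rho})

/-- The hook partition `(ℓ-i, 1^i)` of `ℓ`. -/
def hookPartition (l i : ℕ) (h : i < l) : Nat.Partition l where
  parts := (l - i) ::ₘ Multiset.replicate i 1
  parts_pos := by
    intro j hj
    rcases Multiset.mem_cons.mp hj with h1 | h2
    · omega
    · have := Multiset.eq_of_mem_replicate h2
      omega
  parts_sum := by
    simp [Multiset.sum_cons, Multiset.sum_replicate, smul_eq_mul]
    omega

/-- `β_i = s_{(ℓ-i, 1^i)} + s_{(ℓ-i-1, 1^{i+1})}` for `0 ≤ i ≤ ℓ-2`, as a class function on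
`S_ℓ`. -/
def betaChar (l : ℕ) (i : Fin (l - 1)) : Equiv.Perm (Fin l) → ℚ :=
  sFun (hookPartition l i (by have := i.isLt; omega))
    + sFun (hookPartition l ((i : ℕ) + 1) (by have := i.isLt; omega))

namespace CB

section hs
variable {A B : Type*} [CommRing A] [Algebra ℚ A] [CommRing B] [Algebra ℚ B]

/-- Complete homogeneous functions from power sums `P k = p_{k+1}`. -/
def hs (P : ℕ → A) : ℕ → A
  | 0 => 1
  | n + 1 => ((n + 1 : ℚ)⁻¹) • ∑ k : Fin (n + 1), P k * hs P (n - k)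
termination_by n => n
decreasing_by omega

lemma hs_zero (P : ℕ → A) : hs P 0 = 1 := by rw [hs]

lemma hs_succ (P : ℕ → A) (n : ℕ) :
    ((n + 1 : ℚ)) • hs P (n + 1) = ∑ k ∈ Finset.range (n + 1), P k * hs P (n - k) := by
  rw [hs, smul_smul, mul_inv_cancel₀ (by positivity), one_smul,
    Finset.sum_range (fun k => P k * hs P (n - k))]

lemma hs_unique (P : ℕ → A) (f : ℕ → A) (h0 : f 0 = 1)
    (hf : ∀ n : ℕ, ((n + 1 : ℚ)) • f (n + 1) = ∑ k ∈ Finset.range (n + 1), P k * f (n - k)) :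
    ∀ n, f n = hs P n := by
  intro n
  induction n using Nat.strong_induction_on with
  | _ n ih =>
    rcases n with _ | n
    · rw [h0, hs_zero]
    · have h1 : ((n + 1 : ℚ)) • f (n + 1) = ((n + 1 : ℚ)) • hs P (n + 1) := by
        rw [hf, hs_succ]
        refine Finset.sum_congr rfl fun k hk => ?_
        rw [ih (n - k) (by omega)]
      have h2 := congrArg (fun x => ((n + 1 : ℚ)⁻¹) • x) h1
      simpa [smul_smul, inv_mul_cancel₀ (show (n + 1 : ℚ) ≠ 0 by positivity)] using h2

lemma hs_map (φ : A →ₐ[ℚ] B) (P : ℕ → A) (n : ℕ) : φ (hs P n) = hs (fun k => φ (P k)) n := by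
  refine hs_unique (fun k => φ (P k)) (fun n => φ (hs P n)) (by simp [hs_zero]) ?_ n
  intro n
  rw [← map_smul, hs_succ]
  simp

/-- generating series -/
def Hser (P : ℕ → A) : PowerSeries A := PowerSeries.mk (hs P)

lemma Hser_deriv (P : ℕ → A) :
    PowerSeries.derivative A (Hser P) = PowerSeries.mk P * Hser P := by
  ext n
  rw [PowerSeries.coeff_derivative, PowerSeries.coeff_mul, Finset.Nat.sum_antidiagonal_eq_sum_range_succ_mk]
  simp only [Hser, PowerSeries.coeff_mk]
  rw [← hs_succ, Algebra.smul_def, mul_comm]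
  simp

lemma hs_of_deriv (P : ℕ → A) (G : PowerSeries A) (h0 : PowerSeries.coeff 0 G = 1)
    (h : PowerSeries.derivative A G = PowerSeries.mk P * G) (n : ℕ) :
    PowerSeries.coeff n G = hs P n := by
  refine hs_unique P (fun n => PowerSeries.coeff n G) h0 ?_ n
  intro n
  have := congrArg (PowerSeries.coeff n) h
  rw [PowerSeries.coeff_derivative, PowerSeries.coeff_mul, Finset.Nat.sum_antidiagonal_eq_sum_range_succ_mk] at this
  simp only [PowerSeries.coeff_mk] at this
  rw [← this, Algebra.smul_def, mul_comm]
  simp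

lemma hs_add (P Q : ℕ → A) (n : ℕ) :
    hs (P + Q) n = ∑ x ∈ Finset.HasAntidiagonal.antidiagonal n, hs P x.1 * hs Q x.2 := by
  rw [← hs_of_deriv (P + Q) (Hser P * Hser Q) ?_ ?_ n]
  · rw [PowerSeries.coeff_mul]; simp [Hser]
  · rw [PowerSeries.coeff_mul]; simp [Hser, hs_zero]
  · rw [Derivation.leibniz, Hser_deriv, Hser_deriv]
    have : PowerSeries.mk (P + Q) = PowerSeries.mk P + PowerSeries.mk Q := by ext; simp
    rw [this]; simp only [smul_eq_mul]; ring

lemma hs_zero_fun (n : ℕ) : hs (0 : ℕ → A) (n + 1) = 0 := by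
  refine (hs_unique (0 : ℕ → A) (fun n => if n = 0 then 1 else 0) (by simp) ?_ (n+1)).symm.trans (by simp)
  intro n; simp

/-- extension to integer indices -/
def hz (P : ℕ → A) (n : ℤ) : A := if n < 0 then 0 else hs P n.toNat

lemma hz_neg (P : ℕ → A) {n : ℤ} (h : n < 0) : hz P n = 0 := if_pos h
lemma hz_nat (P : ℕ → A) (n : ℕ) : hz P (n : ℤ) = hs P n := by simp [hz]
lemma hz_zero (P : ℕ → A) : hz P 0 = 1 := by simp [hz, hs_zero]
lemma hz_map (φ : A →ₐ[ℚ] B) (P : ℕ → A) (n : ℤ) : φ (hz P n) = hz (fun k => φ (P k)) n := by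
  unfold hz; split_ifs <;> simp [hs_map]

lemma hz_rec (P : ℕ → A) (n : ℕ) (N : ℕ) (hN : n ≤ N) :
    (n : ℚ) • hz P (n : ℤ) = ∑ k ∈ Finset.range N, P k * hz P ((n : ℤ) - (k + 1)) := by
  have : ∑ k ∈ Finset.range N, P k * hz P ((n : ℤ) - (k + 1))
      = ∑ k ∈ Finset.range n, P k * hz P ((n : ℤ) - (k + 1)) := by
    symm
    apply Finset.sum_subset
    · intro x; simp; omega
    · intro x hx hx'
      simp at hx hx'
      rw [hz_neg _ (by omega), mul_zero]
  rw [this]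
  rcases n with _ | n
  · simp
  · rw [hz_nat]
    have := hs_succ P n
    push_cast at this ⊢
    rw [this]
    refine Finset.sum_congr rfl fun k hk => ?_
    simp at hk
    congr 1
    rw [← hz_nat]; congr 1; omega

lemma hz_der_zero (D : Derivation ℚ A A) (P : ℕ → A) (h : ∀ j, D (P j) = 0) (n : ℤ) :
    D (hz P n) = 0 := by
  by_cases hn : n < 0
  · rw [hz_neg _ hn, map_zero]
  · obtain ⟨n, rfl⟩ := Int.eq_ofNat_of_zero_le (not_lt.mp hn)
    induction n using Nat.strong_induction_on with
    | _ n ih =>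
      rcases n with _ | n
      · simp [hz_zero]
      · have h1 := congrArg D (hz_rec P (n+1) (n+1) le_rfl)
        rw [Derivation.map_smul, map_sum, Finset.sum_eq_zero] at h1
        · simpa [Nat.cast_add_one_ne_zero] using h1
        · intro k hk
          simp at hk
          rw [Derivation.leibniz, h k]
          have := ih (n - k) (by omega) (by omega)
          rw [show ((n+1 : ℕ) : ℤ) - (k + 1) = ((n - k : ℕ) : ℤ) by omega, this]
          simp

lemma hz_der (D : Derivation ℚ A A) (P : ℕ → A) (m : ℕ) (hm : 0 < m)
    (h : ∀ j, D (P j) = if j + 1 = m then (m : A) else 0) (n : ℤ) :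
    D (hz P n) = hz P (n - m) := by
  by_cases hn : n < 0
  · rw [hz_neg _ hn, map_zero, hz_neg _ (by omega)]
  · obtain ⟨n, rfl⟩ := Int.eq_ofNat_of_zero_le (not_lt.mp hn)
    induction n using Nat.strong_induction_on with
    | _ n ih =>
      rcases n with _ | n
      · simp only [Nat.cast_zero, hz_zero, Derivation.map_one_eq_zero]; rw [hz_neg _ (by omega)]
      · have h1 := congrArg D (hz_rec P (n+1) (n+1+m) (by omega))
        rw [Derivation.map_smul, map_sum] at h1
        have h2 : ∀ k ∈ Finset.range (n+1+m), D (P k * hz P (((n+1 : ℕ) : ℤ) - (k+1)))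
            = P k * hz P (((n+1 : ℕ) : ℤ) - m - (k+1))
              + (if k + 1 = m then (m : A) * hz P (((n+1:ℕ) : ℤ) - m) else 0) := by
          intro k hk
          rw [Derivation.leibniz, h k]
          have h3 : D (hz P (((n+1 : ℕ) : ℤ) - (k+1))) = hz P (((n+1 : ℕ) : ℤ) - m - (k+1)) := by
            by_cases hkn : k ≤ n
            · have := ih (n - k) (by omega) (by omega)
              rw [show ((n+1 : ℕ) : ℤ) - (k + 1) = ((n - k : ℕ) : ℤ) by omega, this]
              congr 1; omega
            · rw [hz_neg _ (by omega), hz_neg _ (by omega), map_zero]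
          rw [h3]
          split_ifs with hk
          · subst hk; simp only [smul_eq_mul]; push_cast; ring
          · simp
        rw [Finset.sum_congr rfl h2, Finset.sum_add_distrib] at h1
        have h4 : ∑ k ∈ Finset.range (n+1+m), (if k + 1 = m then (m : A) * hz P (((n+1:ℕ) : ℤ) - m) else 0)
            = (m : ℚ) • hz P (((n+1:ℕ) : ℤ) - m) := by
          rw [Finset.sum_eq_single_of_mem (m-1) (by simp; omega)]
          · rw [if_pos (by omega), Algebra.smul_def]; simp
          · intro b _ hb; rw [if_neg (by omega)]
        rw [h4] at h1
        by_cases hmn : m ≤ n + 1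
        · have h5 := hz_rec P (n+1-m) (n+1+m) (by omega)
          rw [show ((n+1-m : ℕ) : ℤ) = ((n+1:ℕ) : ℤ) - m by omega] at h5
          rw [← h5, ← add_smul] at h1
          rw [show ((n+1-m : ℕ) : ℚ) + m = ((n+1 : ℕ) : ℚ) by rw [Nat.cast_sub hmn]; ring] at h1
          have h2 := congrArg (fun x => (((n + 1 : ℕ) : ℚ)⁻¹) • x) h1
          simpa only [smul_smul, inv_mul_cancel₀ (show ((n + 1 : ℕ) : ℚ) ≠ 0 by positivity), one_smul] using h2
        · rw [hz_neg (n := ((n+1 : ℕ) : ℤ) - m) _ (by omega), smul_zero, add_zero, Finset.sum_eq_zero] at h1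
          · rw [hz_neg (n := ((n+1 : ℕ) : ℤ) - m) _ (by omega)]
            simpa [Nat.cast_add_one_ne_zero] using h1
          · intro k _
            rw [hz_neg _ (by omega), mul_zero]

end hs

end CB

namespace CB

open MvPolynomial in
/-- polynomial ring in coloured power sums, `X (k,c) = p_{k+1}` in colour `c` -/
abbrev R (η : Type*) := MvPolynomial (ℕ × η) ℚ

section basic
variable {η η' : Type*}

def pp (c : η) (k : ℕ) : R η := MvPolynomial.X (k, c)

def hc (c : η) (n : ℤ) : R η := hz (pp c) n

/-- the operator `p_n^⊥` in colour `c` -/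
def DD (x : ℕ × η) : Derivation ℚ (R η) (R η) := (x.1 : ℚ) • MvPolynomial.pderiv (x.1 - 1, x.2)

lemma DD_apply (x : ℕ × η) (F : R η) :
    DD x F = (x.1 : ℚ) • MvPolynomial.pderiv (x.1 - 1, x.2) F := rfl

lemma DD_hc (m : ℕ) (hm : 0 < m) (c c' : η) (n : ℤ) :
    DD (m, c) (hc c' n) = if c = c' then hc c' (n - m) else 0 := by
  split_ifs with h
  · subst h
    refine hz_der (DD (m, c)) _ m hm ?_ n
    intro j
    rw [DD_apply]
    simp only [pp]
    split_ifs with hj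
    · subst hj
      simp only [Nat.add_sub_cancel]
      rw [MvPolynomial.pderiv_X_self, MvPolynomial.smul_eq_C_mul]
      simp
    · rw [MvPolynomial.pderiv_X_of_ne, smul_zero]
      intro h; simp at h; omega
  · refine hz_der_zero (DD (m, c)) _ ?_ n
    intro j
    rw [DD_apply]
    simp only [pp]
    rw [MvPolynomial.pderiv_X_of_ne, smul_zero]
    intro h'; simp at h'; exact h h'.2.symm

lemma DD_comm (x y : ℕ × η) (F : R η) : DD x (DD y F) = DD y (DD x F) := by
  simp only [DD_apply, Derivation.map_smul]
  rw [smul_comm]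
  congr 2
  have : ⁅MvPolynomial.pderiv (R := ℚ) (x.1 - 1, x.2), MvPolynomial.pderiv (R := ℚ) (y.1 - 1, y.2)⁆ = 0 := by
    apply MvPolynomial.derivation_ext
    intro i
    rw [Derivation.commutator_apply, MvPolynomial.pderiv_X, MvPolynomial.pderiv_X]
    simp only [Pi.single_apply]
    split_ifs <;> simp
  have h2 := congrArg (fun D => D F) this
  simp only [Derivation.commutator_apply, Derivation.coe_zero, Pi.zero_apply] at h2
  exact sub_eq_zero.mp h2

instance : RightCommutative (fun (G : R η) (x : ℕ × η) => DD x G) :=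
  ⟨fun G x y => DD_comm _ _ _⟩

/-- value of (the class function attached to) `F` at a coloured cycle type -/
def val (F : R η) (ν : Multiset (ℕ × η)) : ℚ :=
  MvPolynomial.constantCoeff (ν.foldl (fun G x => DD x G) F)

lemma val_zero (F : R η) : val F 0 = MvPolynomial.constantCoeff F := by
  simp [val]

lemma val_cons (F : R η) (x : ℕ × η) (ν : Multiset (ℕ × η)) :
    val F (x ::ₘ ν) = val (DD x F) ν := by
  simp [val]

lemma val_add (F G : R η) (ν : Multiset (ℕ × η)) : val (F + G) ν = val F ν + val G ν := by
  induction ν using Multiset.induction_on generalizing F G with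
  | empty => simp [val_zero]
  | cons x ν ih => simp only [val_cons, map_add, ih]

lemma val_smul (a : ℚ) (F : R η) (ν : Multiset (ℕ × η)) : val (a • F) ν = a * val F ν := by
  induction ν using Multiset.induction_on generalizing F with
  | empty => simp [val_zero]
  | cons x ν ih => simp only [val_cons, Derivation.map_smul, ih]

def valL (ν : Multiset (ℕ × η)) : R η →ₗ[ℚ] ℚ where
  toFun F := val F ν
  map_add' F G := val_add F G ν
  map_smul' a F := val_smul a F ν

lemma val_sum {ι : Type*} (s : Finset ι) (F : ι → R η) (ν : Multiset (ℕ × η)) :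
    val (∑ i ∈ s, F i) ν = ∑ i ∈ s, val (F i) ν := map_sum (valL ν) F s

lemma val_z (ν : Multiset (ℕ × η)) : val (0 : R η) ν = 0 := map_zero (valL ν)

variable [Fintype η'] [Fintype η]

/-- averaging functional over (coloured) cycle types of weight `n` -/
def EE : ℕ → (Multiset (ℕ × η) → ℚ) → ℚ
  | 0, Φ => Φ 0
  | n + 1, Φ => ((n + 1 : ℚ)⁻¹) *
      ∑ k : Fin (n + 1), ∑ c : η, EE (n - k) (fun ν => Φ ((k.1 + 1, c) ::ₘ ν))
termination_by n => n
decreasing_by omega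

lemma EE_zero (Φ : Multiset (ℕ × η) → ℚ) : EE 0 Φ = Φ 0 := by rw [EE]

lemma EE_succ (n : ℕ) (Φ : Multiset (ℕ × η) → ℚ) : EE (n+1) Φ = ((n + 1 : ℚ)⁻¹) *
      ∑ k ∈ Finset.range (n + 1), ∑ c : η, EE (n - k) (fun ν => Φ ((k + 1, c) ::ₘ ν)) := by
  rw [EE, Finset.sum_range (fun k => ∑ c : η, EE (n - k) (fun ν => Φ ((k + 1, c) ::ₘ ν)))]

lemma EE_add (n : ℕ) (Φ Ψ : Multiset (ℕ × η) → ℚ) :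
    EE n (fun ν => Φ ν + Ψ ν) = EE n Φ + EE n Ψ := by
  induction n using Nat.strong_induction_on generalizing Φ Ψ with
  | _ n ih =>
    rcases n with _ | n
    · simp [EE_zero]
    · simp only [EE_succ]
      rw [← mul_add, ← Finset.sum_add_distrib]
      congr 1
      refine Finset.sum_congr rfl fun k hk => ?_
      rw [← Finset.sum_add_distrib]
      refine Finset.sum_congr rfl fun c _ => ?_
      exact ih _ (by omega) _ _

lemma EE_smul (n : ℕ) (a : ℚ) (Φ : Multiset (ℕ × η) → ℚ) :
    EE n (fun ν => a * Φ ν) = a * EE n Φ := by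
  induction n using Nat.strong_induction_on generalizing Φ with
  | _ n ih =>
    rcases n with _ | n
    · simp [EE_zero]
    · simp only [EE_succ]
      rw [mul_left_comm]
      congr 1
      rw [Finset.mul_sum]
      refine Finset.sum_congr rfl fun k hk => ?_
      rw [Finset.mul_sum]
      refine Finset.sum_congr rfl fun c _ => ?_
      exact ih _ (by omega) _

lemma EE_congr (n : ℕ) (Φ Ψ : Multiset (ℕ × η) → ℚ)
    (h : ∀ ν, (∀ x ∈ ν, 0 < x.1) → (ν.map Prod.fst).sum = n → Φ ν = Ψ ν) : EE n Φ = EE n Ψ := by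
  induction n using Nat.strong_induction_on generalizing Φ Ψ with
  | _ n ih =>
    rcases n with _ | n
    · simp only [EE_zero]; apply h <;> simp
    · simp only [EE_succ]
      congr 1
      refine Finset.sum_congr rfl fun k hk => ?_
      simp at hk
      refine Finset.sum_congr rfl fun c _ => ?_
      refine ih _ (by omega) _ _ ?_
      intro ν hν hs
      apply h
      · intro x hx
        rcases Multiset.mem_cons.mp hx with rfl | hx
        · simp
        · exact hν x hx
      · simp [hs]; omega

/-- the scalar product in degree `n` -/
def ip (n : ℕ) (F G : R η) : ℚ := EE n (fun ν => val F ν * val G ν)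

lemma ip_zero (F G : R η) :
    ip 0 F G = MvPolynomial.constantCoeff F * MvPolynomial.constantCoeff G := by
  simp [ip, EE_zero, val_zero]

lemma ip_succ (n : ℕ) (F G : R η) : ip (n+1) F G = ((n + 1 : ℚ)⁻¹) *
    ∑ k ∈ Finset.range (n + 1), ∑ c : η, ip (n - k) (DD (k+1, c) F) (DD (k+1,c) G) := by
  simp only [ip, EE_succ, val_cons]

lemma ip_comm (n : ℕ) (F G : R η) : ip n F G = ip n G F := by
  simp only [ip, mul_comm]

lemma ip_add_left (n : ℕ) (F F' G : R η) : ip n (F + F') G = ip n F G + ip n F' G := by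
  simp only [ip, val_add, add_mul, EE_add]

lemma ip_smul_left (n : ℕ) (a : ℚ) (F G : R η) : ip n (a • F) G = a * ip n F G := by
  simp only [ip, val_smul, mul_assoc, EE_smul]

def ipL (n : ℕ) (G : R η) : R η →ₗ[ℚ] ℚ where
  toFun F := ip n F G
  map_add' F F' := ip_add_left n F F' G
  map_smul' a F := ip_smul_left n a F G

lemma ip_sum_left {ι : Type*} (n : ℕ) (s : Finset ι) (F : ι → R η) (G : R η) :
    ip n (∑ i ∈ s, F i) G = ∑ i ∈ s, ip n (F i) G := map_sum (ipL n G) F s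

lemma ip_sum_right {ι : Type*} (n : ℕ) (s : Finset ι) (F : ι → R η) (G : R η) :
    ip n G (∑ i ∈ s, F i) = ∑ i ∈ s, ip n G (F i) := by
  simp only [ip_comm n G, ip_sum_left]

lemma ip_smul_right (n : ℕ) (a : ℚ) (F G : R η) : ip n F (a • G) = a * ip n F G := by
  rw [ip_comm, ip_smul_left, ip_comm]

lemma ip_zero_left (n : ℕ) (G : R η) : ip n 0 G = 0 := map_zero (ipL n G)

lemma ip_eq_zero_of_val (n : ℕ) (F G : R η)
    (h : ∀ ν, (∀ x ∈ ν, 0 < x.1) → (ν.map Prod.fst).sum = n → val F ν = 0) : ip n F G = 0 := by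
  have : ip n F G = ip n 0 G := by
    apply EE_congr
    intro ν h1 h2
    rw [h ν h1 h2, val_z]
  rw [this, ip_zero_left]

/-- substitution of colours along an integer matrix -/
def phi (B : Matrix η η' ℤ) : R η →ₐ[ℚ] R η' :=
  MvPolynomial.aeval (fun x => ∑ d : η', (B x.2 d : ℚ) • (MvPolynomial.X (x.1, d) : R η'))

lemma phi_X (B : Matrix η η' ℤ) (x : ℕ × η) :
    phi B (MvPolynomial.X x) = ∑ d : η', (B x.2 d : ℚ) • (MvPolynomial.X (x.1, d) : R η') := by
  simp [phi]

lemma DD_phi (B : Matrix η η' ℤ) (k : ℕ) (d : η') (F : R η) :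
    DD (k, d) (phi B F) = ∑ c : η, (B c d : ℚ) • phi B (DD (k, c) F) := by
  induction F using MvPolynomial.induction_on with
  | C a => simp [DD_apply, phi]
  | add F G hF hG => simp only [map_add, hF, hG, smul_add, Finset.sum_add_distrib]
  | mul_X F x hF =>
    rw [map_mul, Derivation.leibniz, hF]
    simp only [Derivation.leibniz, smul_eq_mul, map_add, map_mul, smul_add, Finset.sum_add_distrib]
    congr 1
    · have h1 : DD (k, d) (phi B (MvPolynomial.X x)) =
        ∑ c : η, (B c d : ℚ) • phi B (DD (k, c) (MvPolynomial.X x)) := by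
        rw [phi_X, map_sum]
        simp only [Derivation.map_smul, DD_apply, MvPolynomial.pderiv_X, Pi.single_apply]
        have e1 : ∀ d' : η', ((x.1, d') = (k - 1, d)) = (x.1 = k - 1 ∧ d' = d) := by
          intro d'; simp
        have e2 : ∀ c : η, (x = (k - 1, c)) = (x.1 = k - 1 ∧ c = x.2) := by
          intro c; ext; constructor
          · rintro rfl; simp
          · rintro ⟨h, rfl⟩; ext <;> simp [h]
        simp only [e1, e2]
        by_cases hx : x.1 = k - 1
        · simp only [hx, true_and]
          rw [Finset.sum_eq_single d, Finset.sum_eq_single x.2]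
          · simp
          · intro b _ hb; simp [hb]
          · simp
          · intro b _ hb; simp [hb]
          · simp
        · simp [hx]
      rw [h1, Finset.mul_sum]
      refine Finset.sum_congr rfl fun c _ => ?_
      rw [mul_smul_comm]
    · rw [Finset.mul_sum]
      refine Finset.sum_congr rfl fun c _ => ?_
      rw [mul_smul_comm]

lemma phi_hc (B : Matrix η η' ℤ) (c : η) (n : ℤ) :
    phi B (hc c n) = hz (∑ d : η', B c d • (pp d : ℕ → R η')) n := by
  rw [hc, hz_map]
  congr 1
  ext1 k
  rw [pp, phi_X]
  rw [Finset.sum_apply]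
  refine Finset.sum_congr rfl fun d _ => ?_
  rw [Pi.smul_apply, pp, Int.cast_smul_eq_zsmul]

lemma phi_comp {η'' : Type*} [Fintype η''] (B : Matrix η η' ℤ) (B' : Matrix η' η'' ℤ) (F : R η) :
    phi B' (phi B F) = phi (B * B') F := by
  have : (phi B').comp (phi B) = phi (B * B') := by
    apply MvPolynomial.algHom_ext
    intro x
    simp only [AlgHom.comp_apply, phi_X, map_sum, map_smul, Matrix.mul_apply, Int.cast_sum,
      Int.cast_mul, Finset.sum_smul, Finset.smul_sum, smul_smul]
    rw [Finset.sum_comm]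
  exact congrArg (fun f => f F) this

lemma phi_one (F : R η) : phi (1 : Matrix η η ℤ) F = F := by
  have : phi (1 : Matrix η η ℤ) = AlgHom.id ℚ _ := by
    apply MvPolynomial.algHom_ext
    intro x
    rw [phi_X, Finset.sum_eq_single x.2]
    · simp
    · intro b _ hb; simp [Matrix.one_apply_ne hb.symm]
    · simp
  rw [this]; rfl

end basic

section lat
variable (η : Type*)

/-- degree `w` part of the integral form generated by the complete functions -/
def Lat (w : ℕ) : Submodule ℤ (R η) :=
  Submodule.span ℤ {x | ∃ m : Multiset (ℕ × η), (m.map Prod.fst).sum = w ∧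
    x = (m.map (fun a => hs (pp a.2) a.1)).prod}

variable {η}

lemma Lat_one : (1 : R η) ∈ Lat η 0 := Submodule.subset_span ⟨0, by simp, by simp⟩

lemma Lat_mul {i j : ℕ} {a b : R η} (ha : a ∈ Lat η i) (hb : b ∈ Lat η j) : a * b ∈ Lat η (i + j) := by
  induction ha using Submodule.span_induction with
  | zero => simp
  | add x y _ _ hx hy => rw [add_mul]; exact add_mem hx hy
  | smul c x _ hx => rw [smul_mul_assoc]; exact Submodule.smul_mem _ _ hx
  | mem x hx =>
    obtain ⟨m, hm, rfl⟩ := hx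
    induction hb using Submodule.span_induction with
    | zero => simp
    | add x y _ _ hx hy => rw [mul_add]; exact add_mem hx hy
    | smul c x _ hx => rw [mul_smul_comm]; exact Submodule.smul_mem _ _ hx
    | mem x hx =>
      obtain ⟨m', hm', rfl⟩ := hx
      exact Submodule.subset_span ⟨m + m', by simp [hm, hm'], by simp⟩

def goodP (P : ℕ → R η) : Prop := ∀ n, hs P n ∈ Lat η n

lemma good_pp (c : η) : goodP (pp c) := fun n =>
  Submodule.subset_span ⟨{(n, c)}, by simp, by simp⟩

lemma good_zero : goodP (0 : ℕ → R η) := by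
  intro n
  rcases n with _ | n
  · rw [hs_zero]; exact Lat_one
  · rw [hs_zero_fun]; exact zero_mem _

lemma good_add {P Q : ℕ → R η} (hP : goodP P) (hQ : goodP Q) : goodP (P + Q) := by
  intro n
  rw [hs_add]
  refine sum_mem ?_
  rintro ⟨i, j⟩ hx
  rw [← Finset.HasAntidiagonal.mem_antidiagonal.mp hx]
  exact Lat_mul (hP i) (hQ j)

lemma good_neg {P : ℕ → R η} (hP : goodP P) : goodP (-P) := by
  intro n
  induction n using Nat.strong_induction_on with
  | _ n ih =>
    rcases n with _ | n
    · rw [hs_zero]; exact Lat_one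
    · have h := hs_add P (-P) (n+1)
      rw [add_neg_cancel, hs_zero_fun, Finset.Nat.sum_antidiagonal_succ, hs_zero, one_mul] at h
      rw [eq_neg_of_add_eq_zero_left h.symm]
      refine neg_mem (sum_mem ?_)
      rintro ⟨i, j⟩ hx
      have := Finset.HasAntidiagonal.mem_antidiagonal.mp hx
      rw [show n + 1 = (i + 1) + j by simp at this; omega]
      exact Lat_mul (hP _) (ih _ (by simp at this ⊢; omega))

def goodSub : AddSubgroup (ℕ → R η) where
  carrier := {P | goodP P}
  add_mem' := good_add
  zero_mem' := good_zero
  neg_mem' := good_neg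

lemma phi_Lat {η' : Type*} [Fintype η] [Fintype η'] (B : Matrix η η' ℤ) {w : ℕ} {F : R η}
    (hF : F ∈ Lat η w) : phi B F ∈ Lat η' w := by
  have key : ∀ (n : ℕ) (c : η), phi B (hs (pp c) n) ∈ Lat η' n := by
    intro n c
    have h1 := phi_hc B c n
    rw [hz_nat] at h1
    rw [hc, hz_nat] at h1
    rw [h1]
    have : (∑ d : η', B c d • (pp d : ℕ → R η')) ∈ goodSub :=
      sum_mem fun d _ => zsmul_mem (show pp d ∈ goodSub from good_pp d) _
    exact this n
  induction hF using Submodule.span_induction with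
  | zero => simp
  | add x y _ _ hx hy => rw [map_add]; exact add_mem hx hy
  | smul c x _ hx => rw [map_zsmul]; exact Submodule.smul_mem _ _ hx
  | mem x hx =>
    obtain ⟨m, hm, rfl⟩ := hx
    subst hm
    induction m using Multiset.induction_on with
    | empty => simpa using Lat_one
    | cons a m ih =>
      simp only [Multiset.map_cons, Multiset.prod_cons, Multiset.sum_cons, map_mul]
      exact Lat_mul (key _ _) ih

end lat

end CB

namespace CB

lemma der_prod {A : Type*} [CommRing A] [Algebra ℚ A] (D : Derivation ℚ A A) {ι : Type*}
    (s : Finset ι) (f : ι → A) :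
    D (∏ i ∈ s, f i) = ∑ i ∈ s, ∏ j ∈ s, (if j = i then D (f j) else f j) := by
  induction s using Finset.induction_on with
  | empty => simp
  | insert a s ha ih =>
    rw [Finset.prod_insert ha, Derivation.leibniz, ih, Finset.sum_insert ha, Finset.prod_insert ha,
      if_pos rfl, add_comm]
    congr 1
    · rw [smul_eq_mul, mul_comm]
      congr 1
      refine Finset.prod_congr rfl fun j hj => ?_
      rw [if_neg (by rintro rfl; exact ha hj)]
    · rw [smul_eq_mul, Finset.mul_sum]
      refine Finset.sum_congr rfl fun i hi => ?_
      rw [Finset.prod_insert ha, if_neg (by rintro rfl; exact ha hi)]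

lemma der_det {A : Type*} [CommRing A] [Algebra ℚ A] (D : Derivation ℚ A A) {I : Type*} [Fintype I]
    (M : Matrix I I A) :
    D M.det = ∑ i, (Matrix.of fun a b => if a = i then D (M a b) else M a b).det := by
  have h1 : ∀ N : Matrix I I A, N.det = ∑ σ : Equiv.Perm I,
      ((Equiv.Perm.sign σ : ℤ) : ℚ) • ∏ i, N i (σ i) := by
    intro N
    rw [← Matrix.det_transpose, Matrix.det_apply']
    refine Finset.sum_congr rfl fun σ _ => ?_
    rw [Algebra.smul_def]; simp
  rw [h1, map_sum]
  simp only [Derivation.map_smul, der_prod, Finset.smul_sum]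
  rw [Finset.sum_comm]
  refine Finset.sum_congr rfl fun i _ => ?_
  rw [h1]
  simp

section det
variable {η : Type*} {I : Type*} [Fintype I]

def TT (col : I → η) (pos : I → ℕ) (γ : I → ℤ) : R η :=
  (Matrix.of fun i j => if col i = col j then hc (col i) (γ i - pos j) else 0 : Matrix I I (R η)).det

structure Good (col : I → η) (pos : I → ℕ) : Prop where
  inj : ∀ i j, col i = col j → pos i = pos j → i = j
  lt : ∀ i, pos i < (Finset.univ.filter fun j => col j = col i).card
  surj : ∀ i, ∀ m < (Finset.univ.filter fun j => col j = col i).card,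
    ∃ j, col j = col i ∧ pos j = m

variable {col : I → η} {pos : I → ℕ}

lemma TT_neg (γ : I → ℤ) (i : I) (h : γ i < 0) : TT col pos γ = 0 := by
  refine Matrix.det_eq_zero_of_row_eq_zero i ?_
  intro j
  simp only [Matrix.of_apply]
  split_ifs
  · exact hz_neg _ (by omega)
  · rfl

lemma TT_perm (γ : I → ℤ) (π : Equiv.Perm I) (hπ : ∀ i, col (π i) = col i) :
    TT col pos (fun i => γ (π i)) = ((Equiv.Perm.sign π : ℤ) : ℚ) • TT col pos γ := by
  have := Matrix.det_permute π
    (Matrix.of fun i j => if col i = col j then hc (col i) (γ i - pos j) else 0 : Matrix I I (R η))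
  rw [Algebra.smul_def]
  simp only [map_intCast]
  unfold TT
  rw [← this]
  congr 1
  ext1 i j
  simp [hπ]

lemma TT_eq_zero (γ : I → ℤ) (i j : I) (hij : i ≠ j) (hc' : col i = col j) (h : γ i = γ j) :
    TT col pos γ = 0 := by
  refine Matrix.det_zero_of_row_eq hij ?_
  ext1 a
  simp [hc', h]

lemma TT_DD (k : ℕ) (hk : 0 < k) (c : η) (γ : I → ℤ) :
    DD (k, c) (TT col pos γ) =
      ∑ i, if col i = c then TT col pos (fun a => if a = i then γ a - k else γ a) else 0 := by
  unfold TT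
  rw [der_det]
  refine Finset.sum_congr rfl fun i _ => ?_
  split_ifs with h
  · congr 1
    ext1 a b
    simp only [Matrix.of_apply]
    by_cases ha : a = i
    · subst ha
      rw [if_pos rfl, if_pos rfl]
      by_cases hab : col a = col b
      · rw [if_pos hab, if_pos hab, DD_hc _ hk, if_pos h.symm]; congr 1; ring
      · rw [if_neg hab, if_neg hab]; exact map_zero _
    · rw [if_neg ha, if_neg ha]
  · refine Matrix.det_eq_zero_of_row_eq_zero i ?_
    intro b
    simp only [Matrix.of_apply, if_pos]
    split_ifs with hab
    · rw [DD_hc _ hk, if_neg (fun h' => h h'.symm)]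
    · simp

lemma const_hc (c : η) (n : ℤ) : MvPolynomial.constantCoeff (hc c n) = if n = 0 then 1 else 0 := by
  by_cases hn : n < 0
  · rw [hc, hz_neg _ hn, if_neg (by omega), map_zero]
  · obtain ⟨n, rfl⟩ := Int.eq_ofNat_of_zero_le (not_lt.mp hn)
    rw [hc, hz_nat]
    have : ∀ F : R η, MvPolynomial.constantCoeff F = MvPolynomial.aeval (R := ℚ) (fun _ => (0:ℚ)) F := by
      intro F
      have := MvPolynomial.aeval_zero (R := ℚ) (S₁ := ℚ) F
      simpa using this.symm
    rw [this, hs_map]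
    have h2 : (fun k => MvPolynomial.aeval (R := ℚ) (fun _ => (0:ℚ)) (pp c k)) = (0 : ℕ → ℚ) := by
      ext k; simp [pp]
    rw [h2]
    rcases n with _ | n
    · simp [hs_zero]
    · rw [hs_zero_fun, if_neg (by omega)]

lemma const_TT (γ : I → ℤ) : MvPolynomial.constantCoeff (TT col pos γ) =
    (Matrix.of fun i j => if col i = col j ∧ γ i = pos j then (1:ℚ) else 0 : Matrix I I ℚ).det := by
  unfold TT
  rw [RingHom.map_det]
  congr 1
  ext1 i j
  simp only [RingHom.mapMatrix_apply, Matrix.map_apply, Matrix.of_apply]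
  by_cases h : col i = col j
  · simp only [h, if_true, true_and, const_hc, sub_eq_zero]
  · simp [h]

lemma const_TT_pos (hg : Good col pos) :
    MvPolynomial.constantCoeff (TT col pos (fun i => (pos i : ℤ))) = 1 := by
  rw [const_TT]
  convert Matrix.det_one (n := I) (R := ℚ) using 2
  ext1 i j
  simp only [Matrix.of_apply, Matrix.one_apply, Nat.cast_inj]
  by_cases h : i = j
  · simp [h]
  · rw [if_neg h, if_neg]; rintro ⟨h1, h2⟩; exact h (hg.inj _ _ h1 h2)

/-- signed count of colour preserving permutations taking `γ` to `γ'` -/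
def dl' (col : I → η) (γ γ' : I → ℤ) : ℚ :=
  ∑ π : Equiv.Perm I, if (∀ i, col (π i) = col i) ∧ (∀ i, γ' i = γ (π i)) then
    ((Equiv.Perm.sign π : ℤ) : ℚ) else 0

def dl (col : I → η) (γ γ' : I → ℤ) : ℚ := if ∀ i, 0 ≤ γ i then dl' col γ γ' else 0

lemma dl'_perm (γ γ' : I → ℤ) (τ : Equiv.Perm I) (hτ : ∀ i, col (τ i) = col i) :
    dl' col (fun i => γ (τ i)) γ' = ((Equiv.Perm.sign τ : ℤ) : ℚ) * dl' col γ γ' := by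
  unfold dl'
  rw [Finset.mul_sum]
  refine Fintype.sum_equiv (Equiv.mulLeft τ) _ _ ?_
  intro π
  simp only [Equiv.coe_mulLeft, Equiv.Perm.mul_apply, hτ, mul_ite, mul_zero, Equiv.Perm.sign_mul]
  congr 1
  push_cast
  rw [← mul_assoc, ← Int.cast_mul, Int.units_coe_mul_self]; simp

lemma dl'_eq_zero (γ γ' : I → ℤ) (i j : I) (hij : i ≠ j) (hc' : col i = col j) (h : γ i = γ j) :
    dl' col γ γ' = 0 := by
  have h1 := dl'_perm (col := col) γ γ' (Equiv.swap i j) (by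
    intro a; rw [Equiv.swap_apply_def]; split_ifs with h1 h2
    · rw [h1, hc']
    · rw [h2, hc']
    · rfl)
  have h2 : (fun a => γ (Equiv.swap i j a)) = γ := by
    ext a; rw [Equiv.swap_apply_def]; split_ifs with h1 h2
    · rw [h1, h]
    · rw [h2, h]
    · rfl
  rw [h2, Equiv.Perm.sign_swap hij] at h1
  push_cast at h1
  linarith

lemma dl'_symm (γ γ' : I → ℤ) : dl' col γ γ' = dl' col γ' γ := by
  unfold dl'
  refine Fintype.sum_equiv (Equiv.inv _) _ _ ?_
  intro π
  have : ((∀ i, col (π i) = col i) ∧ (∀ i, γ' i = γ (π i))) ↔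
    ((∀ i, col ((Equiv.inv _ π) i) = col i) ∧ (∀ i, γ i = γ' ((Equiv.inv _ π) i))) := by
    simp only [Equiv.inv_apply]
    constructor
    · rintro ⟨h1, h2⟩
      refine ⟨fun i => ?_, fun i => ?_⟩
      · have := h1 (π⁻¹ i); simpa using this.symm
      · rw [h2]; simp
    · rintro ⟨h1, h2⟩
      refine ⟨fun i => ?_, fun i => ?_⟩
      · have := h1 (π i); simpa using this.symm
      · rw [h2]; simp
  simp only [this]
  simp

lemma dl_symm (γ γ' : I → ℤ) : dl col γ γ' = dl col γ' γ := by
  unfold dl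
  by_cases h : dl' col γ γ' = 0
  · rw [← dl'_symm γ γ', h]; simp
  · have : ∃ π : Equiv.Perm I, (∀ i, γ' i = γ (π i)) := by
      by_contra hcon
      apply h
      unfold dl'
      refine Finset.sum_eq_zero fun π _ => ?_
      rw [if_neg]; rintro ⟨_, h2⟩; exact hcon ⟨π, h2⟩
    obtain ⟨π, hπ⟩ := this
    have : (∀ i, 0 ≤ γ i) ↔ (∀ i, 0 ≤ γ' i) := by
      constructor
      · intro h i; rw [hπ]; exact h _
      · intro h i; have := h (π⁻¹ i); rw [hπ] at this; simpa using this
    rw [dl'_symm]; simp only [this]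

lemma straight (hg : Good col pos) (γ : I → ℤ) (h0 : ∀ i, 0 ≤ γ i)
    (hinj : ∀ i j, col i = col j → γ i = γ j → i = j) (hs : ∑ i, γ i ≤ ∑ i, (pos i : ℤ)) :
    ∃ π : Equiv.Perm I, (∀ i, col (π i) = col i) ∧ ∀ i, γ i = pos (π i) := by
  let S : I → Finset I := fun i => Finset.univ.filter fun j => col j = col i ∧ γ j < γ i
  have hlt : ∀ i, (S i).card < (Finset.univ.filter fun j => col j = col i).card := by
    intro i
    apply Finset.card_lt_card
    refine ⟨fun j => by simp [S]; tauto, fun h => ?_⟩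
    have := h (show i ∈ _ by simp)
    simp [S] at this
  choose f hf1 hf2 using fun i => hg.surj i _ (hlt i)
  have hmono : ∀ i j, col i = col j → γ i < γ j → (S i).card < (S j).card := by
    intro i j hij hlt
    apply Finset.card_lt_card
    refine ⟨fun a => ?_, fun h => ?_⟩
    · simp only [S, Finset.mem_filter, Finset.mem_univ, true_and]
      rintro ⟨h1, h2⟩; exact ⟨h1.trans hij, h2.trans hlt⟩
    · have := h (show i ∈ _ by simp [S, hij, hlt])
      simp [S] at this
  have finj : Function.Injective f := by
    intro i j hij
    have hcol : col i = col j := by rw [← hf1 i, hij, hf1 j]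
    have hcard : (S i).card = (S j).card := by rw [← hf2 i, hij, hf2 j]
    rcases lt_trichotomy (γ i) (γ j) with h | h | h
    · have := hmono _ _ hcol h; omega
    · exact hinj _ _ hcol h
    · have := hmono _ _ hcol.symm h; omega
  let π : Equiv.Perm I := Equiv.ofBijective f (Finite.injective_iff_bijective.mp finj)
  refine ⟨π, hf1, ?_⟩
  have hle : ∀ i ∈ Finset.univ, ((pos (π i) : ℕ) : ℤ) ≤ γ i := by
    intro i _
    change ((pos (f i) : ℕ) : ℤ) ≤ _
    rw [hf2]
    have : (S i).card ≤ (Finset.range (γ i).toNat).card := by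
      apply Finset.card_le_card_of_injOn (fun j => (γ j).toNat)
      · intro j hj
        simp [S] at hj ⊢
        have := h0 j; omega
      · intro a ha b hb hab
        simp [S] at ha hb hab
        have h1 := h0 a; have h2 := h0 b
        exact hinj _ _ (ha.1.trans hb.1.symm) (by omega)
    simp at this
    have := h0 i; omega
  have hsum : ∑ i, ((pos (π i) : ℕ) : ℤ) = ∑ i, (pos i : ℤ) :=
    Equiv.sum_comp π (fun i => ((pos i : ℕ) : ℤ))
  have heq : ∑ i, ((pos (π i) : ℕ) : ℤ) = ∑ i, γ i :=
    le_antisymm (Finset.sum_le_sum hle) (by rw [hsum]; exact hs)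
  intro i
  exact ((Finset.sum_eq_sum_iff_of_le hle).mp heq i (Finset.mem_univ i)).symm

lemma low_noninj (hg : Good col pos) (γ : I → ℤ) (h0 : ∀ i, 0 ≤ γ i)
    (hs : ∑ i, γ i < ∑ i, (pos i : ℤ)) : ∃ i j, i ≠ j ∧ col i = col j ∧ γ i = γ j := by
  by_contra hcon
  push Not at hcon
  obtain ⟨π, -, h2⟩ := straight hg γ h0 (fun i j h1 h2 => by
    by_contra h3; exact hcon i j h3 h1 h2) hs.le
  have : ∑ i, γ i = ∑ i, (pos i : ℤ) := by
    rw [← Equiv.sum_comp π (fun i => ((pos i : ℕ) : ℤ))]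
    exact Finset.sum_congr rfl fun i _ => h2 i
  omega

lemma dl_low (hg : Good col pos) (γ γ' : I → ℤ)
    (hs : ∑ i, γ i < ∑ i, (pos i : ℤ)) : dl col γ γ' = 0 := by
  unfold dl
  split_ifs with h0
  · obtain ⟨i, j, h1, h2, h3⟩ := low_noninj hg γ h0 hs
    exact dl'_eq_zero _ _ i j h1 h2 h3
  · rfl

lemma dl_neg_right (γ γ' : I → ℤ) (i : I) (h : γ' i < 0) : dl col γ γ' = 0 := by
  rw [dl_symm, dl, if_neg]
  intro h'; have := h' i; omega

lemma orth_base [Fintype η] (hg : Good col pos) (γ γ' : I → ℤ) (h0 : ∀ i, 0 ≤ γ i) (h0' : ∀ i, 0 ≤ γ' i)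
    (hs : ∑ i, γ i = ∑ i, (pos i : ℤ)) (hs' : ∑ i, γ' i = ∑ i, (pos i : ℤ)) :
    ip 0 (TT col pos γ) (TT col pos γ') = dl' col γ γ' := by
  by_cases hi : ∀ i j, col i = col j → γ i = γ j → i = j
  swap
  · push Not at hi
    obtain ⟨i, j, h1, h2, h3⟩ := hi
    rw [TT_eq_zero γ i j h3 h1 h2, dl'_eq_zero γ γ' i j h3 h1 h2, ip_zero_left]
  by_cases hi' : ∀ i j, col i = col j → γ' i = γ' j → i = j
  swap
  · push Not at hi'
    obtain ⟨i, j, h1, h2, h3⟩ := hi'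
    rw [TT_eq_zero γ' i j h3 h1 h2, dl'_symm, dl'_eq_zero γ' γ i j h3 h1 h2, ip_comm, ip_zero_left]
  obtain ⟨π, h1, h2⟩ := straight hg γ h0 hi hs.le
  obtain ⟨π', h1', h2'⟩ := straight hg γ' h0' hi' hs'.le
  have e1 : γ = fun i => (fun a => ((pos a : ℕ) : ℤ)) (π i) := by ext i; exact h2 i
  have e1' : γ' = fun i => (fun a => ((pos a : ℕ) : ℤ)) (π' i) := by ext i; exact h2' i
  rw [e1, e1', TT_perm (fun a => ((pos a : ℕ) : ℤ)) _ h1, TT_perm (fun a => ((pos a : ℕ) : ℤ)) _ h1',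
    dl'_perm (fun a => ((pos a : ℕ) : ℤ)) _ _ h1, dl'_symm,
    dl'_perm (fun a => ((pos a : ℕ) : ℤ)) _ _ h1',
    ip_smul_left, ip_smul_right]
  congr 2
  rw [ip_zero, const_TT_pos hg, mul_one]
  unfold dl'
  rw [Finset.sum_eq_single 1]
  · simp
  · intro τ _ hτ
    rw [if_neg]
    rintro ⟨h3, h4⟩
    apply hτ
    ext1 i
    simp only [Nat.cast_inj] at h4
    exact hg.inj _ _ (h3 i) (h4 i).symm
  · simp

lemma pair_sum (g : ℤ → ℚ) (a b : ℕ) (hg : ∀ x, g ((a + b : ℤ) - x) = - g x) :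
    ∑ k ∈ Finset.range a, g k + ∑ k ∈ Finset.range b, g ((a + b : ℤ) - k) = - g a := by
  simp only [hg, Finset.sum_neg_distrib]
  have h1 : ∑ k ∈ Finset.range (a + b + 1), g k = 0 := by
    have := Finset.sum_range_reflect (fun k : ℕ => g k) (a + b + 1)
    have h2 : ∑ k ∈ Finset.range (a + b + 1), g ((a + b + 1 - 1 - k : ℕ) : ℤ)
        = - ∑ k ∈ Finset.range (a + b + 1), g k := by
      rw [← Finset.sum_neg_distrib]
      refine Finset.sum_congr rfl fun k hk => ?_
      simp at hk
      rw [← hg]; congr 1; omega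
    rw [h2] at this
    linarith
  have h3 : ∑ k ∈ Finset.range b, g k = ∑ k ∈ Finset.range (a+1), g k := by
    rw [show a + b + 1 = b + (a + 1) by ring, Finset.sum_range_add] at h1
    have h4 : ∑ x ∈ Finset.range (a+1), g ((b + x : ℕ) : ℤ) = - ∑ k ∈ Finset.range (a+1), g k := by
      rw [← Finset.sum_range_reflect (fun k : ℕ => g k) (a+1), ← Finset.sum_neg_distrib]
      refine Finset.sum_congr rfl fun k hk => ?_
      simp at hk
      rw [← hg]; congr 1; omega
    rw [h4] at h1; linarith
  rw [h3, Finset.sum_range_succ]; ring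

lemma pos_card (hg : Good col pos) (i : I) :
    (Finset.univ.filter fun j => col j = col i ∧ pos j < pos i).card = pos i := by
  conv_rhs => rw [← Finset.card_range (pos i)]
  refine Finset.card_bij (fun j _ => pos j) ?_ ?_ ?_
  · intro j hj; simp at hj ⊢; exact hj.2
  · intro a ha b hb h; simp at ha hb; exact hg.inj _ _ (ha.1.trans hb.1.symm) h
  · intro m hm
    simp at hm
    obtain ⟨j, h1, h2⟩ := hg.surj i m (hm.trans (hg.lt i))
    exact ⟨j, by simp [h1, h2, hm], h2⟩

/-- move `k` units from `i` to `j` -/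
def mv (γ : I → ℤ) (i j : I) (k : ℤ) : I → ℤ :=
  fun a => γ a - (if a = i then k else 0) + (if a = j then k else 0)

lemma mv_pair (f : (I → ℤ) → ℚ) (γ : I → ℤ) (i j : I) (hij : i ≠ j) (h0 : ∀ i, 0 ≤ γ i)
    (hf : ∀ δ : I → ℤ, f (fun a => δ (Equiv.swap i j a)) = - f δ) (K : ℕ) (hK : ∀ i, γ i ≤ K) :
    ∑ k ∈ Finset.range K, (if (k + 1 : ℤ) ≤ γ i then f (mv γ i j (k+1)) else 0)
    + ∑ k ∈ Finset.range K, (if (k + 1 : ℤ) ≤ γ j then f (mv γ j i (k+1)) else 0) = - f γ := by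
  obtain ⟨a, ha⟩ := Int.eq_ofNat_of_zero_le (h0 i)
  obtain ⟨b, hb⟩ := Int.eq_ofNat_of_zero_le (h0 j)
  have haK := hK i
  have hbK := hK j
  let g : ℤ → ℚ := fun x => f (mv γ i j (a - x))
  have hgs : ∀ x, g ((a + b : ℤ) - x) = - g x := by
    intro x
    simp only [g]
    rw [← hf]
    congr 1
    ext c
    simp only [mv, Equiv.swap_apply_def]
    by_cases h1 : c = i
    · subst h1; simp [hij, hij.symm, ha, hb]; ring
    · by_cases h2 : c = j
      · subst h2; simp [hij, hij.symm, ha, hb]; ring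
      · simp [h1, h2]
  have key := pair_sum g a b hgs
  have hga : g a = f γ := by
    simp only [g]; congr 1; ext c; simp [mv]
  rw [hga] at key
  rw [← key]
  congr 1
  · rw [← Finset.sum_range_reflect (fun k : ℕ => g k) a]
    refine (Finset.sum_subset (s₁ := Finset.range a) ?_ ?_).symm.trans ?_
    rotate_left 2
    · refine Finset.sum_congr rfl fun k hk => ?_
      simp at hk
      rw [if_pos (by omega)]
      simp only [g]
      congr 2; omega
    · intro x; simp; omega
    · intro k _ hk; simp at hk; rw [if_neg (by omega)]
  · rw [← Finset.sum_range_reflect (fun k : ℕ => g ((a + b : ℤ) - k)) b]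
    refine (Finset.sum_subset (s₁ := Finset.range b) ?_ ?_).symm.trans ?_
    rotate_left 2
    · refine Finset.sum_congr rfl fun k hk => ?_
      simp at hk
      rw [if_pos (by omega)]
      simp only [g]
      congr 1
      have : (a : ℤ) - (a + b - ((b - 1 - k : ℕ) : ℤ)) = -(k + 1) := by omega
      rw [this]
      ext c
      simp only [mv]
      split_ifs <;> ring
    · intro x; simp; omega
    · intro k _ hk; simp at hk; rw [if_neg (by omega)]

lemma mv_total (hg : Good col pos) (f : (I → ℤ) → ℚ) (γ : I → ℤ) (h0 : ∀ i, 0 ≤ γ i)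
    (hf : ∀ i j, i ≠ j → col i = col j → ∀ δ : I → ℤ, f (fun a => δ (Equiv.swap i j a)) = - f δ)
    (K : ℕ) (hK : ∀ i, γ i ≤ K) :
    ∑ i, ∑ j, (if col i = col j then
      ∑ k ∈ Finset.range K, (if (k + 1 : ℤ) ≤ γ i then f (mv γ i j (k+1)) else 0) else 0)
    = ((∑ i, γ i - ∑ i, (pos i : ℤ) : ℤ) : ℚ) * f γ := by
  set g : I → I → ℚ := fun i j => (if col i = col j then
      ∑ k ∈ Finset.range K, (if (k + 1 : ℤ) ≤ γ i then f (mv γ i j (k+1)) else 0) else 0) with hgdef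
  have hsplit : ∀ i j, g i j = (if i = j then (γ i : ℚ) * f γ else 0)
      + ((if col j = col i ∧ pos j < pos i then g i j else 0)
      + (if col i = col j ∧ pos i < pos j then g i j else 0)) := by
    intro i j
    by_cases hc' : col i = col j
    · by_cases hij : i = j
      · subst hij
        simp only [hgdef, if_true, lt_irrefl, and_false, if_false, add_zero]
        have hm : ∀ k : ℤ, mv γ i i k = γ := by intro k; ext a; simp [mv]
        simp only [hm]
        obtain ⟨a, ha⟩ := Int.eq_ofNat_of_zero_le (h0 i)
        have haK := hK i
        rw [← Finset.sum_subset (s₁ := Finset.range a)]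
        · rw [Finset.sum_congr rfl (g := fun _ => f γ)]
          · simp [ha]
          · intro k hk; simp at hk; rw [if_pos (by omega)]
        · intro x; simp; omega
        · intro k _ hk; simp at hk; rw [if_neg (by omega)]
      · have hne : pos i ≠ pos j := fun h => hij (hg.inj _ _ hc' h)
        rw [if_neg hij]
        rcases lt_or_gt_of_ne hne with h | h
        · simp [hc', h, h.le]
        · simp [hc', h, h.le]
    · have : i ≠ j := fun h => hc' (by rw [h])
      simp [hgdef, hc', this]
  rw [Finset.sum_congr rfl fun i _ => Finset.sum_congr rfl fun j _ => hsplit i j]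
  simp only [Finset.sum_add_distrib]
  have e1 : ∑ i, ∑ j, (if col i = col j ∧ pos i < pos j then g i j else 0)
      = ∑ i, ∑ j, (if col j = col i ∧ pos j < pos i then g j i else 0) := by
    rw [Finset.sum_comm]
  rw [e1, ← Finset.sum_add_distrib]
  have e2 : ∀ i, ((∑ j, (if col j = col i ∧ pos j < pos i then g i j else 0))
      + ∑ j, (if col j = col i ∧ pos j < pos i then g j i else 0)) = - (pos i : ℚ) * f γ := by
    intro i
    rw [← Finset.sum_add_distrib]
    have : ∀ j, ((if col j = col i ∧ pos j < pos i then g i j else 0)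
        + (if col j = col i ∧ pos j < pos i then g j i else 0))
        = if col j = col i ∧ pos j < pos i then - f γ else 0 := by
      intro j
      split_ifs with h
      · have hij : i ≠ j := by rintro rfl; omega
        simp only [hgdef, h.1, if_true]
        exact mv_pair f γ i j hij h0 (hf i j hij h.1.symm) K hK
      · simp
    rw [Finset.sum_congr rfl fun j _ => this j, ← Finset.sum_filter, Finset.sum_const, pos_card hg]
    simp
  rw [Finset.sum_congr rfl fun i _ => e2 i]
  simp only [Finset.sum_ite_eq, Finset.mem_univ, if_true]
  push_cast
  rw [sub_mul, Finset.sum_mul, Finset.sum_mul, ← Finset.sum_add_distrib, ← Finset.sum_sub_distrib]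
  refine Finset.sum_congr rfl fun i _ => ?_
  ring

lemma swap_col {i j : I} (h : col i = col j) (a : I) : col (Equiv.swap i j a) = col a := by
  rw [Equiv.swap_apply_def]; split_ifs with h1 h2
  · rw [h1, h]
  · rw [h2, h]
  · rfl

/-- `γ` decreased by `k` at `i` -/
def dn (γ : I → ℤ) (i : I) (k : ℤ) : I → ℤ := fun a => if a = i then γ a - k else γ a

lemma sum_dn (γ : I → ℤ) (i : I) (k : ℤ) : ∑ a, dn γ i k a = ∑ a, γ a - k := by
  have : ∀ a, dn γ i k a = γ a - if a = i then k else 0 := by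
    intro a; unfold dn; split_ifs <;> ring
  simp only [this, Finset.sum_sub_distrib, Finset.sum_ite_eq', Finset.mem_univ, if_true]

lemma dl'_adj (γ γ' : I → ℤ) (c : η) (k : ℤ) :
    ∑ j, (if col j = c then dl' col γ (dn γ' j k) else 0)
      = ∑ j, (if col j = c then dl' col (fun a => γ a + if a = j then k else 0) γ' else 0) := by
  unfold dl'
  have h1 : ∀ (j : I) (X : Equiv.Perm I → ℚ), (if col j = c then ∑ π : Equiv.Perm I, X π else 0)
      = ∑ π : Equiv.Perm I, if col j = c then X π else 0 := by
    intro j X; split_ifs <;> simp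
  simp only [h1]
  rw [Finset.sum_comm]
  conv_rhs => rw [Finset.sum_comm]
  refine Finset.sum_congr rfl fun π _ => ?_
  refine Fintype.sum_equiv π _ _ ?_
  intro j
  by_cases hπ : ∀ i, col (π i) = col i
  · rw [hπ j]
    have : (∀ i, dn γ' j k i = γ (π i)) ↔ (∀ i, γ' i = γ (π i) + if π i = π j then k else 0) := by
      refine forall_congr' fun i => ?_
      simp only [dn, π.injective.eq_iff]
      split_ifs <;> constructor <;> intro h <;> linarith
    simp only [this]
  · simp [hπ]

theorem orth [Fintype η] (hg : Good col pos) (m : ℕ) (γ γ' : I → ℤ)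
    (hs : ∑ i, γ i = m + ∑ i, (pos i : ℤ)) (hs' : ∑ i, γ' i = m + ∑ i, (pos i : ℤ)) :
    ip m (TT col pos γ) (TT col pos γ') = dl col γ γ' := by
  induction m using Nat.strong_induction_on generalizing γ γ' with
  | _ m ih =>
  by_cases h0 : ∀ i, 0 ≤ γ i
  swap
  · rw [dl, if_neg h0]
    push Not at h0
    obtain ⟨i, hi⟩ := h0
    rw [TT_neg γ i hi, ip_zero_left]
  by_cases h0' : ∀ i, 0 ≤ γ' i
  swap
  · push Not at h0'
    obtain ⟨i, hi⟩ := h0'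
    rw [TT_neg γ' i hi, ip_comm, ip_zero_left, dl_neg_right γ γ' i hi]
  rcases m with _ | m
  · rw [dl, if_pos h0, orth_base hg γ γ' h0 h0' (by simpa using hs) (by simpa using hs')]
  · rw [ip_succ]
    set K : ℕ := (∑ i, γ i).toNat + (m + 1) with hKdef
    have hK : ∀ i, γ i ≤ K := by
      intro i
      have := Finset.single_le_sum (f := γ) (fun i _ => h0 i) (Finset.mem_univ i)
      omega
    have step1 : ∀ k ∈ Finset.range (m+1), (∑ c : η, ip (m - k) (DD (k+1, c) (TT col pos γ))
        (DD (k+1, c) (TT col pos γ')))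
        = ∑ i, ∑ j, if col j = col i then dl col (dn γ i (k+1)) (dn γ' j (k+1)) else 0 := by
      intro k hk
      simp at hk
      have : ∀ c : η, ip (m - k) (DD (k+1, c) (TT col pos γ)) (DD (k+1, c) (TT col pos γ'))
        = ∑ i, if col i = c then ∑ j, (if col j = c then dl col (dn γ i (k+1)) (dn γ' j (k+1)) else 0) else 0 := by
        intro c
        rw [TT_DD _ (by omega), TT_DD _ (by omega), ip_sum_left]
        refine Finset.sum_congr rfl fun i _ => ?_
        split_ifs with hi
        · rw [ip_sum_right]
          refine Finset.sum_congr rfl fun j _ => ?_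
          split_ifs with hj
          · have := ih (m - k) (by omega) (dn γ i (k+1)) (dn γ' j (k+1))
              (by rw [sum_dn, hs]; push_cast; omega) (by rw [sum_dn, hs']; push_cast; omega)
            rw [← this]
            rfl
          · rw [ip_comm, ip_zero_left]
        · rw [ip_zero_left]
      rw [Finset.sum_congr rfl fun c _ => this c, Finset.sum_comm]
      refine Finset.sum_congr rfl fun i _ => ?_
      rw [Finset.sum_ite_eq]; simp
    rw [Finset.sum_congr rfl step1]
    have step2 : ∑ k ∈ Finset.range (m+1), ∑ i, ∑ j, (if col j = col i then dl col (dn γ i (k+1)) (dn γ' j (k+1)) else 0)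
      = ∑ k ∈ Finset.range K, ∑ i, ∑ j, (if col j = col i then dl col (dn γ i (k+1)) (dn γ' j (k+1)) else 0) := by
      apply Finset.sum_subset
      · intro x; simp; omega
      · intro k _ hk
        simp at hk
        refine Finset.sum_eq_zero fun i _ => Finset.sum_eq_zero fun j _ => ?_
        rw [dl_low hg _ _ (by rw [sum_dn, hs]; push_cast; omega)]; simp
    rw [step2]
    have step3 : ∀ k ∈ Finset.range K, ∀ i, ∑ j, (if col j = col i then dl col (dn γ i (k+1)) (dn γ' j (k+1)) else 0)
      = ∑ j, if col i = col j then (if (k + 1 : ℤ) ≤ γ i then dl' col (mv γ i j (k+1)) γ' else 0) else 0 := by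
      intro k _ i
      have hnn : (∀ a, 0 ≤ dn γ i (k+1) a) ↔ (k + 1 : ℤ) ≤ γ i := by
        constructor
        · intro h; have := h i; simp [dn] at this; omega
        · intro h a
          simp only [dn]; split_ifs with ha
          · subst ha; omega
          · exact h0 a
      simp only [dl, hnn]
      by_cases h : (k + 1 : ℤ) ≤ γ i
      · simp only [h, if_true]
        rw [dl'_adj]
        refine Finset.sum_congr rfl fun j _ => ?_
        have : (fun a => dn γ i (k+1) a + if a = j then (k + 1 : ℤ) else 0) = mv γ i j (k+1) := by
          ext a; simp only [dn, mv]; split_ifs <;> ring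
        rw [this]
        simp only [eq_comm]
      · simp [h]
    rw [Finset.sum_congr rfl fun k hk => Finset.sum_congr rfl fun i _ => step3 k hk i]
    rw [Finset.sum_comm]
    have step4 : ∀ i, ∑ k ∈ Finset.range K, ∑ j, (if col i = col j then (if (k + 1 : ℤ) ≤ γ i then dl' col (mv γ i j (k+1)) γ' else 0) else 0)
       = ∑ j, (if col i = col j then
      ∑ k ∈ Finset.range K, (if (k + 1 : ℤ) ≤ γ i then dl' col (mv γ i j (k+1)) γ' else 0) else 0) := by
      intro i
      rw [Finset.sum_comm]
      refine Finset.sum_congr rfl fun j _ => ?_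
      split_ifs <;> simp
    rw [Finset.sum_congr rfl fun i _ => step4 i]
    rw [mv_total hg (fun δ => dl' col δ γ') γ h0 ?_ K hK, hs, dl, if_pos h0]
    · push_cast
      have : (m + 1 : ℚ) ≠ 0 := by positivity
      field_simp
      ring
    · intro i j hij hcol δ
      rw [dl'_perm δ γ' _ (swap_col hcol), Equiv.Perm.sign_swap hij]
      simp

end det

end CB

namespace CB

section SpanH
variable {η : Type*} {I : Type*} [Fintype I] {col : I → η} {pos : I → ℕ}

/-- product of complete functions -/
def HH (col : I → η) (α : I → ℤ) : R η := ∏ i, hc (col i) (α i)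

lemma HH_perm (α : I → ℤ) (π : Equiv.Perm I) (h : ∀ i, col (π i) = col i) :
    HH col (fun i => α (π i)) = HH col α := by
  unfold HH
  rw [← Equiv.prod_comp π (fun i => hc (col i) (α i))]
  exact Finset.prod_congr rfl fun i _ => by rw [h]

lemma HH_neg (α : I → ℤ) (i : I) (h : α i < 0) : HH col α = 0 :=
  Finset.prod_eq_zero (Finset.mem_univ i) (hz_neg _ h)

lemma TT_expand (γ : I → ℤ) : TT col pos γ = ∑ π : Equiv.Perm I,
    if (∀ i, col (π i) = col i) then
      ((Equiv.Perm.sign π : ℤ)) • HH col (fun i => γ (π i) - pos i) else 0 := by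
  unfold TT
  rw [Matrix.det_apply]
  refine Finset.sum_congr rfl fun π _ => ?_
  split_ifs with h
  · rw [Units.smul_def]
    congr 1
    unfold HH
    refine Finset.prod_congr rfl fun i _ => ?_
    simp [h]
  · push Not at h
    obtain ⟨i, hi⟩ := h
    rw [Finset.prod_eq_zero (Finset.mem_univ i), smul_zero]
    simp [hi]

lemma max_perm (α : I → ℤ) (pos : I → ℕ) : ∃ τ : Equiv.Perm I, (∀ i, col (τ i) = col i) ∧
    ∀ π : Equiv.Perm I, (∀ i, col (π i) = col i) →
      ∑ i, α (π i) * (pos i : ℤ) ≤ ∑ i, α (τ i) * (pos i : ℤ) := by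
  obtain ⟨τ, h1, h2⟩ := Finset.exists_max_image
    (Finset.univ.filter fun π : Equiv.Perm I => ∀ i, col (π i) = col i)
    (fun π => ∑ i, α (π i) * (pos i : ℤ)) ⟨1, by simp⟩
  refine ⟨τ, by simpa using h1, fun π hπ => h2 π (by simpa using hπ)⟩

lemma span_HH (hinj : ∀ i j, col i = col j → pos i = pos j → i = j) (w : ℕ) :
    ∀ (q : ℕ) (α : I → ℤ), (∑ i, α i = w) → (w : ℤ)^2 - ∑ i, α i ^ 2 < q →
      HH col α ∈ Submodule.span ℤ {F | ∃ γ : I → ℤ, (∑ i, γ i = w + ∑ i, (pos i : ℤ)) ∧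
        F = TT col pos γ} := by
  intro q
  induction q with
  | zero =>
    intro α hs hq
    by_cases h : ∃ i, α i < 0
    · obtain ⟨i, hi⟩ := h; rw [HH_neg α i hi]; exact Submodule.zero_mem _
    · push Not at h
      exfalso
      have : ∑ i, α i ^ 2 ≤ (∑ i, α i) ^ 2 := by
        rw [sq (∑ i, α i), Finset.sum_mul]
        refine Finset.sum_le_sum fun i _ => ?_
        rw [sq]
        exact mul_le_mul_of_nonneg_left
          (Finset.single_le_sum (f := α) (fun i _ => h i) (Finset.mem_univ i)) (h i)
      rw [hs] at this
      simp at hq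
      omega
  | succ q ih =>
    intro α hs hq
    obtain ⟨τ, h1, h2⟩ := max_perm (col := col) α pos
    rw [← HH_perm α τ h1]
    set a : I → ℤ := fun i => α (τ i) with ha
    have hs' : ∑ i, a i = w := by rw [← hs]; exact Equiv.sum_comp τ α
    have hq' : ∑ i, a i ^ 2 = ∑ i, α i ^ 2 := Equiv.sum_comp τ (fun i => α i ^ 2)
    have key := TT_expand (col := col) (pos := pos) (fun i => a i + pos i)
    rw [← Finset.add_sum_erase _ _ (Finset.mem_univ 1)] at key
    simp only [Equiv.Perm.coe_one, id, implies_true, if_true, Equiv.Perm.sign_one, Units.val_one,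
      one_smul, add_sub_cancel_right] at key
    rw [eq_sub_of_add_eq key.symm]
    refine Submodule.sub_mem _ (Submodule.subset_span ⟨_, ?_, rfl⟩) (Submodule.sum_mem _ ?_)
    · rw [Finset.sum_add_distrib, hs']
    · intro π hπ
      split_ifs with hc'
      swap
      · exact Submodule.zero_mem _
      refine Submodule.smul_mem _ _ (ih _ ?_ ?_)
      · rw [Finset.sum_sub_distrib, Finset.sum_add_distrib, Equiv.sum_comp π a,
          Equiv.sum_comp π (fun i => (pos i : ℤ)), hs']; ring
      · have hne : ∃ i, π i ≠ i := by
          by_contra hcon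
          push Not at hcon
          apply Finset.ne_of_mem_erase hπ
          ext1 i; exact hcon i
        obtain ⟨i0, hi0⟩ := hne
        have e1 : ∀ i, (a (π i) + (pos (π i) : ℤ) - pos i) ^ 2
            = a (π i) ^ 2 + 2 * (a (π i) * pos (π i)) - 2 * (a (π i) * pos i)
              + ((pos (π i) : ℤ) - pos i) ^ 2 := fun i => by ring
        simp only [e1]
        rw [Finset.sum_add_distrib, Finset.sum_sub_distrib, Finset.sum_add_distrib,
          Equiv.sum_comp π (fun i => a i ^ 2), hq', ← Finset.mul_sum, ← Finset.mul_sum,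
          Equiv.sum_comp π (fun i => a i * (pos i : ℤ))]
        have e2 := h2 (π.trans τ) (fun i => by simp [h1, hc'])
        have e3 : (1 : ℤ) ≤ ∑ i, ((pos (π i) : ℤ) - pos i) ^ 2 := by
          have : (1 : ℤ) ≤ ((pos (π i0) : ℤ) - pos i0) ^ 2 := by
            have : (pos (π i0) : ℤ) - pos i0 ≠ 0 := by
              intro h
              exact hi0 (hinj _ _ (hc' i0) (by omega))
            have := sq_pos_of_ne_zero this
            omega
          exact this.trans (Finset.single_le_sum (f := fun i => ((pos (π i) : ℤ) - pos i) ^ 2)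
            (fun i _ => sq_nonneg _) (Finset.mem_univ i0))
        simp only [Equiv.trans_apply] at e2
        simp only [ha] at *
        push_cast at hq
        linarith

lemma exists_HH (w : ℕ) (hcap : ∀ c, w ≤ (Finset.univ.filter fun i => col i = c).card) :
    ∀ M : Multiset (ℕ × η), (∀ x ∈ M, 0 < x.1) → Multiset.card M ≤ w →
      ∃ α : I → ℤ, ∑ i, α i = ((M.map Prod.fst).sum : ℕ) ∧
        HH col α = (M.map fun x => hs (pp x.2) x.1).prod ∧
        (Finset.univ.filter fun i => α i ≠ 0).card ≤ Multiset.card M := by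
  intro M
  induction M using Multiset.induction_on with
  | empty =>
    intro _ _
    refine ⟨0, by simp, ?_, by simp⟩
    simp [HH, hc, hz_zero]
  | cons x M ih =>
    intro hM hw
    rw [Multiset.card_cons] at hw
    obtain ⟨α, h1, h2, h3⟩ := ih (fun y hy => hM y (Multiset.mem_cons_of_mem hy)) (by omega)
    have : ∃ i, col i = x.2 ∧ α i = 0 := by
      by_contra hcon
      push Not at hcon
      have : (Finset.univ.filter fun i => col i = x.2) ⊆ (Finset.univ.filter fun i => α i ≠ 0) := by
        intro i; simp; exact hcon i
      have := Finset.card_le_card this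
      have := hcap x.2
      omega
    obtain ⟨i, hi, hi0⟩ := this
    refine ⟨Function.update α i x.1, ?_, ?_, ?_⟩
    · rw [Finset.sum_update_of_mem (Finset.mem_univ _), Multiset.map_cons, Multiset.sum_cons]
      push_cast
      push_cast at h1
      rw [← h1, ← Finset.add_sum_erase _ _ (Finset.mem_univ i), hi0, zero_add]
      rw [Finset.sdiff_singleton_eq_erase]
    · unfold HH at *
      have : ∀ j, hc (col j) (Function.update α i (x.1 : ℤ) j) = Function.update (fun j => hc (col j) (α j)) i
          (hc (col i) x.1) j := by
        intro j
        by_cases hj : j = i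
        · subst hj; simp
        · simp [hj]
      simp only [this]
      rw [Finset.prod_update_of_mem (Finset.mem_univ _), Multiset.map_cons, Multiset.prod_cons, ← h2,
        ← Finset.mul_prod_erase _ _ (Finset.mem_univ i), hi0, Finset.sdiff_singleton_eq_erase, hi]
      simp only [hc, hz_nat, hz_zero, one_mul]
    · rw [Multiset.card_cons]
      refine le_trans (Finset.card_le_card (t := insert i (Finset.univ.filter fun i => α i ≠ 0)) ?_)
        ((Finset.card_insert_le _ _).trans (by omega))
      intro j
      by_cases hj : j = i
      · simp [hj]
      · simp [hj]

lemma Lat_le_span (hinj : ∀ i j, col i = col j → pos i = pos j → i = j) (w : ℕ)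
    (hcap : ∀ c, w ≤ (Finset.univ.filter fun i => col i = c).card) :
    Lat η w ≤ Submodule.span ℤ {F | ∃ γ : I → ℤ, (∑ i, γ i = w + ∑ i, (pos i : ℤ)) ∧
        F = TT col pos γ} := by
  unfold Lat
  rw [Submodule.span_le]
  rintro F ⟨M, hM, rfl⟩
  have hfil : (M.map fun x => hs (pp x.2) x.1).prod
      = ((M.filter fun x => 0 < x.1).map fun x => hs (pp x.2) x.1).prod := by
    conv_lhs => rw [← Multiset.filter_add_not (fun x : ℕ × η => 0 < x.1) M]
    rw [Multiset.map_add, Multiset.prod_add]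
    rw [Multiset.prod_eq_one (s := Multiset.map _ (Multiset.filter (fun x => ¬ 0 < x.1) M)), mul_one]
    intro y hy
    simp only [Multiset.mem_map, Multiset.mem_filter] at hy
    obtain ⟨x, ⟨_, hx⟩, rfl⟩ := hy
    rw [Nat.eq_zero_of_not_pos hx, hs_zero]
  have hsum : (M.map Prod.fst).sum = ((M.filter fun x => 0 < x.1).map Prod.fst).sum := by
    conv_lhs => rw [← Multiset.filter_add_not (fun x : ℕ × η => 0 < x.1) M]
    rw [Multiset.map_add, Multiset.sum_add]
    rw [Multiset.sum_eq_zero (s := Multiset.map _ (Multiset.filter (fun x => ¬ 0 < x.1) M)), add_zero]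
    intro y hy
    simp only [Multiset.mem_map, Multiset.mem_filter] at hy
    obtain ⟨x, ⟨_, hx⟩, rfl⟩ := hy
    omega
  have hcard : Multiset.card (M.filter fun x => 0 < x.1) ≤ w := by
    rw [← hM, hsum]
    have := Multiset.card_nsmul_le_sum (s := (M.filter fun x => 0 < x.1).map Prod.fst) (a := 1) (by
      intro y hy
      simp only [Multiset.mem_map, Multiset.mem_filter] at hy
      obtain ⟨x, ⟨_, hx⟩, rfl⟩ := hy
      exact hx)
    simpa using this
  obtain ⟨α, h1, h2, _⟩ := exists_HH (col := col) w hcap (M.filter fun x => 0 < x.1) (by simp) hcard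
  rw [SetLike.mem_coe]
  rw [hfil, ← h2]
  refine span_HH hinj w (((w : ℤ)^2 - ∑ i, α i ^ 2).toNat + 1) α (by rw [h1, ← hsum, hM]) ?_
  have := Int.self_le_toNat ((w : ℤ)^2 - ∑ i, α i ^ 2)
  push_cast
  omega

lemma hc_Lat (c : η) (n : ℕ) : hc c (n : ℤ) ∈ Lat η n := by
  rw [hc, hz_nat]; exact good_pp c n

lemma HH_Lat (α : I → ℤ) (w : ℕ) (h : ∑ i, α i = w) : HH col α ∈ Lat η w := by
  by_cases h0 : ∃ i, α i < 0
  · obtain ⟨i, hi⟩ := h0; rw [HH_neg α i hi]; exact Submodule.zero_mem _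
  push Not at h0
  have : ∀ i, ∃ a : ℕ, α i = a := fun i => Int.eq_ofNat_of_zero_le (h0 i)
  choose a ha using this
  have hw : w = ∑ i, a i := by
    have : (w : ℤ) = ((∑ i, a i : ℕ) : ℤ) := by
      rw [← h]; push_cast; exact Finset.sum_congr rfl fun i _ => ha i
    exact_mod_cast this
  rw [hw]
  unfold HH
  have : ∀ s : Finset I, ∏ i ∈ s, hc (col i) (α i) ∈ Lat η (∑ i ∈ s, a i) := by
    intro s
    induction s using Finset.induction_on with
    | empty => simpa using Lat_one
    | insert i s hi ih =>
      rw [Finset.prod_insert hi, Finset.sum_insert hi]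
      exact Lat_mul (by rw [ha]; exact hc_Lat _ _) ih
  exact this _

lemma TT_Lat (γ : I → ℤ) (w : ℕ) (h : ∑ i, γ i = w + ∑ i, (pos i : ℤ)) : TT col pos γ ∈ Lat η w := by
  rw [TT_expand]
  refine Submodule.sum_mem _ fun π _ => ?_
  split_ifs
  · refine Submodule.smul_mem _ _ (HH_Lat _ _ ?_)
    rw [Finset.sum_sub_distrib, Equiv.sum_comp π γ, h]; ring
  · exact Submodule.zero_mem _

end SpanH

end CB

namespace CB

/-- the `i`-th largest part -/
def row (lam : Multiset ℕ) (i : ℕ) : ℕ := ((lam.sort (· ≤ ·)).reverse).getD i 0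

lemma row_len (lam : Multiset ℕ) : ((lam.sort (· ≤ ·)).reverse).length = Multiset.card lam := by
  simp

lemma row_zero (lam : Multiset ℕ) (i : ℕ) (h : Multiset.card lam ≤ i) : row lam i = 0 := by
  unfold row
  rw [List.getD_eq_default]
  simpa using h

lemma row_anti (lam : Multiset ℕ) {i j : ℕ} (h : i ≤ j) : row lam j ≤ row lam i := by
  by_cases hj : Multiset.card lam ≤ j
  · rw [row_zero _ _ hj]; exact Nat.zero_le _
  · rcases h.eq_or_lt with rfl | hlt
    · exact le_rfl
    have hp : ((lam.sort (· ≤ ·)).reverse).Pairwise (· ≥ ·) := by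
      rw [List.pairwise_reverse]
      exact Multiset.pairwise_sort lam (· ≤ ·)
    have hj' : j < ((lam.sort (· ≤ ·)).reverse).length := by rw [row_len]; omega
    unfold row
    rw [List.getD_eq_getElem _ _ hj', List.getD_eq_getElem _ _ (hlt.trans hj')]
    exact List.pairwise_iff_getElem.mp hp i j _ _ hlt

lemma row_list (lam : Multiset ℕ) :
    (List.range (Multiset.card lam)).map (row lam) = (lam.sort (· ≤ ·)).reverse := by
  apply List.ext_getElem
  · simp
  · intro i h1 h2
    simp only [List.getElem_map, List.getElem_range]
    unfold row
    rw [List.getD_eq_getElem _ _ h2]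

lemma row_mult (lam : Multiset ℕ) :
    (Multiset.range (Multiset.card lam)).map (row lam) = lam := by
  have := congrArg Multiset.ofList (row_list lam)
  rw [Multiset.coe_reverse, Multiset.sort_eq] at this
  exact this

lemma row_sum (lam : Multiset ℕ) (N : ℕ) (h : Multiset.card lam ≤ N) :
    ∑ i : Fin N, row lam i = lam.sum := by
  rw [← Finset.sum_range (fun i => row lam i)]
  rw [← Finset.sum_subset (s₁ := Finset.range (Multiset.card lam))]
  · conv_rhs => rw [← row_mult lam]
    rfl
  · intro x; simp; omega
  · intro x _ hx; exact row_zero _ _ (by simpa using hx)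

lemma row_pos (lam : Multiset ℕ) (hp : ∀ x ∈ lam, 0 < x) (i : ℕ) (h : i < Multiset.card lam) :
    0 < row lam i := by
  have : row lam i ∈ (Multiset.range (Multiset.card lam)).map (row lam) :=
    Multiset.mem_map_of_mem _ (by simpa using h)
  rw [row_mult] at this
  exact hp _ this

lemma row_inj (lam mu : Multiset ℕ) (hl : ∀ x ∈ lam, 0 < x) (hm : ∀ x ∈ mu, 0 < x) (N : ℕ)
    (h1 : Multiset.card lam ≤ N) (h2 : Multiset.card mu ≤ N) (h : ∀ i < N, row lam i = row mu i) :
    lam = mu := by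
  have hall : ∀ i, row lam i = row mu i := by
    intro i
    by_cases hi : i < N
    · exact h i hi
    · rw [row_zero _ _ (by omega), row_zero _ _ (by omega)]
  have hcard : Multiset.card lam = Multiset.card mu := by
    by_contra hne
    rcases Nat.lt_or_gt_of_ne hne with hlt | hlt
    · have := row_pos mu hm _ hlt
      rw [← hall, row_zero _ _ le_rfl] at this
      omega
    · have := row_pos lam hl _ hlt
      rw [hall, row_zero _ _ le_rfl] at this
      omega
  rw [← row_mult lam, ← row_mult mu, hcard]
  exact Multiset.map_congr rfl fun i _ => hall i

lemma row_ofList (r : ℕ → ℕ) (hr : ∀ i j, i ≤ j → r j ≤ r i) (K : ℕ) (hK : ∀ i, K ≤ i → r i = 0)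
    (i : ℕ) : row (Multiset.ofList ((List.range K).map r)) i = r i := by
  have : ((Multiset.ofList ((List.range K).map r)).sort (· ≤ ·)).reverse = (List.range K).map r := by
    refine List.Perm.eq_of_pairwise' (r := (· ≥ ·)) ?_ ?_ ?_
    · rw [List.pairwise_reverse]
      exact Multiset.pairwise_sort _ (· ≤ ·)
    · rw [List.pairwise_map]
      exact List.pairwise_le_range.imp fun h => hr _ _ h
    · rw [← Multiset.coe_eq_coe, Multiset.coe_reverse, Multiset.sort_eq]
  unfold row
  rw [this]
  by_cases hi : i < K
  · rw [List.getD_eq_getElem _ _ (by simpa using hi)]; simp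
  · rw [List.getD_eq_default _ _ (by simpa using hi), hK i (by omega)]

lemma anti_gap {N : ℕ} (b : Fin N → ℤ) (hb : StrictAnti b) :
    ∀ (d : ℕ) (i j : Fin N), (j : ℕ) = i + d → b j + d ≤ b i := by
  intro d
  induction d with
  | zero => intro i j h; have : j = i := Fin.ext (by simpa using h); simp [this]
  | succ d ih =>
    intro i j h
    have hj := j.isLt
    have := ih i ⟨i + d, by omega⟩ rfl
    have h2 : b j < b ⟨i + d, by omega⟩ := hb (by rw [Fin.lt_def]; simp; omega)
    push_cast
    omega

lemma strip {N : ℕ} (β : Fin N → ℤ) (h0 : ∀ i, 0 ≤ β i) (hinj : Function.Injective β) :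
    ∃ (π : Equiv.Perm (Fin N)) (m : ℕ) (lam : Nat.Partition m), Multiset.card lam.parts ≤ N ∧
      ∀ i : Fin N, β (π i) = row lam.parts i + (N - 1 - i : ℕ) := by
  let π := Tuple.sort (fun i => - β i)
  have hmono : Monotone ((fun i => - β i) ∘ π) := Tuple.monotone_sort _
  let b : Fin N → ℤ := fun i => β (π i)
  have hb : StrictAnti b := by
    intro i j hij
    have h1 := hmono hij.le
    simp only [Function.comp] at h1
    have h2 : b i ≠ b j := fun h => hij.ne (π.injective (hinj h))
    simp only [b] at *
    omega
  have hlow : ∀ i : Fin N, ((N - 1 - i : ℕ) : ℤ) ≤ b i := by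
    intro i
    have hi := i.isLt
    have := anti_gap b hb (N - 1 - i) i ⟨N - 1, by omega⟩ (by simp; omega)
    have h3 := h0 (π ⟨N - 1, by omega⟩)
    simp only [b] at *
    omega
  let r : ℕ → ℕ := fun i => if h : i < N then (b ⟨i, h⟩ - (N - 1 - i : ℕ)).toNat else 0
  have hr : ∀ i j, i ≤ j → r j ≤ r i := by
    intro i j hij
    simp only [r]
    by_cases hj : j < N
    · have hi : i < N := by omega
      rw [dif_pos hj, dif_pos hi]
      have := anti_gap b hb (j - i) ⟨i, hi⟩ ⟨j, hj⟩ (by simp; omega)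
      have := hlow ⟨j, hj⟩
      have := hlow ⟨i, hi⟩
      simp only at *
      omega
    · rw [dif_neg hj]; exact Nat.zero_le _
  have hex : ∃ K, r K = 0 := ⟨N, by simp [r]⟩
  have hKN : Nat.find hex ≤ N := Nat.find_min' hex (by simp [r])
  have hK0 : ∀ i, Nat.find hex ≤ i → r i = 0 := fun i hi => by
    have := hr _ _ hi
    rw [Nat.find_spec hex] at this
    omega
  refine ⟨π, _, ⟨Multiset.ofList ((List.range (Nat.find hex)).map r), ?_, rfl⟩, ?_, ?_⟩
  · intro x hx
    simp only [Multiset.mem_coe, List.mem_map, List.mem_range] at hx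
    obtain ⟨i, hi, rfl⟩ := hx
    exact Nat.pos_of_ne_zero (Nat.find_min hex hi)
  · simpa using hKN
  · intro i
    simp only
    rw [row_ofList r hr _ hK0]
    have := hlow i
    simp only [r, i.isLt, dif_pos]
    simp only [b] at *
    simp only [Fin.eta]
    omega

section JT
variable {η : Type*}

/-- Jacobi-Trudi determinant with `N` rows -/
def JT (c : η) (N : ℕ) (lam : Multiset ℕ) : R η :=
  (Matrix.of fun i j : Fin N => hc c ((row lam i : ℤ) - i + j)).det

lemma JT_succ (c : η) (N : ℕ) (lam : Multiset ℕ) (h : Multiset.card lam ≤ N) :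
    JT c (N + 1) lam = JT c N lam := by
  unfold JT
  rw [Matrix.det_succ_row _ (Fin.last N), Finset.sum_eq_single (Fin.last N)]
  · simp only [Fin.val_last, Matrix.of_apply, row_zero lam N h]
    simp only [Nat.cast_zero, zero_sub, neg_add_cancel, hc, hz_zero, mul_one]
    rw [← two_mul, pow_mul]
    simp
    congr 1
  · intro j _ hj
    have : (j : ℕ) < N := by
      have := j.isLt
      have : (j : ℕ) ≠ N := fun h => hj (Fin.ext h)
      omega
    simp only [Fin.val_last, Matrix.of_apply, row_zero lam N h, hc]
    rw [hz_neg _ (by push_cast; omega)]; simp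
  · simp

lemma JT_eq (c : η) (N : ℕ) (lam : Multiset ℕ) (h : Multiset.card lam ≤ N) :
    JT c N lam = JT c (Multiset.card lam) lam := by
  induction N, h using Nat.le_induction with
  | base => rfl
  | succ n hn ih => rw [JT_succ c n lam hn, ih]

variable [Fintype η]

/-- standard index positions -/
def spos (N : ℕ) (x : Fin N × η) : ℕ := N - 1 - x.1

/-- the beta numbers of a tuple of partitions -/
def gam (N : ℕ) (lam : η → Multiset ℕ) (x : Fin N × η) : ℤ := row (lam x.2) x.1 + (N - 1 - x.1 : ℕ)

/-- the determinant attached to a tuple of partitions -/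
def TN (N : ℕ) (lam : η → Multiset ℕ) : R η := TT (fun x : Fin N × η => x.2) (spos N) (gam N lam)

lemma TN_prod (N : ℕ) (lam : η → Multiset ℕ) : TN N lam = ∏ c, JT c N (lam c) := by
  unfold TN TT JT
  rw [← Matrix.det_blockDiagonal]
  congr 1
  ext1 x y
  rw [Matrix.blockDiagonal_apply]
  simp only [Matrix.of_apply]
  congr 1
  have := x.1.isLt
  have := y.1.isLt
  congr 1
  simp only [gam, spos]
  omega

lemma count_snd (N : ℕ) (c : η) :
    (Finset.univ.filter fun x : Fin N × η => x.2 = c).card = N := by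
  have : (Finset.univ.filter fun x : Fin N × η => x.2 = c)
      = Finset.univ.image (fun i : Fin N => (i, c)) := by
    ext x
    simp only [Finset.mem_filter, Finset.mem_univ, true_and, Finset.mem_image]
    constructor
    · rintro rfl; exact ⟨x.1, rfl⟩
    · rintro ⟨i, rfl⟩; rfl
  rw [this, Finset.card_image_of_injective _ (fun a b h => (Prod.ext_iff.mp h).1)]
  simp

lemma sgood (N : ℕ) : Good (fun x : Fin N × η => x.2) (spos N) where
  inj := by
    intro x y h1 h2
    have := x.1.isLt
    have := y.1.isLt
    simp only [spos] at h2
    exact Prod.ext (Fin.ext (by omega)) h1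
  lt := by
    intro x
    rw [count_snd]
    have := x.1.isLt
    simp only [spos]; omega
  surj := by
    intro x m hm
    rw [count_snd] at hm
    refine ⟨(⟨N - 1 - m, by omega⟩, x.2), rfl, ?_⟩
    simp only [spos]; omega

lemma gam_anti (N : ℕ) (lam : η → Multiset ℕ) (c : η) : StrictAnti (fun i : Fin N => gam N lam (i, c)) := by
  intro i j hij
  simp only [gam]
  have h := row_anti (lam c) (i := i) (j := j) hij.le
  rw [Fin.lt_def] at hij
  have := j.isLt
  omega

lemma sum_gam (N : ℕ) (lam : η → Multiset ℕ) (h : ∀ c, Multiset.card (lam c) ≤ N) :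
    ∑ x, gam N lam x = ((∑ c, (lam c).sum : ℕ) : ℤ) + ∑ x : Fin N × η, (spos N x : ℤ) := by
  unfold gam spos
  rw [Finset.sum_add_distrib]
  congr 1
  rw [Fintype.sum_prod_type_right]
  rw [Nat.cast_sum]
  refine Finset.sum_congr rfl fun c _ => ?_
  rw [← row_sum (lam c) N (h c)]
  push_cast; rfl

lemma gam_inj (N : ℕ) (lam mu : η → Multiset ℕ) (hl : ∀ c, ∀ x ∈ lam c, 0 < x)
    (hm : ∀ c, ∀ x ∈ mu c, 0 < x) (h1 : ∀ c, Multiset.card (lam c) ≤ N)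
    (h2 : ∀ c, Multiset.card (mu c) ≤ N) (h : gam N lam = gam N mu) : lam = mu := by
  funext c
  refine row_inj _ _ (hl c) (hm c) N (h1 c) (h2 c) fun i hi => ?_
  have := congrFun h (⟨i, hi⟩, c)
  simp only [gam] at this
  omega

lemma dl_gam (N : ℕ) (lam mu : η → Multiset ℕ) :
    dl (fun x : Fin N × η => x.2) (gam N lam) (gam N mu) = if gam N lam = gam N mu then 1 else 0 := by
  unfold dl
  rw [if_pos (fun i => by simp only [gam]; positivity)]
  unfold dl'
  have key : ∀ π : Equiv.Perm (Fin N × η), ((∀ x, (π x).2 = x.2) ∧ ∀ x, gam N mu x = gam N lam (π x)) →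
      π = 1 := by
    rintro π ⟨h1, h2⟩
    have hr : ∀ c, (fun i : Fin N => gam N mu (i, c)) = fun i => gam N lam (i, c) := by
      intro c
      rw [← StrictAnti.range_inj (gam_anti N mu c) (gam_anti N lam c)]
      ext z
      simp only [Set.mem_range]
      constructor
      · rintro ⟨i, rfl⟩
        refine ⟨(π (i, c)).1, ?_⟩
        rw [h2]; congr 1; exact Prod.ext rfl (h1 (i,c)).symm
      · rintro ⟨i, rfl⟩
        refine ⟨(π.symm (i, c)).1, ?_⟩
        have h3 : (π.symm (i, c)).2 = c := by
          have := h1 (π.symm (i, c)); simpa using this.symm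
        have h4 : ((π.symm (i, c)).1, c) = π.symm (i, c) := Prod.ext rfl h3.symm
        rw [h4, h2]; simp
    ext1 x
    have h3 : gam N lam (x.1, x.2) = gam N lam ((π x).1, x.2) := by
      have := h2 x
      have h4 := congrFun (hr x.2) x.1
      have h5 : ((π x).1, x.2) = π x := Prod.ext rfl (h1 x).symm
      rw [h5, ← this, ← h4]
    have := (gam_anti N lam x.2).injective h3
    exact Prod.ext this.symm (h1 x)
  split_ifs with h
  · rw [Finset.sum_eq_single 1]
    · simp [h]
    · intro π _ hπ
      rw [if_neg fun h' => hπ (key π h')]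
    · simp
  · refine Finset.sum_eq_zero fun π _ => ?_
    rw [if_neg]
    intro h'
    have := key π h'
    subst this
    apply h
    funext x
    exact (h'.2 x).symm

end JT

end CB

namespace CB

lemma card_parts_le {m : ℕ} (lam : Nat.Partition m) : Multiset.card lam.parts ≤ m := by
  have := Multiset.card_nsmul_le_sum (s := lam.parts) (a := 1) (fun x hx => lam.parts_pos hx)
  rw [lam.parts_sum] at this
  simpa using this

section
variable {η : Type*} [Fintype η] {w : ℕ}

/-- the multisets of a tuple of partitions -/
def pm (lam : PMapw η w) (c : η) : Multiset ℕ := (lam.1 c).2.parts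

lemma pm_card (lam : PMapw η w) (c : η) : Multiset.card (pm lam c) ≤ w :=
  (card_parts_le _).trans (Nat.lt_succ_iff.mp (lam.1 c).1.isLt)

lemma pm_pos (lam : PMapw η w) (c : η) : ∀ x ∈ pm lam c, 0 < x := fun _ hx => (lam.1 c).2.parts_pos hx

lemma pm_sum (lam : PMapw η w) : ∑ c, (pm lam c).sum = w := by
  have := lam.2
  refine Eq.trans ?_ this
  exact Finset.sum_congr rfl fun c _ => (lam.1 c).2.parts_sum

lemma pm_inj (lam mu : PMapw η w) (h : pm lam = pm mu) : lam = mu := by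
  apply Subtype.ext
  funext c
  have hc := congrFun h c
  unfold pm at hc
  rcases hx : lam.1 c with ⟨m, p⟩
  rcases hy : mu.1 c with ⟨m', p'⟩
  rw [hx, hy] at hc
  simp only at hc
  have hm : m = m' := by
    apply Fin.ext
    rw [← p.parts_sum, ← p'.parts_sum, hc]
  subst hm
  have : p = p' := Nat.Partition.ext hc
  rw [this]

/-- the basis of the lattice -/
def Tm (lam : PMapw η w) : R η := TN w (pm lam)

lemma Tm_orth (lam mu : PMapw η w) : ip w (Tm lam) (Tm mu) = if lam = mu then 1 else 0 := by
  unfold Tm TN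
  rw [orth (sgood w) w _ _ (by rw [sum_gam _ _ (pm_card lam), pm_sum])
    (by rw [sum_gam _ _ (pm_card mu), pm_sum]), dl_gam]
  by_cases h : lam = mu
  · subst h; simp
  · rw [if_neg, if_neg h]
    intro h'
    exact h (pm_inj _ _ (gam_inj w _ _ (pm_pos lam) (pm_pos mu) (pm_card lam) (pm_card mu) h'))

lemma Tm_Lat (lam : PMapw η w) : Tm lam ∈ Lat η w :=
  TT_Lat _ _ (by rw [sum_gam _ _ (pm_card lam), pm_sum])

lemma TT_mem_Tm (γ : Fin w × η → ℤ) (hs : ∑ i, γ i = w + ∑ i : Fin w × η, (spos w i : ℤ)) :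
    TT (fun x : Fin w × η => x.2) (spos w) γ ∈ Submodule.span ℤ (Set.range (Tm (η := η) (w := w))) := by
  by_cases h0 : ∃ i, γ i < 0
  · obtain ⟨i, hi⟩ := h0; rw [TT_neg γ i hi]; exact Submodule.zero_mem _
  push Not at h0
  by_cases hinj : ∀ c, Function.Injective (fun i : Fin w => γ (i, c))
  swap
  · push Not at hinj
    obtain ⟨c, hc⟩ := hinj
    unfold Function.Injective at hc
    push Not at hc
    obtain ⟨i, j, h1, h2⟩ := hc
    rw [TT_eq_zero γ (i, c) (j, c) (fun h => h2 (Prod.ext_iff.mp h).1) rfl h1]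
    exact Submodule.zero_mem _
  choose π m lam hcard hrow using fun c => strip (fun i : Fin w => γ (i, c)) (fun i => h0 _) (hinj c)
  let PP : Equiv.Perm (Fin w × η) := Equiv.prodCongrLeft π
  have hPP : ∀ x, (PP x).2 = x.2 := fun x => rfl
  have hgam : (fun x => γ (PP x)) = gam w (fun c => (lam c).parts) := by
    funext x
    exact hrow x.2 x.1
  have hsum : ∑ c, m c = w := by
    have h1 := sum_gam w (fun c => (lam c).parts) hcard
    rw [← hgam, Equiv.sum_comp PP γ, hs] at h1
    have h2 : ∑ c, (lam c).parts.sum = ∑ c, m c := Finset.sum_congr rfl fun c _ => (lam c).parts_sum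
    rw [h2] at h1
    omega
  have hle : ∀ c, m c < w + 1 := fun c => by
    have := Finset.single_le_sum (f := m) (fun i _ => Nat.zero_le _) (Finset.mem_univ c)
    omega
  let L : PMapw η w := ⟨fun c => ⟨⟨m c, hle c⟩, lam c⟩, hsum⟩
  have hL : Tm L = ((Equiv.Perm.sign PP : ℤ)) • TT (fun x : Fin w × η => x.2) (spos w) γ := by
    have := TT_perm (col := fun x : Fin w × η => x.2) (pos := spos w) γ PP hPP
    rw [hgam] at this
    rw [← Int.cast_smul_eq_zsmul ℚ]
    refine Eq.trans ?_ (this.trans ?_)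
    · rfl
    · congr!
  have : TT (fun x : Fin w × η => x.2) (spos w) γ = ((Equiv.Perm.sign PP : ℤ)) • Tm L := by
    rw [hL, smul_smul]
    norm_cast
    simp
  rw [this]
  exact Submodule.smul_mem _ _ (Submodule.subset_span ⟨L, rfl⟩)

lemma Tm_span : Lat η w ≤ Submodule.span ℤ (Set.range (Tm (η := η) (w := w))) := by
  refine (Lat_le_span (sgood (η := η) w).inj w (fun c => (count_snd w c).ge)).trans ?_
  rw [Submodule.span_le]
  rintro F ⟨γ, hγ, rfl⟩
  exact TT_mem_Tm γ hγ

/-- embedding of the one colour ring as colour `c` -/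
def emb (c : η) : R Unit →ₐ[ℚ] R η := phi (Matrix.of fun _ d => if d = c then 1 else 0)

lemma emb_hc (c : η) (n : ℤ) : emb c (hc () n) = hc c n := by
  unfold emb
  rw [phi_hc]
  unfold hc
  congr 1
  simp

lemma emb_JT (c : η) (N : ℕ) (lam : Multiset ℕ) : emb c (JT () N lam) = JT c N lam := by
  unfold JT
  rw [AlgHom.map_det]
  congr 1
  ext1 i j
  simp [emb_hc]

lemma DD_emb (c : η) (k : ℕ) (d : η) (F : R Unit) :
    DD (k, d) (emb c F) = if d = c then emb c (DD (k, ()) F) else 0 := by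
  unfold emb
  rw [DD_phi]
  simp

lemma Tm_prod (lam : PMapw η w) :
    Tm lam = ∏ c, emb c (JT () (Multiset.card (pm lam c)) (pm lam c)) := by
  unfold Tm
  rw [TN_prod]
  refine Finset.prod_congr rfl fun c _ => ?_
  rw [JT_eq _ _ _ (pm_card lam c), emb_JT]

/-- the part of a coloured multiset of a given colour -/
def colp (c : η) (ν : Multiset (ℕ × η)) : Multiset (ℕ × Unit) :=
  (ν.filter fun x => x.2 = c).map fun x => (x.1, ())

lemma const_emb (c : η) (F : R Unit) :
    MvPolynomial.constantCoeff (emb c F) = MvPolynomial.constantCoeff F := by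
  have : (MvPolynomial.constantCoeff (R := ℚ)).comp (emb c).toRingHom
      = MvPolynomial.constantCoeff (R := ℚ) (σ := ℕ × Unit) := by
    apply MvPolynomial.ringHom_ext
    · intro r; simp
    · intro i
      simp [emb, phi_X]
  exact congrFun (congrArg DFunLike.coe this) F

lemma val_prod (ν : Multiset (ℕ × η)) : ∀ (F : η → R Unit),
    val (∏ c, emb c (F c)) ν = ∏ c, val (F c) (colp c ν) := by
  induction ν using Multiset.induction_on with
  | empty =>
    intro F
    rw [val_zero, map_prod]
    refine Finset.prod_congr rfl fun c _ => ?_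
    rw [const_emb]
    simp [colp, val_zero]
  | cons x ν ih =>
    intro F
    rw [val_cons]
    obtain ⟨k, d⟩ := x
    have h1 : DD (k, d) (∏ c, emb c (F c))
        = ∏ c, emb c (if c = d then DD (k, ()) (F c) else F c) := by
      rw [der_prod, Finset.sum_eq_single d]
      · refine Finset.prod_congr rfl fun c _ => ?_
        split_ifs with h
        · subst h; rw [DD_emb, if_pos rfl]
        · rfl
      · intro c _ hc
        refine Finset.prod_eq_zero (Finset.mem_univ c) ?_
        rw [if_pos rfl, DD_emb, if_neg (fun h => hc h.symm)]
      · simp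
    rw [h1, ih]
    refine Finset.prod_congr rfl fun c _ => ?_
    by_cases h : c = d
    · subst h
      rw [if_pos rfl, ← val_cons]
      simp [colp]
    · rw [if_neg h]
      congr 1
      unfold colp
      rw [Multiset.filter_cons_of_neg]
      exact fun h' => h h'.symm

end

end CB

namespace CB

/-- uncoloured multiset as multiset with a single colour -/
def uu (ν : Multiset ℕ) : Multiset (ℕ × Unit) := ν.map fun k => (k, ())

lemma cnt_val {A : Type*} [Fintype A] : ∀ (n : ℕ) (b : Fin n → ℕ) (_ : ∀ j, 0 < b j) (a : A → ℤ),
    val (∏ i, hc () (a i)) ((Finset.univ : Finset (Fin n)).val.map fun j => (b j, ()))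
      = ∑ f : Fin n → A, if ∀ i, ∑ j, (if f j = i then (b j : ℤ) else 0) = a i then (1 : ℚ) else 0 := by
  intro n
  induction n with
  | zero =>
    intro b hb a
    have : (Finset.univ : Finset (Fin 0)).val = 0 := rfl
    rw [this, Multiset.map_zero, val_zero, map_prod]
    simp only [const_hc, Finset.univ_eq_empty, Finset.sum_empty, Finset.univ_unique,
      Finset.sum_singleton]
    rw [Finset.prod_boole]
    simp only [Finset.mem_univ, true_implies, eq_comm]
  | succ n ih =>
    intro b hb a
    have hu : (Finset.univ : Finset (Fin (n+1))).val.map (fun j => (b j, ()))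
        = (b 0, ()) ::ₘ (Finset.univ : Finset (Fin n)).val.map (fun j => (b j.succ, ())) := by
      rw [Fin.univ_succ]
      simp [Finset.cons_val]
      rfl
    rw [hu, val_cons, der_prod, val_sum]
    rw [← Equiv.sum_comp (Fin.consEquiv (fun _ : Fin (n+1) => A)), Fintype.sum_prod_type]
    refine Finset.sum_congr rfl fun i _ => ?_
    have h1 : (∏ j, if j = i then DD (b 0, ()) (hc () (a j)) else hc () (a j))
        = ∏ j, hc () (a j - if i = j then (b 0 : ℤ) else 0) := by
      refine Finset.prod_congr rfl fun j _ => ?_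
      by_cases h : j = i
      · subst h; simp [DD_hc _ (hb 0)]
      · rw [if_neg h, if_neg (fun h' => h h'.symm), sub_zero]
    rw [h1, ih _ (fun j => hb _)]
    refine Finset.sum_congr rfl fun f _ => ?_
    congr 1
    simp only [Fin.consEquiv_apply, Fin.sum_univ_succ, Fin.cons_zero, Fin.cons_succ]
    refine propext (forall_congr' fun j => ?_)
    constructor <;> intro h <;> omega

lemma fin_map_getD (L : List ℕ) (n : ℕ) (h : L.length = n) :
    (Finset.univ : Finset (Fin n)).val.map (fun j : Fin n => L.getD j 0) = (L : Multiset ℕ) := by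
  subst h
  have : ∀ j : Fin L.length, L.getD j 0 = L.get j := fun j => List.getD_eq_getElem _ _ j.isLt
  simp only [this]
  rw [Fin.univ_val_map, List.ofFn_get]

lemma Mcount_val (al nu : Multiset ℕ) (hp : ∀ x ∈ nu, 0 < x) :
    (Mcount al nu : ℚ) = val ((al.map fun a : ℕ => hc () (a : ℤ)).prod) (uu nu) := by
  have hn := fin_map_getD (nu.sort (· ≤ ·)) (Multiset.card nu) (by simp)
  have ha := fin_map_getD (al.sort (· ≤ ·)) (Multiset.card al) (by simp)
  rw [Multiset.sort_eq] at hn ha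
  have e1 : (al.map fun a : ℕ => hc () (a : ℤ)).prod
      = ∏ i : Fin (Multiset.card al), hc () (((al.sort (· ≤ ·)).getD i 0 : ℕ) : ℤ) := by
    conv_lhs => rw [← ha]
    rw [Multiset.map_map]
    rfl
  have e2 : uu nu = (Finset.univ : Finset (Fin (Multiset.card nu))).val.map
      (fun j : Fin (Multiset.card nu) => ((nu.sort (· ≤ ·)).getD j 0, ())) := by
    unfold uu
    conv_lhs => rw [← hn]
    rw [Multiset.map_map]
    rfl
  rw [e1, e2, cnt_val]
  · unfold Mcount
    rw [Fintype.card_subtype, Finset.card_filter]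
    push_cast
    refine Finset.sum_congr rfl fun f _ => ?_
    congr 1
    refine propext (forall_congr' fun i => ?_)
    rw [Finset.sum_filter]
    rw [← @Nat.cast_inj ℤ]
    push_cast
    congr!
  · intro j
    apply hp
    have := Multiset.mem_map_of_mem (fun j : Fin (Multiset.card nu) => (nu.sort (· ≤ ·)).getD j 0)
      (Finset.mem_univ_val j)
    rw [hn] at this
    exact this

lemma prod_filter_one {ι A : Type*} [CommMonoid A] (s : Multiset ι) (f : ι → A) (P : ι → Prop)
    (h : ∀ i, ¬ P i → f i = 1) : (s.map f).prod = ((s.filter P).map f).prod := by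
  conv_lhs => rw [← Multiset.filter_add_not P s]
  rw [Multiset.map_add, Multiset.prod_add]
  rw [Multiset.prod_eq_one (s := Multiset.map _ (Multiset.filter (fun x => ¬ P x) s)), mul_one]
  intro y hy
  simp only [Multiset.mem_map, Multiset.mem_filter] at hy
  obtain ⟨x, ⟨_, hx⟩, rfl⟩ := hy
  exact h x hx

lemma sval_val (lam nu : Multiset ℕ) (hp : ∀ x ∈ nu, 0 < x) :
    sval lam nu = val (JT () (Multiset.card lam) lam) (uu nu) := by
  unfold JT
  rw [← Matrix.det_transpose, Matrix.det_apply, val_sum]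
  unfold sval
  refine Finset.sum_congr rfl fun σ _ => ?_
  rw [Units.smul_def, ← Int.cast_smul_eq_zsmul ℚ, val_smul]
  congr 1
  split_ifs with h
  · rw [Mcount_val _ _ hp]
    congr 1
    rw [Multiset.filter_map]
    conv_rhs => rw [Finset.prod_eq_multiset_prod]
    rw [prod_filter_one (P := fun i : Fin (Multiset.card lam) => row lam i + σ i - i ≠ 0)]
    rotate_left
    · intro i hi
      have h1 := h i
      change (i : ℕ) ≤ row lam i + _ at h1
      simp only [Matrix.transpose_apply, Matrix.of_apply]
      have : (row lam i : ℤ) - i + σ i = 0 := by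
        simp only [not_not] at hi
        omega
      rw [this, hc, hz_zero]
    rw [Multiset.map_map]
    congr 1
    refine Multiset.map_congr ?_ ?_
    · have key : ∀ (s : Multiset (Fin (Multiset.card lam))) (p q : Fin (Multiset.card lam) → Prop)
          (d1 : DecidablePred p) (d2 : DecidablePred q), p = q →
          @Multiset.filter _ p d1 s = @Multiset.filter _ q d2 s := by
        intro s p q d1 d2 h
        subst h
        congr
      exact key _ _ _ _ _ rfl
    · intro i _
      have h1 := h i
      change (i : ℕ) ≤ row lam i + _ at h1
      simp only [Function.comp, Matrix.transpose_apply, Matrix.of_apply]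
      congr 1
      change ((row lam i + _ - _ : ℕ) : ℤ) = _
      omega
  · push Not at h
    obtain ⟨i, hi⟩ := h
    change row lam i + _ < (i : ℕ) at hi
    rw [Finset.prod_eq_zero (Finset.mem_univ i), val_z]
    simp only [Matrix.transpose_apply, Matrix.of_apply]
    exact hz_neg _ (by omega)

end CB

namespace CB

/-- centraliser order -/
def zz (ν : Multiset ℕ) : ℚ := (ν.prod : ℚ) * ∏ i ∈ ν.toFinset, ((ν.count i).factorial : ℚ)

lemma prod_count (ν : Multiset ℕ) (S : Finset ℕ) (h : ν.toFinset ⊆ S) :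
    ∏ i ∈ ν.toFinset, ((ν.count i).factorial : ℚ) = ∏ i ∈ S, ((ν.count i).factorial : ℚ) := by
  refine Finset.prod_subset h fun x _ hx => ?_
  rw [Multiset.mem_toFinset, ← Multiset.count_eq_zero] at hx
  simp [hx]

lemma zz_cons (k : ℕ) (ν : Multiset ℕ) : zz (k ::ₘ ν) = k * (ν.count k + 1) * zz ν := by
  unfold zz
  rw [prod_count (k ::ₘ ν) (insert k ν.toFinset) (by simp),
    prod_count ν (insert k ν.toFinset) (Finset.subset_insert _ _),
    ← Finset.mul_prod_erase _ _ (Finset.mem_insert_self k ν.toFinset),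
    ← Finset.mul_prod_erase (insert k ν.toFinset) _ (Finset.mem_insert_self k ν.toFinset)]
  have : ∏ x ∈ (insert k ν.toFinset).erase k, (((k ::ₘ ν).count x).factorial : ℚ)
      = ∏ x ∈ (insert k ν.toFinset).erase k, ((ν.count x).factorial : ℚ) := by
    refine Finset.prod_congr rfl fun x hx => ?_
    rw [Multiset.count_cons_of_ne (Finset.ne_of_mem_erase hx)]
  rw [this, Multiset.count_cons_self, Nat.factorial_succ, Multiset.prod_cons]
  push_cast
  ring

lemma zz_pos (ν : Multiset ℕ) (h : ∀ x ∈ ν, 0 < x) : 0 < zz ν := by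
  unfold zz
  have : 0 < ν.prod := Multiset.prod_pos h
  positivity

lemma cycM_part {n : ℕ} (σ : Equiv.Perm (Fin n)) :
    cycM σ = σ.partition.parts := by
  unfold cycM
  rw [Equiv.Perm.parts_partition]
  simp

lemma cycM_pos {n : ℕ} (σ : Equiv.Perm (Fin n)) : ∀ x ∈ cycM σ, 0 < x := by
  rw [cycM_part]; exact fun x hx => σ.partition.parts_pos hx

lemma cycM_sum {n : ℕ} (σ : Equiv.Perm (Fin n)) : (cycM σ).sum = n := by
  rw [cycM_part, σ.partition.parts_sum]; simp

lemma cycM_inv {n : ℕ} (σ : Equiv.Perm (Fin n)) : cycM σ⁻¹ = cycM σ := by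
  unfold cycM
  rw [Equiv.Perm.cycleType_inv, Equiv.Perm.support_inv]

lemma split_ones (ν : Multiset ℕ) (h : ∀ x ∈ ν, 0 < x) :
    ν = ν.filter (fun k => 2 ≤ k) + Multiset.replicate (ν.sum - (ν.filter (fun k => 2 ≤ k)).sum) 1 := by
  have h1 : ν.filter (fun k => ¬ 2 ≤ k)
      = Multiset.replicate (Multiset.card (ν.filter (fun k => ¬ 2 ≤ k))) 1 := by
    rw [Multiset.eq_replicate]
    refine ⟨rfl, fun x hx => ?_⟩
    rw [Multiset.mem_filter] at hx
    have := h x hx.1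
    omega
  have h2 := Multiset.filter_add_not (fun k => 2 ≤ k) ν
  have h3 : ν.sum = (ν.filter (fun k => 2 ≤ k)).sum + Multiset.card (ν.filter (fun k => ¬ 2 ≤ k)) := by
    conv_lhs => rw [← h2, Multiset.sum_add, h1]
    simp
  rw [h3, Nat.add_sub_cancel_left, ← h1, h2]

lemma cycM_eq_iff {n : ℕ} (σ : Equiv.Perm (Fin n)) (ν : Multiset ℕ) (h : ∀ x ∈ ν, 0 < x)
    (hs : ν.sum = n) : cycM σ = ν ↔ σ.cycleType = ν.filter (fun k => 2 ≤ k) := by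
  have h0 : (cycM σ).filter (fun k => 2 ≤ k) = σ.cycleType := by
    rw [cycM_part]; exact Equiv.Perm.filter_parts_partition_eq_cycleType
  constructor
  · rintro rfl; exact h0.symm
  · intro h1
    rw [split_ones _ (cycM_pos σ), split_ones ν h, h0, h1, cycM_sum, hs]

lemma card_cycM {n : ℕ} (ν : Multiset ℕ) (h : ∀ x ∈ ν, 0 < x) (hs : ν.sum = n) :
    ((Finset.univ.filter fun σ : Equiv.Perm (Fin n) => cycM σ = ν).card : ℚ) * zz ν = n.factorial := by
  have e : (Finset.univ.filter fun σ : Equiv.Perm (Fin n) => cycM σ = ν)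
      = Finset.univ.filter fun σ : Equiv.Perm (Fin n) => σ.cycleType = ν.filter (fun k => 2 ≤ k) := by
    ext σ
    simp only [Finset.mem_filter, Finset.mem_univ, true_and]
    exact cycM_eq_iff σ ν h hs
  rw [e]
  set m := ν.filter (fun k => 2 ≤ k) with hm
  have hle : m.sum ≤ n := by
    rw [← hs, hm]
    have h2 := Multiset.filter_add_not (fun k => 2 ≤ k) ν
    conv_rhs => rw [← h2, Multiset.sum_add]
    exact Nat.le_add_right _ _
  have h2 : ∀ a ∈ m, 2 ≤ a := by
    intro a ha
    rw [hm, Multiset.mem_filter] at ha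
    exact ha.2
  have key := Equiv.Perm.card_of_cycleType_mul_eq (Fin n) m
  rw [if_pos ⟨by simpa using hle, h2⟩] at key
  have h1m : m.count 1 = 0 := Multiset.count_eq_zero.mpr fun h => by have := h2 1 h; omega
  have hz : zz ν = ((n - m.sum).factorial * m.prod * (∏ n ∈ m.toFinset, (m.count n).factorial) : ℕ) := by
    have hsp := split_ones ν h
    rw [← hm, hs] at hsp
    unfold zz
    rw [prod_count ν (insert 1 m.toFinset)]
    · rw [← Finset.mul_prod_erase _ _ (Finset.mem_insert_self 1 m.toFinset), Finset.erase_insert]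
      · have a1 : ν.prod = m.prod := by
          conv_lhs => rw [hsp]
          simp
        have a2 : ν.count 1 = n - m.sum := by
          conv_lhs => rw [hsp]
          simp [h1m]
        have a3 : ∏ x ∈ m.toFinset, ((ν.count x).factorial : ℚ)
            = ∏ x ∈ m.toFinset, ((m.count x).factorial : ℚ) := by
          refine Finset.prod_congr rfl fun x hx => ?_
          have : x ≠ 1 := by
            have := h2 x (by simpa using hx)
            omega
          conv_lhs => rw [hsp]
          rw [Multiset.count_add, Multiset.count_replicate, if_neg (fun h => this h.symm), add_zero]
        rw [a1, a2, a3]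
        push_cast
        ring
      · rw [Multiset.mem_toFinset]; exact Multiset.count_eq_zero.mp h1m
    · rw [hsp]
      intro x hx
      simp only [Multiset.mem_toFinset, Multiset.mem_add, Multiset.mem_replicate] at hx
      simp only [Finset.mem_insert, Multiset.mem_toFinset]
      tauto
  rw [hz]
  rw [Fintype.card_fin] at key
  rw [← Nat.cast_mul]
  congr 1

/-- weighted sum over partitions -/
def PS (n : ℕ) (Ψ : Multiset ℕ → ℚ) : ℚ := ∑ ν : Nat.Partition n, Ψ ν.parts / zz ν.parts

lemma avg_PS (n : ℕ) (Ψ : Multiset ℕ → ℚ) :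
    ((n.factorial : ℚ))⁻¹ * ∑ σ : Equiv.Perm (Fin n), Ψ (cycM σ) = PS n Ψ := by
  let pf : Equiv.Perm (Fin n) → Nat.Partition n := fun σ => ⟨cycM σ, fun {x} hx => cycM_pos σ x hx, cycM_sum σ⟩
  rw [← Finset.sum_fiberwise_of_maps_to (s := Finset.univ) (t := Finset.univ) (g := pf) (by simp)]
  unfold PS
  rw [Finset.mul_sum]
  refine Finset.sum_congr rfl fun ν _ => ?_
  have h1 : ∀ σ ∈ Finset.univ.filter (fun σ => pf σ = ν), Ψ (cycM σ) = Ψ ν.parts := by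
    intro σ hσ
    rw [← (Finset.mem_filter.mp hσ).2]
  rw [Finset.sum_congr rfl h1, Finset.sum_const, nsmul_eq_mul]
  have h2 := card_cycM (n := n) ν.parts (fun x hx => ν.parts_pos hx) ν.parts_sum
  have h3 := zz_pos ν.parts (fun x hx => ν.parts_pos hx)
  have h4 : (Finset.univ.filter fun σ => pf σ = ν)
      = (Finset.univ.filter fun σ : Equiv.Perm (Fin n) => cycM σ = ν.parts) := by
    ext σ
    simp only [Finset.mem_filter, Finset.mem_univ, true_and, pf]
    exact ⟨fun h => by rw [← h], fun h => Nat.Partition.ext h⟩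
  rw [h4, ← h2]
  have h5 : ((Finset.univ.filter fun σ : Equiv.Perm (Fin n) => cycM σ = ν.parts).card : ℚ) ≠ 0 := by
    intro h0
    rw [h0, zero_mul] at h2
    have : (0 : ℚ) < n.factorial := by positivity
    rw [← h2] at this
    exact lt_irrefl _ this
  field_simp

lemma PS_term (n k : ℕ) (hk : 0 < k) (hkn : k ≤ n) (Ψ : Multiset ℕ → ℚ) :
    ∑ ν : Nat.Partition n, (k * ν.parts.count k : ℚ) * (Ψ ν.parts / zz ν.parts)
      = PS (n - k) (fun ν => Ψ (k ::ₘ ν)) := by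
  unfold PS
  symm
  have hf : ∑ ν : Nat.Partition n, (k * ν.parts.count k : ℚ) * (Ψ ν.parts / zz ν.parts)
      = ∑ ν ∈ Finset.univ.filter (fun ν : Nat.Partition n => k ∈ ν.parts),
        (k * ν.parts.count k : ℚ) * (Ψ ν.parts / zz ν.parts) := by
    rw [Finset.sum_filter]
    refine Finset.sum_congr rfl fun ν _ => ?_
    split_ifs with h
    · rfl
    · rw [Multiset.count_eq_zero.mpr h]; simp
  rw [hf]
  refine Finset.sum_bij' (fun (μ : Nat.Partition (n - k)) _ =>
      (⟨k ::ₘ μ.parts, fun {x} hx => by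
        rcases Multiset.mem_cons.mp hx with rfl | h
        · exact hk
        · exact μ.parts_pos h, by rw [Multiset.sum_cons, μ.parts_sum]; omega⟩ : Nat.Partition n))
    (fun ν hν => (⟨ν.parts.erase k, fun {x} hx => ν.parts_pos (Multiset.mem_of_mem_erase hx), by
        have h1 := ν.parts_sum
        rw [← Multiset.cons_erase (Finset.mem_filter.mp hν).2, Multiset.sum_cons] at h1
        omega⟩ : Nat.Partition (n - k))) ?_ ?_ ?_ ?_ ?_
  · intro μ _; simp
  · intro ν _; simp
  · intro μ _; apply Nat.Partition.ext; simp
  · intro ν hν; apply Nat.Partition.ext; simp [Multiset.cons_erase (Finset.mem_filter.mp hν).2]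
  · intro μ _
    simp only
    rw [zz_cons, Multiset.count_cons_self]
    have h3 := zz_pos μ.parts (fun x hx => μ.parts_pos hx)
    have : (0 : ℚ) < k := by exact_mod_cast hk
    have h4 : (0 : ℚ) < (μ.parts.count k : ℚ) + 1 := by positivity
    push_cast
    field_simp

lemma PS_succ (n : ℕ) (Ψ : Multiset ℕ → ℚ) : PS (n + 1) Ψ = ((n + 1 : ℚ)⁻¹) *
    ∑ k ∈ Finset.range (n + 1), PS (n - k) (fun ν => Ψ ((k + 1) ::ₘ ν)) := by
  have h1 : ∀ k ∈ Finset.range (n + 1), PS (n - k) (fun ν => Ψ ((k + 1) ::ₘ ν))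
      = ∑ ν : Nat.Partition (n + 1), (((k + 1 : ℕ) : ℚ) * ν.parts.count (k + 1)) * (Ψ ν.parts / zz ν.parts) := by
    intro k hk
    rw [PS_term (n + 1) (k + 1) (by omega) (by simp at hk; omega)]
    congr 1
    omega
  rw [Finset.sum_congr rfl h1, Finset.sum_comm]
  have h2 : ∀ ν : Nat.Partition (n + 1), ∑ k ∈ Finset.range (n + 1),
      (((k + 1 : ℕ) : ℚ) * ν.parts.count (k + 1)) = (n + 1 : ℚ) := by
    intro ν
    have h3 : ν.parts.sum = ∑ k ∈ Finset.range (n + 2), ν.parts.count k * k := by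
      rw [Finset.sum_multiset_count]
      simp only [smul_eq_mul]
      refine Finset.sum_subset ?_ ?_
      · intro x hx
        rw [Multiset.mem_toFinset] at hx
        have := Multiset.le_sum_of_mem hx
        rw [ν.parts_sum] at this
        simp; omega
      · intro x _ hx
        rw [Multiset.mem_toFinset] at hx
        rw [Multiset.count_eq_zero.mpr hx, zero_mul]
    rw [ν.parts_sum, Finset.sum_range_succ'] at h3
    simp only [mul_zero, add_zero] at h3
    have h4 : ((n + 1 : ℕ) : ℚ) = ∑ k ∈ Finset.range (n + 1), ((ν.parts.count (k+1) * (k+1) : ℕ) : ℚ) := by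
      conv_lhs => rw [h3]
      push_cast; rfl
    push_cast at h4 ⊢
    rw [h4]
    exact Finset.sum_congr rfl fun k _ => mul_comm _ _
  simp only [← Finset.sum_mul, h2]
  rw [← Finset.mul_sum, ← mul_assoc, inv_mul_cancel₀ (by positivity), one_mul]
  rfl

section
variable {η : Type*} [Fintype η]

/-- sum over all colourings of a multiset -/
def KK (ν : Multiset ℕ) : (Multiset (ℕ × η) → ℚ) → ℚ :=
  haveI : LeftCommutative (fun (k : ℕ) (G : (Multiset (ℕ × η) → ℚ) → ℚ) =>
      fun Φ : Multiset (ℕ × η) → ℚ => ∑ c : η, G (fun μ => Φ ((k, c) ::ₘ μ))) :=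
    ⟨fun a b G => by
      funext Φ
      rw [Finset.sum_comm]
      simp only [Multiset.cons_swap]⟩
  Multiset.foldr (fun (k : ℕ) (G : (Multiset (ℕ × η) → ℚ) → ℚ) =>
      fun Φ : Multiset (ℕ × η) → ℚ => ∑ c : η, G (fun μ => Φ ((k, c) ::ₘ μ))) (fun Φ => Φ 0) ν

lemma KK_zero (Φ : Multiset (ℕ × η) → ℚ) : KK 0 Φ = Φ 0 := by
  unfold KK; rw [Multiset.foldr_zero]

lemma KK_cons (k : ℕ) (ν : Multiset ℕ) (Φ : Multiset (ℕ × η) → ℚ) :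
    KK (k ::ₘ ν) Φ = ∑ c : η, KK ν (fun μ => Φ ((k, c) ::ₘ μ)) := by
  unfold KK; rw [Multiset.foldr_cons]

lemma PS_sum {ι : Type*} (n : ℕ) (s : Finset ι) (Ψ : ι → Multiset ℕ → ℚ) :
    PS n (fun ν => ∑ c ∈ s, Ψ c ν) = ∑ c ∈ s, PS n (Ψ c) := by
  unfold PS
  rw [Finset.sum_comm]
  simp only [Finset.sum_div]

lemma PS_KK : ∀ (n : ℕ) (Φ : Multiset (ℕ × η) → ℚ), PS n (fun ν => KK ν Φ) = EE n Φ := by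
  intro n
  induction n using Nat.strong_induction_on with
  | _ n ih =>
    intro Φ
    rcases n with _ | n
    · rw [EE_zero]
      unfold PS
      have : ∀ ν : Nat.Partition 0, ν.parts = 0 := fun ν => by
        have : ν = default := Subsingleton.elim _ _
        rw [this]; rfl
      simp [this, KK_zero, zz]
    · rw [PS_succ, EE_succ]
      congr 1
      refine Finset.sum_congr rfl fun k hk => ?_
      simp only [KK_cons]
      rw [PS_sum]
      exact Finset.sum_congr rfl fun c _ => ih (n - k) (by omega) _

lemma avg_KK (n : ℕ) (Φ : Multiset (ℕ × η) → ℚ) :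
    ((n.factorial : ℚ))⁻¹ * ∑ σ : Equiv.Perm (Fin n), KK (cycM σ) Φ = EE n Φ := by
  rw [avg_PS n (fun ν => KK ν Φ), PS_KK]

lemma KK_fin : ∀ (n : ℕ) (len : Fin n → ℕ) (Φ : Multiset (ℕ × η) → ℚ),
    ∑ c : Fin n → η, Φ ((Finset.univ : Finset (Fin n)).val.map fun q => (len q, c q))
      = KK ((Finset.univ : Finset (Fin n)).val.map len) Φ := by
  intro n
  induction n with
  | zero =>
    intro len Φ
    have : (Finset.univ : Finset (Fin 0)).val = 0 := rfl
    simp [this, KK_zero]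
  | succ n ih =>
    intro len Φ
    rw [← Equiv.sum_comp (Fin.consEquiv (fun _ : Fin (n+1) => η)), Fintype.sum_prod_type]
    rw [Fin.univ_succ]
    simp only [Finset.cons_val, Multiset.map_cons, KK_cons, Finset.map_val, Multiset.map_map]
    refine Finset.sum_congr rfl fun c _ => ?_
    exact Eq.trans (Finset.sum_congr rfl fun f _ => rfl) (ih (fun j => len j.succ) (fun μ => Φ ((len 0, c) ::ₘ μ)))

lemma KK_fun {Q : Type*} [Fintype Q] (len : Q → ℕ) (Φ : Multiset (ℕ × η) → ℚ) :
    ∑ c : Q → η, Φ ((Finset.univ : Finset Q).val.map fun q => (len q, c q))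
      = KK ((Finset.univ : Finset Q).val.map len) Φ := by
  let e := Fintype.equivFin Q
  have hu : ∀ {A : Type _} (f : Q → A), (Finset.univ : Finset Q).val.map f
      = (Finset.univ : Finset (Fin (Fintype.card Q))).val.map (fun j => f (e.symm j)) := by
    intro A f
    rw [← Finset.map_univ_equiv e.symm, Finset.map_val, Multiset.map_map]
    rfl
  rw [hu len, ← KK_fin, ← Equiv.sum_comp (e.arrowCongr (Equiv.refl η)).symm]
  refine Finset.sum_congr rfl fun c _ => ?_
  congr 1
  rw [← Finset.map_univ_equiv e.symm, Finset.map_val, Multiset.map_map]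
  refine Multiset.map_congr rfl fun j _ => ?_
  simp

lemma KK_unit (ν : Multiset ℕ) : ∀ (Φ : Multiset (ℕ × Unit) → ℚ), KK ν Φ = Φ (uu ν) := by
  induction ν using Multiset.induction_on with
  | empty => intro Φ; rw [KK_zero]; rfl
  | cons k ν ih => intro Φ; rw [KK_cons]; simp [ih, uu]

end

/-- the class function attached to a symmetric function -/
def ch (n : ℕ) (F : R Unit) : Equiv.Perm (Fin n) → ℚ := fun σ => val F (uu (cycM σ))

lemma sp_ch (n : ℕ) (F G : R Unit) : sp (ch n F) (ch n G) = ip n F G := by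
  unfold sp ip
  rw [← avg_KK]
  simp only [ch, cycM_inv, KK_unit, Fintype.card_perm, Fintype.card_fin]

lemma ch_JT {n : ℕ} (lam : Nat.Partition n) (N : ℕ) (h : Multiset.card lam.parts ≤ N) :
    ch n (JT () N lam.parts) = sFun lam := by
  funext σ
  unfold ch sFun
  rw [sval_val _ _ (cycM_pos σ), JT_eq _ _ _ h]

end CB

namespace CB
open Equiv.Perm

section cyc
variable {w : ℕ} {A : Type*}

/-- the length of the cycle through `i` -/
def clen (σ : Equiv.Perm (Fin w)) (i : Fin w) : ℕ := (Finset.univ.filter (fun j => σ.SameCycle i j)).card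

lemma inv_same {σ : Equiv.Perm (Fin w)} {F : Fin w → A} (hF : ∀ i, F (σ i) = F i) {i j : Fin w}
    (h : σ.SameCycle i j) : F i = F j := by
  obtain ⟨n, _, hn⟩ := h.exists_pow_eq'
  rw [← hn]
  have key : ∀ m : ℕ, F i = F ((σ ^ m) i) := by
    intro m
    induction m with
    | zero => simp
    | succ m ih => rw [pow_succ', Equiv.Perm.mul_apply, hF, ← ih]
  exact key n

/-- the set of cycles -/
abbrev Qt (σ : Equiv.Perm (Fin w)) := Quotient (Equiv.Perm.SameCycle.setoid σ)

/-- transversals of the cycles -/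
def IsTr (σ : Equiv.Perm (Fin w)) (S : Finset (Fin w)) : Prop :=
  (∀ i, ∃ j ∈ S, σ.SameCycle i j) ∧ (∀ i ∈ S, ∀ j ∈ S, σ.SameCycle i j → i = j)

lemma tr_mk {σ : Equiv.Perm (Fin w)} {S : Finset (Fin w)} (h : IsTr σ S) :
    S.val.map (fun i => (Quotient.mk _ i : Qt σ)) = (Finset.univ : Finset (Qt σ)).val := by
  refine (Multiset.Nodup.ext ?_ Finset.univ.nodup).mpr fun q => ?_
  · refine Multiset.Nodup.map_on ?_ S.nodup
    intro i hi j hj hij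
    exact h.2 i hi j hj (Quotient.exact hij)
  · simp only [Multiset.mem_map, Finset.mem_val, Finset.mem_univ, iff_true]
    induction q using Quotient.inductionOn with
    | h i =>
      obtain ⟨j, hj, hij⟩ := h.1 i
      exact ⟨j, hj, Quotient.sound hij.symm⟩

lemma tr_bp (σ : Equiv.Perm (Fin w)) : IsTr σ (basepoints σ) := by
  constructor
  · intro i
    have hne : (Finset.univ.filter (fun j => σ.SameCycle i j)).Nonempty := ⟨i, by simp [SameCycle.refl]⟩
    refine ⟨Finset.min' _ hne, ?_, ?_⟩
    · have := Finset.min'_mem _ hne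
      rw [Finset.mem_filter] at this
      simp only [basepoints, Finset.mem_filter, Finset.mem_univ, true_and]
      intro j hj
      exact Finset.min'_le _ _ (by simpa using this.2.trans hj)
    · have := Finset.min'_mem _ hne
      rw [Finset.mem_filter] at this
      exact this.2
  · intro i hi j hj hij
    simp only [basepoints, Finset.mem_filter, Finset.mem_univ, true_and] at hi hj
    exact le_antisymm (hi j hij) (hj i hij.symm)

lemma tr_map {σ : Equiv.Perm (Fin w)} {S : Finset (Fin w)} (h : IsTr σ S) (F : Qt σ → A) :
    S.val.map (fun i => F (Quotient.mk _ i)) = (Finset.univ : Finset (Qt σ)).val.map F := by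
  rw [← tr_mk h, Multiset.map_map]; rfl

lemma tr_eq {σ : Equiv.Perm (Fin w)} {S : Finset (Fin w)} (h : IsTr σ S) (F : Fin w → A)
    (hF : ∀ i, F (σ i) = F i) : (basepoints σ).val.map F = S.val.map F := by
  let F' : Qt σ → A := Quotient.lift F (fun i j hij => inv_same hF hij)
  exact (tr_map (tr_bp σ) F').trans (tr_map h F').symm

lemma tr_conj {σ : Equiv.Perm (Fin w)} {S : Finset (Fin w)} (h : IsTr σ S) (τ : Equiv.Perm (Fin w)) :
    IsTr (τ * σ * τ⁻¹) (S.map τ.toEmbedding) := by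
  constructor
  · intro i
    obtain ⟨j, hj, hij⟩ := h.1 (τ⁻¹ i)
    refine ⟨τ j, by simpa using hj, ?_⟩
    rw [sameCycle_conj]; simpa using hij
  · intro i hi j hj hij
    rw [Finset.mem_map] at hi hj
    obtain ⟨a, ha, rfl⟩ := hi
    obtain ⟨b, hb, rfl⟩ := hj
    rw [sameCycle_conj] at hij
    rw [h.2 a ha b hb (by simpa using hij)]

lemma clen_conj (σ τ : Equiv.Perm (Fin w)) (i : Fin w) : clen (τ * σ * τ⁻¹) (τ i) = clen σ i := by
  unfold clen
  conv_rhs => rw [← Finset.card_map τ.toEmbedding]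
  congr 1
  ext j
  simp only [Finset.mem_filter, Finset.mem_univ, true_and, sameCycle_conj]
  rw [Finset.mem_map_equiv]
  simp only [Finset.mem_filter, Finset.mem_univ, true_and]
  rw [show τ⁻¹ (τ i) = i by simp]
  rfl

lemma clen_inv (σ : Equiv.Perm (Fin w)) (i : Fin w) : clen σ⁻¹ i = clen σ i := by
  unfold clen; simp only [sameCycle_inv]

lemma clen_apply (σ : Equiv.Perm (Fin w)) (i : Fin w) : clen σ (σ i) = clen σ i := by
  unfold clen; simp only [sameCycle_apply_left]

lemma bp_inv (σ : Equiv.Perm (Fin w)) : basepoints σ⁻¹ = basepoints σ := by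
  unfold basepoints; simp only [sameCycle_inv]

lemma clen_image (σ : Equiv.Perm (Fin w)) (i : Fin w) (p : ℕ) (hp : 0 < p) (h : (σ ^ p) i = i) :
    Finset.univ.filter (fun j => σ.SameCycle i j) = (Finset.range p).image (fun k => (σ ^ k) i) := by
  ext j
  simp only [Finset.mem_filter, Finset.mem_univ, true_and, Finset.mem_image, Finset.mem_range]
  constructor
  · intro hj
    obtain ⟨n, _, hn⟩ := hj.exists_pow_eq'
    refine ⟨n % p, Nat.mod_lt _ hp, ?_⟩
    rw [← hn]
    conv_rhs => rw [← Nat.mod_add_div n p, pow_add, Equiv.Perm.mul_apply, pow_mul]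
    congr 1
    generalize n / p = m
    induction m with
    | zero => simp
    | succ m ih => rw [pow_succ, Equiv.Perm.mul_apply, h]; exact ih
  · rintro ⟨k, _, rfl⟩
    exact ⟨k, by simp⟩

lemma clen_le (σ : Equiv.Perm (Fin w)) (i : Fin w) (p : ℕ) (hp : 0 < p) (h : (σ ^ p) i = i) :
    clen σ i ≤ p := by
  unfold clen
  rw [clen_image σ i p hp h]
  exact Finset.card_image_le.trans (by simp)

lemma clen_per (σ : Equiv.Perm (Fin w)) (i : Fin w) : (σ ^ (clen σ i)) i = i := by
  have hex : ∃ p, 0 < p ∧ (σ ^ p) i = i := ⟨orderOf σ, orderOf_pos σ, by rw [pow_orderOf_eq_one]; rfl⟩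
  obtain ⟨h1, h2⟩ := Nat.find_spec hex
  set p := Nat.find hex with hp
  have : clen σ i = p := by
    unfold clen
    rw [clen_image σ i p h1 h2, Finset.card_image_of_injOn, Finset.card_range]
    have key : ∀ a b : ℕ, a ≤ b → b < p → (σ ^ a) i = (σ ^ b) i → a = b := by
      intro a b hab hb h
      by_contra hne
      have : (σ ^ (b - a)) i = i := by
        apply (σ ^ a).injective
        rw [← Equiv.Perm.mul_apply, ← pow_add, Nat.add_sub_cancel' hab, h]
      exact Nat.find_min hex (m := b - a) (by omega) ⟨by omega, this⟩
    intro a ha b hb hab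
    simp only [Finset.coe_range, Set.mem_Iio] at ha hb
    rcases le_total a b with h | h
    · exact key a b h hb hab
    · exact (key b a h ha hab.symm).symm
  rw [this]; exact h2

lemma clen_pos (σ : Equiv.Perm (Fin w)) (i : Fin w) : 0 < clen σ i :=
  Finset.card_pos.mpr ⟨i, by simp [SameCycle.refl]⟩

lemma clen_cycM (σ : Equiv.Perm (Fin w)) : (basepoints σ).val.map (clen σ) = cycM σ := by
  have h1 : (basepoints σ).val = ((basepoints σ).filter (fun i => σ i ≠ i)).val
      + ((basepoints σ).filter (fun i => ¬ σ i ≠ i)).val := by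
    rw [Finset.filter_val, Finset.filter_val, Multiset.filter_add_not]
  rw [h1, Multiset.map_add]
  unfold cycM
  have hfix : ∀ i j, σ i = i → σ.SameCycle i j → i = j := fun i j h hij => by
    obtain ⟨n, _, hn⟩ := hij.exists_pow_eq'
    rw [← hn]; exact (Equiv.Perm.pow_apply_eq_self_of_apply_eq_self h n).symm
  congr 1
  · rw [Equiv.Perm.cycleType_def]
    have : (σ.cycleFactorsFinset).val = ((basepoints σ).filter (fun i => σ i ≠ i)).val.map σ.cycleOf := by
      refine (Multiset.Nodup.ext σ.cycleFactorsFinset.nodup ?_).mpr fun c => ?_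
      · refine Multiset.Nodup.map_on ?_ (Finset.nodup _)
        intro i hi j hj hij
        simp only [Finset.mem_val, Finset.mem_filter] at hi hj
        refine (tr_bp σ).2 i hi.1 j hj.1 ?_
        have : j ∈ (σ.cycleOf j).support := by
          rw [mem_support_cycleOf_iff' hj.2]
        rw [← hij, mem_support_cycleOf_iff' hi.2] at this
        exact this
      · simp only [Finset.mem_val, Multiset.mem_map, Finset.mem_filter]
        constructor
        · intro hc
          have hcy := (mem_cycleFactorsFinset_iff.mp hc).1
          obtain ⟨a, ha⟩ := hcy.nonempty_support
          have hca := cycle_is_cycleOf ha hc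
          obtain ⟨j, hj, hij⟩ := (tr_bp σ).1 a
          refine ⟨j, ⟨hj, ?_⟩, ?_⟩
          · intro hfj
            have := hfix j a hfj hij.symm
            subst this
            have := mem_cycleFactorsFinset_support_le hc ha
            rw [mem_support] at this
            exact this hfj
          · rw [hca]; exact hij.cycleOf_eq.symm
        · rintro ⟨i, ⟨hi, hi2⟩, rfl⟩
          rw [cycleOf_mem_cycleFactorsFinset_iff, mem_support]; exact hi2
    rw [this, Multiset.map_map]
    refine Multiset.map_congr rfl fun i hi => ?_
    simp only [Finset.mem_val, Finset.mem_filter] at hi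
    unfold clen
    simp only [Function.comp]
    congr 1
    ext j
    rw [mem_support_cycleOf_iff' hi.2]
    simp
  · have hS : (basepoints σ).filter (fun i => ¬ σ i ≠ i) = (σ.support)ᶜ := by
      ext i
      simp only [basepoints, ne_eq, not_not, Finset.mem_filter, Finset.mem_univ, true_and,
        Finset.mem_compl, mem_support]
      constructor
      · exact fun h => h.2
      · intro h; exact ⟨fun j hj => (hfix i j h hj).le, h⟩
    rw [hS, Multiset.eq_replicate]
    constructor
    · rw [Multiset.card_map, Finset.card_val, Finset.card_compl, Fintype.card_fin]
    · intro b hb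
      rw [Multiset.mem_map] at hb
      obtain ⟨i, hi, rfl⟩ := hb
      simp only [Finset.mem_val, Finset.mem_compl, mem_support, ne_eq, not_not] at hi
      have := clen_le σ i 1 one_pos (by simpa using hi)
      have := clen_pos σ i
      omega

end cyc

end CB

namespace CB
open Equiv.Perm

section wr1
variable {G : Type*} [Group G] {w : ℕ}

lemma pr_inv (n : ℕ) : ∀ (f : ℕ → G), ((List.range n).map f).prod⁻¹
    = ((List.range n).map (fun k => (f (n - 1 - k))⁻¹)).prod := by
  induction n with
  | zero => intro f; simp
  | succ n ih =>
    intro f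
    rw [List.prod_range_succ, mul_inv_rev, ih, List.prod_range_succ']
    have h0 : n + 1 - 1 - 0 = n := by omega
    rw [h0]
    have h1 : ∀ k, n + 1 - 1 - (k + 1) = n - 1 - k := fun k => by omega
    simp only [h1]

lemma pr_tel (a f : ℕ → G) (n : ℕ) : ((List.range n).map (fun k => a k * f k * (a (k+1))⁻¹)).prod
    = a 0 * ((List.range n).map f).prod * (a n)⁻¹ := by
  induction n with
  | zero => simp
  | succ n ih =>
    rw [List.prod_range_succ, ih, List.prod_range_succ]
    group

lemma pr_congr (n : ℕ) (f g : ℕ → G) (h : ∀ k < n, f k = g k) :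
    ((List.range n).map f).prod = ((List.range n).map g).prod := by
  congr 1
  exact List.map_congr_left fun k hk => h k (List.mem_range.mp hk)

lemma cycleProd_eq (x : Fin w → G) (σ : Equiv.Perm (Fin w)) (i : Fin w) :
    cycleProd x σ i = ((List.range (clen σ i)).map (fun k => x ((σ⁻¹ ^ k) i))).prod := rfl

lemma per_inv (σ : Equiv.Perm (Fin w)) (i : Fin w) : (σ⁻¹ ^ (clen σ i)) i = i := by
  rw [← clen_inv]; exact clen_per _ _

/-- class of the cycle product -/
def cp (g : Wr G w) (i : Fin w) : ConjClasses G := ConjClasses.mk (cycleProd g.1 g.2 i)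

lemma cp_apply (g : Wr G w) (i : Fin w) : cp g (g.2 i) = cp g i := by
  unfold cp
  rw [ConjClasses.mk_eq_mk_iff_isConj, cycleProd_eq, cycleProd_eq, clen_apply]
  obtain ⟨x, σ⟩ := g
  show IsConj ((List.range (clen σ i)).map (fun k => x ((σ⁻¹ ^ k) (σ i)))).prod
    ((List.range (clen σ i)).map (fun k => x ((σ⁻¹ ^ k) i))).prod
  have hp := per_inv σ i
  obtain ⟨m, hm⟩ : ∃ m, clen σ i = m + 1 := ⟨clen σ i - 1, by have := clen_pos σ i; omega⟩
  rw [hm] at hp ⊢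
  rw [List.prod_range_succ', List.prod_range_succ]
  have h1 : (σ⁻¹ ^ m) i = σ i := by
    rw [pow_succ', Equiv.Perm.mul_apply, Equiv.Perm.inv_eq_iff_eq] at hp
    exact hp
  have h2 : ∀ k, (σ⁻¹ ^ (k+1)) (σ i) = (σ⁻¹ ^ k) i := fun k => by
    rw [pow_succ, Equiv.Perm.mul_apply]; simp
  simp only [h1, h2, pow_zero, Equiv.Perm.one_apply]
  rw [isConj_iff]
  exact ⟨(x (σ i))⁻¹, by group⟩

lemma cycleProd_inv (g : Wr G w) (i : Fin w) :
    cycleProd (g⁻¹).1 (g⁻¹).2 i = (cycleProd g.1 g.2 i)⁻¹ := by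
  obtain ⟨x, σ⟩ := g
  show cycleProd (fun i => (x (σ i))⁻¹) σ⁻¹ i = (cycleProd x σ i)⁻¹
  rw [cycleProd_eq, cycleProd_eq, clen_inv, pr_inv]
  refine pr_congr _ _ _ fun k hk => ?_
  congr 2
  have hp := per_inv σ i
  have : clen σ i = (k + 1) + (clen σ i - 1 - k) := by omega
  rw [this, pow_add, Equiv.Perm.mul_apply, inv_pow, Equiv.Perm.inv_eq_iff_eq, pow_succ', Equiv.Perm.mul_apply] at hp
  rw [inv_inv]; exact hp.symm

lemma conj_fst (y g : Wr G w) (i : Fin w) : (y * g * y⁻¹).1 i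
    = y.1 i * g.1 (y.2⁻¹ i) * (y.1 ((y.2 * g.2 * y.2⁻¹)⁻¹ i))⁻¹ := by
  show y.1 i * g.1 (y.2⁻¹ i) * (y.1 (y.2 ((y.2 * g.2)⁻¹ i)))⁻¹ = _
  rw [mul_inv_rev, mul_inv_rev, mul_inv_rev, inv_inv]; rfl

lemma conj_snd (y g : Wr G w) : (y * g * y⁻¹).2 = y.2 * g.2 * y.2⁻¹ := rfl

lemma cp_conj (y g : Wr G w) (i : Fin w) : cp (y * g * y⁻¹) (y.2 i) = cp g i := by
  unfold cp
  rw [ConjClasses.mk_eq_mk_iff_isConj, cycleProd_eq, cycleProd_eq, conj_snd, clen_conj]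
  have h0 : ∀ k, ((y.2 * g.2 * y.2⁻¹)⁻¹ ^ k) (y.2 i) = y.2 ((g.2⁻¹ ^ k) i) := fun k => by
    have : (y.2 * g.2 * y.2⁻¹)⁻¹ = y.2 * g.2⁻¹ * y.2⁻¹ := by group
    rw [this, conj_pow]; simp
  have h1 : ∀ k, (y * g * y⁻¹).1 (((y.2 * g.2 * y.2⁻¹)⁻¹ ^ k) (y.2 i))
      = y.1 (y.2 ((g.2⁻¹ ^ k) i)) * g.1 ((g.2⁻¹ ^ k) i) * (y.1 (y.2 ((g.2⁻¹ ^ (k+1)) i)))⁻¹ := fun k => by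
    rw [conj_fst, ← Equiv.Perm.mul_apply (y.2 * g.2 * y.2⁻¹)⁻¹, ← pow_succ', h0, h0]
    simp
  simp only [h1]
  rw [pr_tel (fun k => y.1 (y.2 ((g.2⁻¹ ^ k) i))) (fun k => g.1 ((g.2⁻¹ ^ k) i)), per_inv]
  simp only [pow_zero, Equiv.Perm.one_apply]
  rw [isConj_iff]
  exact ⟨(y.1 (y.2 i))⁻¹, by group⟩

variable {η : Type*}

/-- the cycle data of a coloured element -/
def dat (g : Wr G w) (b : Fin w → η) : Multiset (ℕ × η × ConjClasses G) :=
  (basepoints g.2).val.map (fun i => (clen g.2 i, b i, cp g i))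

lemma dat_conj (y g : Wr G w) (b : Fin w → η) (hb : ∀ i, b ((y * g * y⁻¹).2 i) = b i) :
    dat (y * g * y⁻¹) b = dat g (b ∘ y.2) := by
  unfold dat
  have htr : IsTr (y * g * y⁻¹).2 ((basepoints g.2).map y.2.toEmbedding) := tr_conj (tr_bp g.2) y.2
  refine (tr_eq htr _ ?_).trans ?_
  rotate_left
  · rw [Finset.map_val, Multiset.map_map]
    refine Multiset.map_congr rfl fun i _ => ?_
    simp only [Function.comp, Equiv.coe_toEmbedding, cp_conj, conj_snd, clen_conj]
  · intro i
    rw [clen_apply, hb, cp_apply]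

end wr1

section blocks
variable {G : Type*} [Group G] {w : ℕ} {η : Type*} [Fintype η]

lemma emb_perm (ws : η → ℕ) (h : ∑ i, ws i = w) (g : ∀ i, Wr G (ws i)) (i : η) (a : Fin (ws i)) :
    (embWr ws h g).2 (embSigma ws h ⟨i, a⟩) = embSigma ws h ⟨i, (g i).2 a⟩ := by
  simp [embWr]

lemma emb_fst (ws : η → ℕ) (h : ∑ i, ws i = w) (g : ∀ i, Wr G (ws i)) (i : η) (a : Fin (ws i)) :
    (embWr ws h g).1 (embSigma ws h ⟨i, a⟩) = (g i).1 a := by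
  simp only [embWr]
  generalize hx : (embSigma ws h).symm (embSigma ws h ⟨i, a⟩) = x
  rw [Equiv.symm_apply_apply] at hx
  subst hx; rfl

lemma emb_perm_inv (ws : η → ℕ) (h : ∑ i, ws i = w) (g : ∀ i, Wr G (ws i)) (i : η) (a : Fin (ws i)) :
    (embWr ws h g).2⁻¹ (embSigma ws h ⟨i, a⟩) = embSigma ws h ⟨i, (g i).2⁻¹ a⟩ := by
  rw [Equiv.Perm.inv_eq_iff_eq, emb_perm]; simp

lemma emb_pow_inv (ws : η → ℕ) (h : ∑ i, ws i = w) (g : ∀ i, Wr G (ws i)) (i : η) (k : ℕ) (a : Fin (ws i)) :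
    ((embWr ws h g).2⁻¹ ^ k) (embSigma ws h ⟨i, a⟩) = embSigma ws h ⟨i, ((g i).2⁻¹ ^ k) a⟩ := by
  induction k with
  | zero => simp
  | succ k ih => rw [pow_succ', Equiv.Perm.mul_apply, ih, emb_perm_inv, pow_succ', Equiv.Perm.mul_apply]

lemma emb_pow (ws : η → ℕ) (h : ∑ i, ws i = w) (g : ∀ i, Wr G (ws i)) (i : η) (k : ℕ) (a : Fin (ws i)) :
    ((embWr ws h g).2 ^ k) (embSigma ws h ⟨i, a⟩) = embSigma ws h ⟨i, ((g i).2 ^ k) a⟩ := by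
  induction k with
  | zero => simp
  | succ k ih => rw [pow_succ', Equiv.Perm.mul_apply, ih, emb_perm, pow_succ', Equiv.Perm.mul_apply]

lemma emb_same (ws : η → ℕ) (h : ∑ i, ws i = w) (g : ∀ i, Wr G (ws i)) (i : η) (a : Fin (ws i)) (j : Fin w) :
    (embWr ws h g).2.SameCycle (embSigma ws h ⟨i, a⟩) j ↔
      ∃ b, (g i).2.SameCycle a b ∧ embSigma ws h ⟨i, b⟩ = j := by
  constructor
  · intro hj
    obtain ⟨n, _, hn⟩ := hj.exists_pow_eq'
    rw [emb_pow] at hn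
    exact ⟨_, ⟨n, by simp⟩, hn⟩
  · rintro ⟨b, hb, rfl⟩
    obtain ⟨n, _, hn⟩ := hb.exists_pow_eq'
    exact ⟨n, by rw [zpow_natCast, emb_pow, hn]⟩

lemma emb_clen (ws : η → ℕ) (h : ∑ i, ws i = w) (g : ∀ i, Wr G (ws i)) (i : η) (a : Fin (ws i)) :
    clen (embWr ws h g).2 (embSigma ws h ⟨i, a⟩) = clen (g i).2 a := by
  unfold clen
  have : Finset.univ.filter (fun j => (embWr ws h g).2.SameCycle (embSigma ws h ⟨i, a⟩) j)
      = (Finset.univ.filter (fun b => (g i).2.SameCycle a b)).image (fun b => embSigma ws h ⟨i, b⟩) := by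
    ext j
    simp [emb_same]
  rw [this, Finset.card_image_of_injective]
  intro b c hbc
  simpa using hbc

lemma emb_cp (ws : η → ℕ) (h : ∑ i, ws i = w) (g : ∀ i, Wr G (ws i)) (i : η) (a : Fin (ws i)) :
    cp (embWr ws h g) (embSigma ws h ⟨i, a⟩) = cp (g i) a := by
  unfold cp
  rw [cycleProd_eq, cycleProd_eq, emb_clen]
  simp only [emb_pow_inv, emb_fst]

/-- the block colouring -/
def b0 (ws : η → ℕ) (h : ∑ i, ws i = w) (j : Fin w) : η := ((embSigma ws h).symm j).1

lemma b0_emb (ws : η → ℕ) (h : ∑ i, ws i = w) (i : η) (a : Fin (ws i)) : b0 ws h (embSigma ws h ⟨i, a⟩) = i := by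
  simp [b0]

lemma emb_ind {ws : η → ℕ} {h : ∑ i, ws i = w} {P : Fin w → Prop}
    (hP : ∀ i a, P (embSigma ws h ⟨i, a⟩)) (j : Fin w) : P j := by
  obtain ⟨⟨i, a⟩, rfl⟩ := (embSigma ws h).surjective j
  exact hP i a

lemma emb_b0 (ws : η → ℕ) (h : ∑ i, ws i = w) (g : ∀ i, Wr G (ws i)) (j : Fin w) :
    b0 ws h ((embWr ws h g).2 j) = b0 ws h j := by
  revert j
  refine emb_ind (ws := ws) (h := h) ?_
  intro i a
  rw [emb_perm, b0_emb, b0_emb]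

lemma dat_emb (ws : η → ℕ) (h : ∑ i, ws i = w) (g : ∀ i, Wr G (ws i)) :
    dat (embWr ws h g) (b0 ws h) = ∑ i, dat (g i) (fun _ => i) := by
  have htr : IsTr (embWr ws h g).2
      ((Finset.univ.sigma fun i => basepoints (g i).2).map (embSigma ws h).toEmbedding) := by
    constructor
    · refine emb_ind (ws := ws) (h := h) ?_
      intro i a
      obtain ⟨b, hb, hab⟩ := (tr_bp (g i).2).1 a
      exact ⟨embSigma ws h ⟨i, b⟩, by simpa using hb, (emb_same ws h g i a _).mpr ⟨b, hab, rfl⟩⟩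
    · intro x hx y hy hxy
      rw [Finset.mem_map] at hx hy
      obtain ⟨⟨i, a⟩, ha, rfl⟩ := hx
      obtain ⟨⟨j, c⟩, hc, rfl⟩ := hy
      simp only [Finset.mem_sigma, Finset.mem_univ, true_and] at ha hc
      simp only [Equiv.coe_toEmbedding] at hxy ⊢
      rw [emb_same] at hxy
      obtain ⟨b, hb, hE⟩ := hxy
      have := (embSigma ws h).injective hE
      obtain ⟨rfl, hbc⟩ := Sigma.mk.inj_iff.mp this
      have hbc := eq_of_heq hbc
      subst hbc
      rw [(tr_bp (g i).2).2 a ha b hc hb]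
  unfold dat
  rw [tr_eq htr]
  · rw [Finset.map_val, Multiset.map_map]
    show ((Finset.univ : Finset η).val.bind fun i => (basepoints (g i).2).val.map (Sigma.mk i)).map _ = _
    rw [Multiset.map_bind]
    show (Multiset.map _ _).sum = (Multiset.map _ _).sum
    congr 1
    refine Multiset.map_congr rfl fun i _ => ?_
    rw [Multiset.map_map]
    refine Multiset.map_congr rfl fun a _ => ?_
    simp only [Function.comp, Equiv.coe_toEmbedding, emb_clen, emb_cp, b0_emb]
  · intro i
    rw [clen_apply, emb_b0, cp_apply]

lemma emb_inj (ws : η → ℕ) (h : ∑ i, ws i = w) : Function.Injective (embWr (G := G) ws h) := by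
  intro g g' hg
  funext i
  refine Prod.ext ?_ ?_
  · funext a
    rw [← emb_fst ws h g, hg, emb_fst]
  · refine Equiv.ext fun a => ?_
    have h1 := emb_perm ws h g i a
    rw [hg, emb_perm] at h1
    have := (embSigma ws h).injective h1
    simpa using this.symm

lemma emb_surj (ws : η → ℕ) (h : ∑ i, ws i = w) (g : Wr G w) (hg : ∀ j, b0 ws h (g.2 j) = b0 ws h j) :
    ∃ g', embWr ws h g' = g := by
  have hex : ∀ i (a : Fin (ws i)), ∃ a' : Fin (ws i), g.2 (embSigma ws h ⟨i, a⟩) = embSigma ws h ⟨i, a'⟩ := by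
    intro i a
    have h1 := hg (embSigma ws h ⟨i, a⟩)
    rw [b0_emb] at h1
    obtain ⟨⟨j, c⟩, hc⟩ := (embSigma ws h).surjective (g.2 (embSigma ws h ⟨i, a⟩))
    rw [← hc, b0_emb] at h1
    subst h1
    exact ⟨c, hc.symm⟩
  choose f hf using hex
  have hinj : ∀ i, Function.Injective (f i) := by
    intro i a a' haa
    have : g.2 (embSigma ws h ⟨i, a⟩) = g.2 (embSigma ws h ⟨i, a'⟩) := by rw [hf, hf, haa]
    simpa using this
  refine ⟨fun i => (fun a => g.1 (embSigma ws h ⟨i, a⟩),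
    Equiv.ofBijective (f i) (Finite.injective_iff_bijective.mp (hinj i))), ?_⟩
  refine Prod.ext ?_ ?_
  · funext j
    revert j
    refine emb_ind (ws := ws) (h := h) ?_
    intro i a
    exact emb_fst ws h _ i a
  · refine Equiv.ext ?_
    refine emb_ind (ws := ws) (h := h) ?_
    intro i a
    exact (emb_perm ws h _ i a).trans (hf i a).symm

end blocks

end CB

namespace CB
open Equiv.Perm

section zeta
variable {G : Type*} [Group G] {w : ℕ} {η : Type*} [Fintype η]

/-- weight of cycle data -/
def WW (φ : η → ConjClasses G → ℚ) (Ff : η → Multiset ℕ → ℚ) (D : Multiset (ℕ × η × ConjClasses G)) : ℚ :=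
  (D.map fun x => φ x.2.1 x.2.2).prod * ∏ c, Ff c ((D.filter fun x => x.2.1 = c).map fun x => x.1)

lemma filter_sum' {ι A : Type*} (s : Finset ι) (p : A → Prop) (f : ι → Multiset A) :
    (∑ i ∈ s, f i).filter p = ∑ i ∈ s, (f i).filter p := by
  induction s using Finset.induction_on with
  | empty => simp
  | insert a s ha ih => rw [Finset.sum_insert ha, Finset.sum_insert ha, Multiset.filter_add, ih]

lemma map_sum' {ι A B : Type*} (s : Finset ι) (p : A → B) (f : ι → Multiset A) :
    (∑ i ∈ s, f i).map p = ∑ i ∈ s, (f i).map p := map_sum (Multiset.mapAddMonoidHom p) f s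

lemma msum_prod {ι : Type*} (s : Finset ι) (f : ι → Multiset ℚ) :
    (∑ i ∈ s, f i).prod = ∏ i ∈ s, (f i).prod := by
  induction s using Finset.induction_on with
  | empty => simp
  | insert a s ha ih => rw [Finset.sum_insert ha, Finset.prod_insert ha, Multiset.prod_add, ih]

lemma WW_emb (ws : η → ℕ) (h : ∑ i, ws i = w) (φs : η → G → ℚ) (fs : ∀ i, Equiv.Perm (Fin (ws i)) → ℚ)
    (φ : η → ConjClasses G → ℚ) (Ff : η → Multiset ℕ → ℚ)
    (hφ : ∀ c g, φs c g = φ c (ConjClasses.mk g)) (hF : ∀ c τ, fs c τ = Ff c (cycM τ))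
    (g : ∀ i, Wr G (ws i)) :
    ∏ i, tilprod (φs i) (g i) * fs i (g i).2 = WW φ Ff (dat (embWr ws h g) (b0 ws h)) := by
  rw [dat_emb, WW, map_sum', msum_prod, Finset.prod_mul_distrib]
  congr 1
  · refine Finset.prod_congr rfl fun i _ => ?_
    unfold dat tilprod
    rw [Multiset.map_map]
    refine Finset.prod_congr rfl fun a _ => ?_
    simp only [Function.comp]
    rw [hφ]; rfl
  · refine Finset.prod_congr rfl fun c _ => ?_
    rw [hF, filter_sum', map_sum', Finset.sum_eq_single c]
    · congr 1
      rw [Multiset.filter_eq_self.mpr, ← clen_cycM]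
      · unfold dat; rw [Multiset.map_map]; rfl
      · unfold dat
        intro x hx
        rw [Multiset.mem_map] at hx
        obtain ⟨_, _, rfl⟩ := hx; rfl
    · intro i _ hi
      rw [Multiset.filter_eq_nil.mpr]; · rfl
      unfold dat
      intro x hx
      rw [Multiset.mem_map] at hx
      obtain ⟨_, _, rfl⟩ := hx; exact hi
    · simp

lemma fib_count (σ : Equiv.Perm (Fin w)) (b : Fin w → η) (hb : ∀ i, b (σ i) = b i) (c : η) :
    (((basepoints σ).val.filter fun i => b i = c).map (clen σ)).sum
      = (Finset.univ.filter fun i => b i = c).card := by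
  have h1 : Finset.univ.filter (fun i => b i = c) = ((basepoints σ).filter fun i => b i = c).biUnion
      (fun i => Finset.univ.filter fun j => σ.SameCycle i j) := by
    ext j
    simp only [Finset.mem_filter, Finset.mem_univ, true_and, Finset.mem_biUnion]
    constructor
    · intro hj
      obtain ⟨i, hi, hij⟩ := (tr_bp σ).1 j
      exact ⟨i, ⟨hi, (inv_same hb hij).symm.trans hj⟩, hij.symm⟩
    · rintro ⟨i, ⟨_, hi⟩, hij⟩
      exact (inv_same hb hij).symm.trans hi
  rw [h1, Finset.card_biUnion]
  · rfl
  · intro i hi j hj hij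
    rw [Finset.mem_coe, Finset.mem_filter] at hi hj
    rw [Function.onFun, Finset.disjoint_left]
    intro k hk hk'
    simp only [Finset.mem_filter, Finset.mem_univ, true_and] at hk hk'
    exact hij ((tr_bp σ).2 i hi.1 j hj.1 (hk.trans hk'.symm))

lemma count_b0 (ws : η → ℕ) (h : ∑ i, ws i = w) (c : η) :
    Fintype.card {j // b0 ws h j = c} = ws c := by
  rw [← Fintype.card_fin (ws c)]
  symm
  refine Fintype.card_congr (Equiv.ofBijective (fun a => ⟨embSigma ws h ⟨c, a⟩, b0_emb _ _ _ _⟩) ⟨?_, ?_⟩)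
  · intro a a' haa
    simpa using haa
  · rintro ⟨j, hj⟩
    obtain ⟨⟨i, a⟩, rfl⟩ := (embSigma ws h).surjective j
    rw [b0_emb] at hj
    subst hj
    exact ⟨a, rfl⟩

lemma sum_b0 (ws : η → ℕ) (h : ∑ i, ws i = w) (Z : (Fin w → η) → ℚ)
    (hZ : ∀ b, Z b ≠ 0 → ∀ c, Fintype.card {j // b j = c} = ws c) :
    ∑ τ : Equiv.Perm (Fin w), Z (b0 ws h ∘ τ) = (∏ c, ((ws c).factorial : ℚ)) * ∑ b, Z b := by
  rw [← Finset.sum_fiberwise (s := Finset.univ) (g := fun τ : Equiv.Perm (Fin w) => b0 ws h ∘ τ), Finset.mul_sum]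
  refine Finset.sum_congr rfl fun b _ => ?_
  have : ∀ τ ∈ Finset.univ.filter (fun τ : Equiv.Perm (Fin w) => b0 ws h ∘ τ = b), Z (b0 ws h ∘ τ) = Z b := by
    intro τ hτ
    rw [(Finset.mem_filter.mp hτ).2]
  rw [Finset.sum_congr rfl this, Finset.sum_const, nsmul_eq_mul]
  by_cases hz : Z b = 0
  · rw [hz]; simp
  congr 1
  have hc := hZ b hz
  let τ0 : Equiv.Perm (Fin w) := Equiv.ofFiberEquiv (f := b) (g := b0 ws h)
    (fun c => Fintype.equivOfCardEq ((hc c).trans (count_b0 ws h c).symm))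
  have hτ0 : b0 ws h ∘ τ0 = b := by
    funext i
    exact Equiv.ofFiberEquiv_map _ i
  have key := DomMulAct.stabilizer_card (b0 ws h)
  simp only [count_b0] at key
  rw [← Nat.cast_prod]
  congr 1
  rw [← key, Fintype.card_subtype]
  symm
  refine Finset.card_bij' (fun τ _ => τ * τ0) (fun τ _ => τ * τ0⁻¹) ?_ ?_ ?_ ?_
  · intro τ hτ
    simp only [Finset.mem_filter, Finset.mem_univ, true_and] at hτ ⊢
    rw [← hτ0, Equiv.Perm.coe_mul, ← Function.comp_assoc, hτ]
  · intro τ hτ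
    simp only [Finset.mem_filter, Finset.mem_univ, true_and] at hτ ⊢
    rw [Equiv.Perm.coe_mul, ← Function.comp_assoc, hτ, ← hτ0]
    funext i; simp
  · intro τ _; simp
  · intro τ _; simp

lemma card_Wr [Fintype G] (w : ℕ) : Fintype.card (Wr G w) = Fintype.card G ^ w * w.factorial := by
  have : Fintype.card (Wr G w) = Fintype.card ((Fin w → G) × Equiv.Perm (Fin w)) :=
    Fintype.card_congr (Equiv.refl _)
  rw [this, Fintype.card_prod, Fintype.card_perm, Fintype.card_fun, Fintype.card_fin]

lemma sum_Wr [Fintype G] (f : (Fin w → G) → Equiv.Perm (Fin w) → ℚ) :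
    ∑ y : Wr G w, f y.1 y.2 = ∑ σ, ∑ x, f x σ := by
  rw [Finset.sum_comm]
  exact Fintype.sum_prod_type (fun y : (Fin w → G) × Equiv.Perm (Fin w) => f y.1 y.2)

theorem zeta_eq [Fintype G] (ws : η → ℕ) (h : ∑ i, ws i = w) (φs : η → G → ℚ) (fs : ∀ i, Equiv.Perm (Fin (ws i)) → ℚ)
    (φ : η → ConjClasses G → ℚ) (Ff : η → Multiset ℕ → ℚ)
    (hφ : ∀ c g, φs c g = φ c (ConjClasses.mk g)) (hF : ∀ c τ, fs c τ = Ff c (cycM τ))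
    (hv : ∀ c ν, (∀ x ∈ ν, 0 < x) → ν.sum ≠ ws c → Ff c ν = 0) (g : Wr G w) :
    zetaTuple ws h φs fs g
      = ∑ b : Fin w → η, if ∀ i, b (g.2 i) = b i then WW φ Ff (dat g b) else 0 := by
  unfold zetaTuple IndFun
  set Z : (Fin w → η) → ℚ := fun b => if ∀ i, b (g.2 i) = b i then WW φ Ff (dat g b) else 0 with hZdef
  have inner : ∀ g' : Wr G w, (∑ k : ∀ i, Wr G (ws i), if embWr ws h k = g' then
      ∏ i, tilprod (φs i) (k i) * fs i (k i).2 else 0)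
      = if ∀ i, b0 ws h (g'.2 i) = b0 ws h i then WW φ Ff (dat g' (b0 ws h)) else 0 := by
    intro g'
    split_ifs with hg'
    · obtain ⟨k, rfl⟩ := emb_surj ws h g' hg'
      rw [Finset.sum_eq_single k]
      · rw [if_pos rfl, WW_emb ws h φs fs φ Ff hφ hF]
      · intro k' _ hk'
        exact if_neg fun hh => hk' (emb_inj ws h hh)
      · simp
    · refine Finset.sum_eq_zero fun k _ => if_neg ?_
      rintro rfl
      exact hg' (emb_b0 ws h k)
  have step : ∀ y : Wr G w, (∑ k : ∀ i, Wr G (ws i), if embWr ws h k = y * g * y⁻¹ then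
      ∏ i, tilprod (φs i) (k i) * fs i (k i).2 else 0) = Z (b0 ws h ∘ y.2) := by
    intro y
    rw [inner]
    have hiff : (∀ i, b0 ws h ((y * g * y⁻¹).2 i) = b0 ws h i)
        ↔ (∀ i, (b0 ws h ∘ y.2) (g.2 i) = (b0 ws h ∘ y.2) i) := by
      rw [conj_snd]
      constructor
      · intro hh i
        have := hh (y.2 i)
        simpa using this
      · intro hh i
        have := hh (y.2⁻¹ i)
        simpa using this
    by_cases hh : ∀ i, b0 ws h ((y * g * y⁻¹).2 i) = b0 ws h i
    · rw [if_pos hh, hZdef]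
      simp only
      rw [if_pos (hiff.mp hh), dat_conj y g _ hh]
    · rw [if_neg hh, hZdef]
      simp only
      rw [if_neg (fun h' => hh (hiff.mpr h'))]
  rw [Finset.sum_congr rfl fun y _ => step y]
  have hsum : ∑ y : Wr G w, Z (b0 ws h ∘ y.2) = (Fintype.card G : ℚ) ^ w * ∑ τ : Equiv.Perm (Fin w), Z (b0 ws h ∘ τ) := by
    rw [sum_Wr (fun _ τ => Z (b0 ws h ∘ τ)), Finset.mul_sum]
    refine Finset.sum_congr rfl fun τ _ => ?_
    rw [Finset.sum_const, nsmul_eq_mul, Finset.card_univ, Fintype.card_fun, Fintype.card_fin]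
    push_cast; rfl
  rw [hsum, sum_b0 ws h Z]
  · have hcard : (Fintype.card (∀ i, Wr G (ws i)) : ℚ) = (Fintype.card G : ℚ) ^ w * ∏ c, ((ws c).factorial : ℚ) := by
      rw [Fintype.card_pi]
      push_cast
      simp only [card_Wr]
      push_cast
      rw [Finset.prod_mul_distrib, Finset.prod_pow_eq_pow_sum, h]
    have hne : (Fintype.card (∀ i, Wr G (ws i)) : ℚ) ≠ 0 := by
      rw [hcard]
      refine mul_ne_zero (pow_ne_zero _ (by exact_mod_cast Fintype.card_ne_zero)) ?_
      exact Finset.prod_ne_zero_iff.mpr fun c _ => by exact_mod_cast Nat.factorial_ne_zero _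
    rw [← mul_assoc ((Fintype.card G : ℚ) ^ w), ← hcard, inv_mul_cancel_left₀ hne]
  · intro b hb c
    rw [hZdef] at hb
    simp only at hb
    have hinv : ∀ i, b (g.2 i) = b i := by
      by_contra hh
      rw [if_neg hh] at hb; exact hb rfl
    rw [if_pos hinv] at hb
    by_contra hne
    apply hb
    unfold WW
    rw [Finset.prod_eq_zero (Finset.mem_univ c), mul_zero]
    apply hv
    · unfold dat
      intro x hx
      simp only [Multiset.mem_map, Multiset.mem_filter] at hx
      obtain ⟨a, ⟨⟨j, hj, rfl⟩, _⟩, rfl⟩ := hx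
      exact clen_pos _ _
    · have := fib_count g.2 b hinv c
      rw [Fintype.card_subtype, ← this] at hne
      unfold dat
      rw [Multiset.filter_map, Multiset.map_map]
      exact hne

end zeta

end CB

namespace CB
open Equiv.Perm

section wsp
variable {G : Type*} [Group G] {w : ℕ} {η η' : Type*} [Fintype η] [Fintype η']

lemma val_phi_fin (B : Matrix η η' ℤ) : ∀ (n : ℕ) (len : Fin n → ℕ) (e : Fin n → η') (F : R η),
    val (phi B F) ((Finset.univ : Finset (Fin n)).val.map fun q => (len q, e q))
      = ∑ c : Fin n → η, (∏ q, (B (c q) (e q) : ℚ)) *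
        val F ((Finset.univ : Finset (Fin n)).val.map fun q => (len q, c q)) := by
  intro n
  induction n with
  | zero =>
    intro len e F
    have : (Finset.univ : Finset (Fin 0)).val = 0 := rfl
    have h2 : MvPolynomial.constantCoeff (phi B F) = MvPolynomial.constantCoeff F := by
      have : (MvPolynomial.constantCoeff (R := ℚ)).comp (phi B).toRingHom
          = MvPolynomial.constantCoeff (R := ℚ) (σ := ℕ × η) := by
        apply MvPolynomial.ringHom_ext
        · intro r; simp
        · intro x; simp [phi_X, MvPolynomial.smul_eq_C_mul]
      exact congrArg (fun f => f F) this
    simp [val_zero, h2]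
  | succ n ih =>
    intro len e F
    have hu : ∀ {η : Type _} (f : Fin (n+1) → ℕ × η), (Finset.univ : Finset (Fin (n+1))).val.map f
        = f 0 ::ₘ (Finset.univ : Finset (Fin n)).val.map (fun j => f j.succ) := by
      intro _ f
      rw [Fin.univ_succ, Finset.cons_val, Multiset.map_cons, Finset.map_val, Multiset.map_map]
      rfl
    rw [hu, val_cons, DD_phi, val_sum, ← Equiv.sum_comp (Fin.consEquiv (fun _ : Fin (n+1) => η)), Fintype.sum_prod_type]
    refine Finset.sum_congr rfl fun c _ => ?_
    rw [val_smul, ih (fun j => len j.succ) (fun j => e j.succ), Finset.mul_sum]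
    refine Finset.sum_congr rfl fun f _ => ?_
    rw [Fin.univ_succ, Finset.cons_val, Multiset.map_cons, Finset.map_val, Multiset.map_map, val_cons,
      Finset.prod_cons, Finset.prod_map, ← mul_assoc]
    rfl

lemma univ_map {Q : Type*} [Fintype Q] {A : Type*} (f : Q → A) : (Finset.univ : Finset Q).val.map f
      = (Finset.univ : Finset (Fin (Fintype.card Q))).val.map (fun j => f ((Fintype.equivFin Q).symm j)) := by
  rw [← Finset.map_univ_equiv (Fintype.equivFin Q).symm, Finset.map_val, Multiset.map_map]
  rfl

lemma val_phi (B : Matrix η η' ℤ) {Q : Type*} [Fintype Q] (len : Q → ℕ) (e : Q → η') (F : R η) :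
    val (phi B F) ((Finset.univ : Finset Q).val.map fun q => (len q, e q))
      = ∑ c : Q → η, (∏ q, (B (c q) (e q) : ℚ)) *
        val F ((Finset.univ : Finset Q).val.map fun q => (len q, c q)) := by
  rw [univ_map, val_phi_fin, ← Equiv.sum_comp ((Fintype.equivFin Q).arrowCongr (Equiv.refl η))]
  refine Finset.sum_congr rfl fun c _ => ?_
  congr 1
  · rw [← Equiv.prod_comp (Fintype.equivFin Q).symm]
    rfl
  · rw [univ_map (fun q => (len q, c q))]
    rfl

lemma sum_inv (σ : Equiv.Perm (Fin w)) (Ψ : (Fin w → η) → ℚ) :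
    (∑ b : Fin w → η, if ∀ i, b (σ i) = b i then Ψ b else 0)
      = ∑ c : Qt σ → η, Ψ (fun i => c (Quotient.mk _ i)) := by
  rw [← Finset.sum_filter]
  symm
  refine Finset.sum_bij' (fun c _ => fun i => c (Quotient.mk _ i))
    (fun b hb => Quotient.lift b (fun i j hij => inv_same (σ := σ) (Finset.mem_filter.mp hb).2 hij)) ?_ ?_ ?_ ?_ ?_
  · intro c _
    simp only [Finset.mem_filter, Finset.mem_univ, true_and]
    intro i
    congr 1
    exact Quotient.sound (show σ.SameCycle _ _ by simp [SameCycle.refl])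
  · intro _ _; simp
  · intro c _
    funext q
    induction q using Quotient.inductionOn with
    | h i => rfl
  · intro b _; rfl
  · intro b _; rfl

/-- length of a cycle -/
def lenQ (σ : Equiv.Perm (Fin w)) : Qt σ → ℕ :=
  Quotient.lift (clen σ) (fun _ _ hij => inv_same (clen_apply σ) hij)

lemma lenQ_cycM (σ : Equiv.Perm (Fin w)) : (Finset.univ : Finset (Qt σ)).val.map (lenQ σ) = cycM σ := by
  rw [← tr_map (tr_bp σ), ← clen_cycM]; rfl

lemma bp_prod (σ : Equiv.Perm (Fin w)) (f : Qt σ → ℚ) :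
    ∏ i ∈ basepoints σ, f (Quotient.mk _ i) = ∏ q, f q :=
  congrArg Multiset.prod (tr_map (tr_bp σ) f)

lemma cycleProd_bp (σ : Equiv.Perm (Fin w)) (i : Fin w) (hi : i ∈ basepoints σ) (x : Fin w → G) :
    cycleProd x σ i = x i * ((List.range (clen σ i - 1)).map (fun k => x ((σ⁻¹ ^ (k+1)) i))).prod := by
  rw [cycleProd_eq]
  obtain ⟨m, hm⟩ : ∃ m, clen σ i = m + 1 := ⟨clen σ i - 1, by have := clen_pos σ i; omega⟩
  rw [hm, List.prod_range_succ']
  rfl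

lemma rest_not_bp (σ : Equiv.Perm (Fin w)) (i : Fin w) (hi : i ∈ basepoints σ) (k : ℕ) (hk : k < clen σ i - 1) :
    (σ⁻¹ ^ (k+1)) i ∉ basepoints σ := by
  intro h
  have h1 : σ.SameCycle i ((σ⁻¹ ^ (k+1)) i) := by
    rw [← sameCycle_inv]
    exact ⟨(k+1 : ℕ), by rw [zpow_natCast]⟩
  have h2 := (tr_bp σ).2 _ hi _ h h1
  have h3 := clen_le σ⁻¹ i (k+1) (by omega) h2.symm
  rw [clen_inv] at h3
  omega

lemma cp_aux (σ : Equiv.Perm (Fin w)) (i : Fin w) (hi : i ∈ basepoints σ) (x y : Fin w → G)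
    (hxy : ∀ j, j ∉ basepoints σ → y j = x j) :
    ((List.range (clen σ i - 1)).map (fun k => y ((σ⁻¹ ^ (k+1)) i))).prod
      = ((List.range (clen σ i - 1)).map (fun k => x ((σ⁻¹ ^ (k+1)) i))).prod := by
  congr 1
  refine List.map_congr_left fun k hk => ?_
  exact hxy _ (rest_not_bp σ i hi k (List.mem_range.mp hk))

/-- the change of variables map -/
def cpTo (σ : Equiv.Perm (Fin w)) (x : Fin w → G) : Fin w → G := fun i => if i ∈ basepoints σ then
    x i * ((List.range (clen σ i - 1)).map (fun k => x ((σ⁻¹ ^ (k+1)) i))).prod else x i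

/-- the inverse change of variables map -/
def cpInv (σ : Equiv.Perm (Fin w)) (x : Fin w → G) : Fin w → G := fun i => if i ∈ basepoints σ then
    x i * ((List.range (clen σ i - 1)).map (fun k => x ((σ⁻¹ ^ (k+1)) i))).prod⁻¹ else x i

lemma cpTo_pos (σ : Equiv.Perm (Fin w)) (x : Fin w → G) (i : Fin w) (hi : i ∈ basepoints σ) :
    cpTo σ x i = x i * ((List.range (clen σ i - 1)).map (fun k => x ((σ⁻¹ ^ (k+1)) i))).prod := if_pos hi

lemma cpInv_pos (σ : Equiv.Perm (Fin w)) (x : Fin w → G) (i : Fin w) (hi : i ∈ basepoints σ) :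
    cpInv σ x i = x i * ((List.range (clen σ i - 1)).map (fun k => x ((σ⁻¹ ^ (k+1)) i))).prod⁻¹ := if_pos hi

/-- change of variables: cycle products at the base points -/
def cpEquiv (σ : Equiv.Perm (Fin w)) : (Fin w → G) ≃ (Fin w → G) where
  toFun := cpTo σ
  invFun := cpInv σ
  left_inv x := by
    funext i
    by_cases hi : i ∈ basepoints σ
    · rw [cpInv_pos σ _ i hi, cp_aux σ i hi x (cpTo σ x) (fun j hj => if_neg hj), cpTo_pos σ _ i hi,
        mul_inv_cancel_right]
    · exact (if_neg hi).trans (if_neg hi)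
  right_inv x := by
    funext i
    by_cases hi : i ∈ basepoints σ
    · rw [cpTo_pos σ _ i hi, cp_aux σ i hi x (cpInv σ x) (fun j hj => if_neg hj), cpInv_pos σ _ i hi,
        inv_mul_cancel_right]
    · exact (if_neg hi).trans (if_neg hi)

lemma unif [Fintype G] (σ : Equiv.Perm (Fin w)) (ψ : Fin w → G → ℚ) :
    ∑ x : Fin w → G, ∏ i ∈ basepoints σ, ψ i (cycleProd x σ i)
      = (Fintype.card G : ℚ) ^ w * ∏ i ∈ basepoints σ, ((Fintype.card G : ℚ)⁻¹ * ∑ g, ψ i g) := by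
  have h1 : ∀ x : Fin w → G, ∏ i ∈ basepoints σ, ψ i (cycleProd x σ i)
      = ∏ i, (if i ∈ basepoints σ then ψ i (cpEquiv σ x i) else 1) := by
    intro x
    rw [← Finset.prod_filter]
    refine Finset.prod_congr (by ext; simp) fun i hi => ?_
    have hi : i ∈ basepoints σ := by simpa using hi
    rw [cycleProd_bp σ i hi]
    simp only [cpEquiv, Equiv.coe_fn_mk, if_pos hi, cpTo_pos σ _ i hi]
  simp only [h1]
  rw [Equiv.sum_comp (cpEquiv σ) (fun x : Fin w → G => ∏ i, (if i ∈ basepoints σ then ψ i (x i) else 1))]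
  have h2 := Finset.prod_univ_sum (fun _ : Fin w => (Finset.univ : Finset G))
    (fun i g => if i ∈ basepoints σ then ψ i g else (1:ℚ))
  rw [Fintype.piFinset_univ] at h2
  rw [← h2]
  have hq : (Fintype.card G : ℚ) ≠ 0 := by exact_mod_cast Fintype.card_ne_zero
  have h3 : (Fintype.card G : ℚ) ^ w = ∏ _i : Fin w, (Fintype.card G : ℚ) := by simp
  rw [h3, ← Finset.prod_filter_mul_prod_filter_not Finset.univ (fun i => i ∈ basepoints σ)
      (fun _ => (Fintype.card G : ℚ)),
    ← Finset.prod_filter_mul_prod_filter_not Finset.univ (fun i => i ∈ basepoints σ)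
      (fun i => ∑ g, if i ∈ basepoints σ then ψ i g else (1:ℚ))]
  have h4 : Finset.univ.filter (fun i => i ∈ basepoints σ) = basepoints σ := by ext; simp
  rw [h4, mul_right_comm, ← Finset.prod_mul_distrib]
  congr 1
  · refine Finset.prod_congr rfl fun i hi => ?_
    simp only [if_pos hi]
    rw [mul_inv_cancel_left₀ hq]
  · refine Finset.prod_congr rfl fun i hi => ?_
    simp only [if_neg (Finset.mem_filter.mp hi).2]
    simp

/-- the multiset of coloured lengths -/
def cl (σ : Equiv.Perm (Fin w)) (b : Fin w → η) : Multiset (ℕ × η) :=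
  (basepoints σ).val.map fun i => (clen σ i, b i)

theorem wr_sp [Fintype G] (φs : η → G → ℚ) (φ : η → ConjClasses G → ℚ)
    (hφ : ∀ c g, φs c g = φ c (ConjClasses.mk g)) (B : Matrix η η' ℤ)
    (hB : ∀ c c', sp (φs c) (φs c') = ∑ e, (B c e : ℚ) * B c' e)
    (ws : η → ℕ) (h : ∑ i, ws i = w) (fs : ∀ i, Equiv.Perm (Fin (ws i)) → ℚ)
    (Ff : η → Multiset ℕ → ℚ) (hF : ∀ c τ, fs c τ = Ff c (cycM τ))
    (hv : ∀ c ν, (∀ x ∈ ν, 0 < x) → ν.sum ≠ ws c → Ff c ν = 0)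
    (F : R η) (hFv : ∀ ν : Multiset (ℕ × η), (∀ x ∈ ν, 0 < x.1) →
      val F ν = ∏ c, Ff c ((ν.filter fun x => x.2 = c).map fun x => x.1))
    (ws' : η → ℕ) (h' : ∑ i, ws' i = w) (fs' : ∀ i, Equiv.Perm (Fin (ws' i)) → ℚ)
    (Ff' : η → Multiset ℕ → ℚ) (hF' : ∀ c τ, fs' c τ = Ff' c (cycM τ))
    (hv' : ∀ c ν, (∀ x ∈ ν, 0 < x) → ν.sum ≠ ws' c → Ff' c ν = 0)
    (F' : R η) (hFv' : ∀ ν : Multiset (ℕ × η), (∀ x ∈ ν, 0 < x.1) →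
      val F' ν = ∏ c, Ff' c ((ν.filter fun x => x.2 = c).map fun x => x.1)) :
    sp (zetaTuple ws h φs fs) (zetaTuple ws' h' φs fs') = ip w (phi B F) (phi B F') := by
  have hclpos : ∀ (σ : Equiv.Perm (Fin w)) (b : Fin w → η), ∀ x ∈ cl σ b, 0 < x.1 := by
    intro σ b x hx
    unfold cl at hx
    rw [Multiset.mem_map] at hx
    obtain ⟨i, _, rfl⟩ := hx
    exact clen_pos _ _
  have hWW : ∀ (g : Wr G w) (b : Fin w → η), WW φ Ff (dat g b)
      = (∏ i ∈ basepoints g.2, φs (b i) (cycleProd g.1 g.2 i)) * val F (cl g.2 b) := by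
    intro g b
    rw [hFv _ (hclpos _ _)]
    unfold WW dat cl
    congr 1
    · rw [Multiset.map_map]
      refine Finset.prod_congr rfl fun i _ => ?_
      rw [hφ]; rfl
    · refine Finset.prod_congr rfl fun c _ => ?_
      rw [Multiset.filter_map, Multiset.filter_map, Multiset.map_map, Multiset.map_map]
      rfl
  have hWW' : ∀ (g : Wr G w) (b : Fin w → η), WW φ Ff' (dat g⁻¹ b)
      = (∏ i ∈ basepoints g.2, φs (b i) (cycleProd g.1 g.2 i)⁻¹) * val F' (cl g.2 b) := by
    intro g b
    rw [hFv' _ (hclpos _ _)]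
    have h2 : (g⁻¹).2 = (g.2)⁻¹ := rfl
    unfold WW dat cl
    rw [h2, bp_inv]
    congr 1
    · rw [Multiset.map_map]
      refine Finset.prod_congr rfl fun i _ => ?_
      rw [hφ, ← cycleProd_inv]; rfl
    · refine Finset.prod_congr rfl fun c _ => ?_
      rw [Multiset.filter_map, Multiset.filter_map, Multiset.map_map, Multiset.map_map]
      simp only [Function.comp_def, clen_inv]
  have hz : ∀ g : Wr G w, zetaTuple ws h φs fs g = ∑ c : Qt g.2 → η,
      (∏ i ∈ basepoints g.2, φs (c (Quotient.mk _ i)) (cycleProd g.1 g.2 i))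
        * val F (cl g.2 (fun i => c (Quotient.mk _ i))) := by
    intro g
    rw [zeta_eq ws h φs fs φ Ff hφ hF hv, sum_inv]
    exact Finset.sum_congr rfl fun c _ => hWW g _
  have hz' : ∀ g : Wr G w, zetaTuple ws' h' φs fs' g⁻¹ = ∑ c : Qt g.2 → η,
      (∏ i ∈ basepoints g.2, φs (c (Quotient.mk _ i)) (cycleProd g.1 g.2 i)⁻¹)
        * val F' (cl g.2 (fun i => c (Quotient.mk _ i))) := by
    intro g
    rw [zeta_eq ws' h' φs fs' φ Ff' hφ hF' hv']
    have hiff : ∀ b : Fin w → η, (∀ i, b ((g⁻¹).2 i) = b i) ↔ ∀ i, b (g.2 i) = b i := by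
      intro b
      have h2 : (g⁻¹).2 = (g.2)⁻¹ := rfl
      rw [h2]
      constructor
      · intro hh i
        have := hh (g.2 i)
        rw [← this]; simp
      · intro hh i
        have := hh (g.2⁻¹ i)
        rw [← this]; simp
    simp only [hiff]
    rw [sum_inv]
    exact Finset.sum_congr rfl fun c _ => hWW' g _
  unfold sp
  rw [ip, ← avg_KK, card_Wr]
  simp only [hz, hz']
  rw [sum_Wr (fun x σ => (∑ c : Qt σ → η,
      (∏ i ∈ basepoints σ, φs (c (Quotient.mk _ i)) (cycleProd x σ i))
        * val F (cl σ (fun i => c (Quotient.mk _ i)))) * ∑ c : Qt σ → η,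
      (∏ i ∈ basepoints σ, φs (c (Quotient.mk _ i)) (cycleProd x σ i)⁻¹)
        * val F' (cl σ (fun i => c (Quotient.mk _ i))))]
  have hq : (Fintype.card G : ℚ) ≠ 0 := by exact_mod_cast Fintype.card_ne_zero
  have main : ∀ σ : Equiv.Perm (Fin w), (∑ x : Fin w → G, (∑ c : Qt σ → η,
      (∏ i ∈ basepoints σ, φs (c (Quotient.mk _ i)) (cycleProd x σ i))
        * val F (cl σ (fun i => c (Quotient.mk _ i)))) * ∑ c : Qt σ → η,
      (∏ i ∈ basepoints σ, φs (c (Quotient.mk _ i)) (cycleProd x σ i)⁻¹)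
        * val F' (cl σ (fun i => c (Quotient.mk _ i))))
      = (Fintype.card G : ℚ) ^ w * KK (cycM σ) (fun ν => val (phi B F) ν * val (phi B F') ν) := by
    intro σ
    have hcl : ∀ c : Qt σ → η, cl σ (fun i => c (Quotient.mk _ i))
        = (Finset.univ : Finset (Qt σ)).val.map fun q => (lenQ σ q, c q) := by
      intro c
      rw [← tr_map (tr_bp σ)]; rfl
    simp only [hcl]
    rw [← lenQ_cycM, ← KK_fun]
    simp only [val_phi, Finset.sum_mul_sum]
    rw [Finset.sum_comm]
    conv_rhs => rw [Finset.sum_comm, Finset.mul_sum]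
    refine Finset.sum_congr (Finset.ext fun _ => by simp) fun c _ => ?_
    rw [Finset.sum_comm]
    conv_rhs => rw [Finset.sum_comm, Finset.mul_sum]
    refine Finset.sum_congr (Finset.ext fun _ => by simp) fun c' _ => ?_
    set v := val F ((Finset.univ : Finset (Qt σ)).val.map fun q => (lenQ σ q, c q))
    set v' := val F' ((Finset.univ : Finset (Qt σ)).val.map fun q => (lenQ σ q, c' q))
    have e1 : ∀ x : Fin w → G, (∏ i ∈ basepoints σ, φs (c (Quotient.mk _ i)) (cycleProd x σ i)) * v
        * ((∏ i ∈ basepoints σ, φs (c' (Quotient.mk _ i)) (cycleProd x σ i)⁻¹) * v')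
        = (∏ i ∈ basepoints σ, (φs (c (Quotient.mk _ i)) (cycleProd x σ i)
          * φs (c' (Quotient.mk _ i)) (cycleProd x σ i)⁻¹)) * (v * v') := by
      intro x
      rw [Finset.prod_mul_distrib]; ring
    have e2 : ∀ e : Qt σ → η', (∏ q, (B (c q) (e q) : ℚ)) * v * ((∏ q, (B (c' q) (e q) : ℚ)) * v')
        = (∏ q, ((B (c q) (e q) : ℚ) * B (c' q) (e q))) * (v * v') := by
      intro e
      rw [Finset.prod_mul_distrib]; ring
    simp only [e1, e2]
    rw [← Finset.sum_mul, ← Finset.sum_mul, ← mul_assoc ((Fintype.card G : ℚ) ^ w)]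
    congr 1
    rw [unif σ (fun i g => φs (c (Quotient.mk _ i)) g * φs (c' (Quotient.mk _ i)) g⁻¹)]
    congr 1
    have e3 : ∀ i : Fin w, (Fintype.card G : ℚ)⁻¹ * ∑ g, φs (c (Quotient.mk _ i)) g * φs (c' (Quotient.mk _ i)) g⁻¹
        = ∑ e, (B (c (Quotient.mk _ i)) e : ℚ) * B (c' (Quotient.mk _ i)) e := fun i => hB _ _
    simp only [e3]
    rw [bp_prod σ (fun q => ∑ e, (B (c q) e : ℚ) * B (c' q) e), Finset.prod_univ_sum, Fintype.piFinset_univ]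
    exact Finset.sum_congr (Finset.ext fun _ => by simp) fun _ _ => rfl
  simp only [main]
  rw [← Finset.mul_sum]
  push_cast
  rw [mul_inv]
  have : ((Fintype.card G : ℚ) ^ w)⁻¹ * (Fintype.card G : ℚ) ^ w = 1 := inv_mul_cancel₀ (pow_ne_zero _ hq)
  linear_combination ((w.factorial : ℚ))⁻¹ * (∑ σ : Equiv.Perm (Fin w), KK (cycM σ) (fun ν => val (phi B F) ν * val (phi B F') ν)) * this

end wsp

end CB

namespace CB

lemma val_TT_zero {I η : Type*} [Fintype I] {col : I → η} {pos : I → ℕ} (ν : Multiset (ℕ × η)) :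
    ∀ (γ : I → ℤ), (∀ x ∈ ν, 0 < x.1) →
      (∑ i, γ i ≠ ((ν.map Prod.fst).sum : ℕ) + ∑ i, (pos i : ℤ)) → val (TT col pos γ) ν = 0 := by
  induction ν using Multiset.induction_on with
  | empty =>
    intro γ _ hs
    rw [val_zero, const_TT, Matrix.det_apply]
    refine Finset.sum_eq_zero fun π _ => ?_
    by_cases h : ∀ i, γ (π i) = pos i
    · exfalso
      apply hs
      rw [← Equiv.sum_comp π γ]
      simp [h]
    · push Not at h
      obtain ⟨i, hi⟩ := h
      rw [Finset.prod_eq_zero (Finset.mem_univ i), smul_zero]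
      simp [hi]
  | cons x ν ih =>
    intro γ hp hs
    obtain ⟨k, c⟩ := x
    have hk : 0 < k := hp (k, c) (Multiset.mem_cons_self _ _)
    rw [val_cons, TT_DD k hk c γ, val_sum]
    refine Finset.sum_eq_zero fun i _ => ?_
    split_ifs with hc
    · refine ih _ (fun x hx => hp x (Multiset.mem_cons_of_mem hx)) ?_
      have := sum_dn γ i k
      unfold dn at this
      rw [this]
      intro h
      apply hs
      rw [Multiset.map_cons, Multiset.sum_cons]
      push_cast at h ⊢
      linarith
    · exact val_z _

lemma JT_TN (N : ℕ) (lam : Multiset ℕ) : JT () N lam = TN N (fun _ : Unit => lam) := by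
  rw [TN_prod]; simp

lemma sFun_TN {n : ℕ} (lam : Nat.Partition n) (N : ℕ) (h : Multiset.card lam.parts ≤ N) :
    sFun lam = ch n (TN N (fun _ : Unit => lam.parts)) := by
  rw [← JT_TN, ch_JT lam N h]

lemma sFun_orth {n : ℕ} (lam mu : Nat.Partition n) :
    sp (sFun lam) (sFun mu) = if lam = mu then 1 else 0 := by
  rw [sFun_TN lam n (card_parts_le _), sFun_TN mu n (card_parts_le _), sp_ch]
  unfold TN
  rw [orth (sgood n) n _ _ (by rw [sum_gam _ _ (fun _ => card_parts_le _)]; simp [lam.parts_sum])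
    (by rw [sum_gam _ _ (fun _ => card_parts_le _)]; simp [mu.parts_sum]), dl_gam]
  by_cases h : lam = mu
  · subst h; simp
  · rw [if_neg, if_neg h]
    intro h'
    apply h
    apply Nat.Partition.ext
    exact congrFun (gam_inj n _ _ (fun _ _ => lam.parts_pos) (fun _ _ => mu.parts_pos)
      (fun _ => card_parts_le _) (fun _ => card_parts_le _) h') ()

lemma sval_size (lam nu : Multiset ℕ) (hp : ∀ x ∈ nu, 0 < x) (h : nu.sum ≠ lam.sum) : sval lam nu = 0 := by
  rw [sval_val _ _ hp, JT_TN]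
  unfold TN
  refine val_TT_zero _ _ ?_ ?_
  · intro x hx
    unfold uu at hx
    rw [Multiset.mem_map] at hx
    obtain ⟨k, hk, rfl⟩ := hx
    exact hp k hk
  · rw [sum_gam _ _ (fun _ => le_refl _)]
    intro h'
    have h1 := add_right_cancel h'
    apply h
    simp only [uu, Multiset.map_map, Function.comp_def, Multiset.map_id'] at h1
    norm_cast at h1
    simpa using h1.symm

lemma val_Tm {η : Type*} [Fintype η] {w : ℕ} (lam : PMapw η w) (ν : Multiset (ℕ × η))
    (hp : ∀ x ∈ ν, 0 < x.1) :
    val (Tm lam) ν = ∏ c, sval (pm lam c) ((ν.filter fun x => x.2 = c).map fun x => x.1) := by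
  rw [Tm_prod, val_prod]
  refine Finset.prod_congr rfl fun c _ => ?_
  rw [sval_val]
  · congr 1
    unfold colp uu
    rw [Multiset.map_map]; rfl
  · intro x hx
    rw [Multiset.mem_map] at hx
    obtain ⟨y, hy, rfl⟩ := hx
    exact hp y (Multiset.mem_filter.mp hy).1

lemma cycM_conj {n : ℕ} {σ τ : Equiv.Perm (Fin n)} (h : IsConj σ τ) : cycM σ = cycM τ := by
  rw [cycM_part, cycM_part, Equiv.Perm.partition_eq_of_isConj.mp h]

lemma hook_inj {l i j : ℕ} (hi : i < l) (hj : j < l) :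
    hookPartition l i hi = hookPartition l j hj ↔ i = j := by
  constructor
  · intro h
    have := congrArg (fun p => Multiset.card p.parts) h
    simpa [hookPartition] using this
  · rintro rfl; rfl

lemma sp_add_left {G : Type*} [Group G] [Fintype G] (f f' h : G → ℚ) :
    sp (f + f') h = sp f h + sp f' h := by
  unfold sp; simp [add_mul, Finset.sum_add_distrib, mul_add]

lemma sp_add_right {G : Type*} [Group G] [Fintype G] (f h h' : G → ℚ) :
    sp f (h + h') = sp f h + sp f h' := by
  unfold sp; simp [Finset.sum_add_distrib, mul_add]

/-- the matrix of the projective characters in cyclic defect -/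
def AA (l : ℕ) : Matrix (Fin (l - 1)) (Fin l) ℤ :=
  Matrix.of fun i c => (-1) ^ (c : ℕ) * ((if (c : ℕ) = i then 1 else 0) + if (c : ℕ) = i + 1 then 1 else 0)

lemma sum_ind (l a b : ℕ) (ha : a < l) :
    ∑ c : Fin l, (if (c : ℕ) = a then (1:ℚ) else 0) * (if (c : ℕ) = b then 1 else 0) = if a = b then 1 else 0 := by
  rw [Finset.sum_eq_single (⟨a, ha⟩ : Fin l)]
  · simp
  · intro c _ hc
    rw [if_neg, zero_mul]
    intro h; exact hc (Fin.ext h)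
  · simp

lemma beta_gram (l : ℕ) (i j : Fin (l - 1)) :
    sp (betaChar l i) (betaChar l j) = ∑ c, (AA l i c : ℚ) * AA l j c := by
  have hi := i.isLt
  have hj := j.isLt
  unfold betaChar
  simp only [sp_add_left, sp_add_right, sFun_orth, hook_inj]
  have : ∀ c : Fin l, (AA l i c : ℚ) * AA l j c
      = ((if (c : ℕ) = i then (1:ℚ) else 0) * (if (c : ℕ) = j then 1 else 0)
        + (if (c : ℕ) = i then (1:ℚ) else 0) * (if (c : ℕ) = j + 1 then 1 else 0))
      + ((if (c : ℕ) = i + 1 then (1:ℚ) else 0) * (if (c : ℕ) = j then 1 else 0)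
        + (if (c : ℕ) = i + 1 then (1:ℚ) else 0) * (if (c : ℕ) = j + 1 then 1 else 0)) := by
    intro c
    unfold AA
    simp only [Matrix.of_apply]
    have hs : ((-1 : ℚ) ^ (c : ℕ)) * (-1) ^ (c : ℕ) = 1 := by
      rw [← mul_pow]; norm_num
    push_cast
    linear_combination (((if (c : ℕ) = i then (1:ℚ) else 0) + if (c : ℕ) = i + 1 then 1 else 0)
      * ((if (c : ℕ) = j then (1:ℚ) else 0) + if (c : ℕ) = j + 1 then 1 else 0)) * hs
  simp only [this, Finset.sum_add_distrib]
  rw [sum_ind l i j (by omega), sum_ind l i (j+1) (by omega), sum_ind l (i+1) j (by omega),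
    sum_ind l (i+1) (j+1) (by omega)]
  ring

theorem zeta_gram (l w : ℕ) (lam mu : PMapw (Fin (l - 1)) w) :
    sp (zetaTuple (fun i => ((lam.1 i).1 : ℕ)) lam.2 (betaChar l) (fun i => sFun (lam.1 i).2))
       (zetaTuple (fun i => ((mu.1 i).1 : ℕ)) mu.2 (betaChar l) (fun i => sFun (mu.1 i).2))
      = ip w (phi (AA l) (Tm lam)) (phi (AA l) (Tm mu)) := by
  refine wr_sp (betaChar l) (fun c q => betaChar l c (Quotient.out q)) ?_ (AA l) (beta_gram l)
    _ _ _ (fun c => sval (pm lam c)) ?_ ?_ (Tm lam) ?_ _ _ _ (fun c => sval (pm mu c)) ?_ ?_ (Tm mu) ?_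
  · intro c g
    have h : IsConj g (Quotient.out (ConjClasses.mk g)) :=
      ConjClasses.mk_eq_mk_iff_isConj.mp (Quotient.out_eq (ConjClasses.mk g)).symm
    have h2 := cycM_conj h
    unfold betaChar sFun
    simp only [Pi.add_apply]
    rw [h2]
  · intro c τ; rfl
  · intro c ν hp hs
    refine sval_size _ _ hp ?_
    rw [show (pm lam c).sum = _ from (lam.1 c).2.parts_sum]; exact hs
  · intro ν hp; exact val_Tm lam ν hp
  · intro c τ; rfl
  · intro c ν hp hs
    refine sval_size _ _ hp ?_
    rw [show (pm mu c).sum = _ from (mu.1 c).2.parts_sum]; exact hs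
  · intro ν hp; exact val_Tm mu ν hp

end CB

namespace CB

section lat
variable {η : Type*} [Fintype η] {w : ℕ}

lemma zsmul_R {η : Type*} (a : ℤ) (F : R η) : a • F = (a : ℚ) • F := (Int.cast_smul_eq_zsmul ℚ a F).symm

lemma Lat_exists {F : R η} (hF : F ∈ Lat η w) : ∃ a : PMapw η w → ℤ, F = ∑ lam, a lam • Tm lam := by
  obtain ⟨a, ha⟩ := (Submodule.mem_span_range_iff_exists_fun ℤ).mp (Tm_span hF)
  exact ⟨a, ha.symm⟩

lemma ip_Tm_sum (a : PMapw η w → ℤ) (mu : PMapw η w) :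
    ip w (∑ lam, a lam • Tm lam) (Tm mu) = a mu := by
  rw [ip_sum_left]
  simp only [zsmul_R, ip_smul_left, Tm_orth]
  simp

lemma Tm_indep (a : PMapw η w → ℤ) (h : ∑ lam, a lam • Tm lam = 0) (mu : PMapw η w) : a mu = 0 := by
  have := ip_Tm_sum a mu
  rw [h, ip_zero_left] at this
  exact_mod_cast this.symm

lemma Lat_zero {F : R η} (hF : F ∈ Lat η w) (h : ip w F F = 0) : F = 0 := by
  obtain ⟨a, rfl⟩ := Lat_exists hF
  rw [ip_sum_right] at h
  simp only [zsmul_R (η := η), ip_smul_right] at h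
  simp only [← zsmul_R, ip_Tm_sum] at h
  have h2 := (Finset.sum_eq_zero_iff_of_nonneg (fun i _ => mul_self_nonneg _)).mp h
  refine Finset.sum_eq_zero fun i hi => ?_
  have : (a i : ℚ) = 0 := mul_self_eq_zero.mp (h2 i hi)
  rw [show a i = 0 by exact_mod_cast this, zero_smul]

lemma Lat_val_zero {F : R η} (hF : F ∈ Lat η w)
    (h : ∀ ν, (∀ x ∈ ν, 0 < x.1) → val F ν = 0) : F = 0 :=
  Lat_zero hF (ip_eq_zero_of_val w F F (fun ν hp _ => h ν hp))

end lat

section ker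
variable (k : ℕ)

lemma phi_id {η : Type*} [Fintype η] [DecidableEq η] (F : R η) : phi (1 : Matrix η η ℤ) F = F := by
  convert phi_one F

/-- the matrix `AA` with simplified index type -/
def AAk : Matrix (Fin k) (Fin (k+1)) ℤ := AA (k+1)

/-- invertible completion of the matrix `AA` -/
def At : Matrix (Fin (k+1)) (Fin (k+1)) ℤ := Matrix.of fun i c =>
  if h : (i : ℕ) < k then AAk k ⟨i, h⟩ c else if c = i then 1 else 0

/-- inclusion matrix -/
def Jm : Matrix (Fin k) (Fin (k+1)) ℤ := Matrix.of fun i c => if c = i.castSucc then 1 else 0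

/-- projection matrix -/
def Pm : Matrix (Fin (k+1)) (Fin k) ℤ := Matrix.of fun c i => if c = i.castSucc then 1 else 0

lemma JP : Jm k * Pm k = 1 := by
  ext i j
  rw [Matrix.mul_apply, Finset.sum_eq_single i.castSucc]
  · simp [Jm, Pm, Matrix.one_apply]
  · intro c _ hc; simp [Jm, hc]
  · simp

lemma PJ (c d : Fin (k+1)) : (Pm k * Jm k) c d = if c = d ∧ c ≠ Fin.last k then 1 else 0 := by
  rw [Matrix.mul_apply]
  refine Fin.lastCases ?_ (fun i => ?_) c
  · rw [if_neg (by tauto)]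
    refine Finset.sum_eq_zero fun x _ => ?_
    have : Fin.last k ≠ x.castSucc := (Fin.castSucc_lt_last x).ne'
    simp [Pm, this]
  · rw [Finset.sum_eq_single i]
    · have := (Fin.castSucc_lt_last i).ne
      simp [Pm, Jm, this, eq_comm]
    · intro j _ hj
      have : i.castSucc ≠ j.castSucc := fun h => hj (Fin.castSucc_injective _ h).symm
      simp [Pm, this]
    · simp

lemma JA : Jm k * At k = AAk k := by
  ext i c
  rw [Matrix.mul_apply, Finset.sum_eq_single i.castSucc]
  · simp [Jm, At]
  · intro j _ hj; simp [Jm, hj]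
  · simp

lemma det_At : IsUnit (At k).det := by
  rw [Matrix.det_of_upperTriangular]
  · rw [IsUnit.prod_univ_iff]
    intro i
    unfold At AAk AA
    by_cases h : (i : ℕ) < k
    · simp only [Matrix.of_apply, dif_pos h]
      simp only [if_true, Nat.left_eq_add, one_ne_zero, if_false, add_zero, mul_one]
      exact IsUnit.pow _ (by simp)
    · simp only [Matrix.of_apply, dif_neg h]
      simp
  · intro i j hij
    simp only [id] at hij
    have hij' : (j : ℕ) < i := hij
    unfold At AAk AA
    by_cases h : (i : ℕ) < k
    · simp only [Matrix.of_apply, dif_pos h]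
      rw [if_neg (by omega), if_neg (by omega)]; simp
    · simp only [Matrix.of_apply, dif_neg h]
      rw [if_neg (by intro h; rw [h] at hij'; omega)]

lemma row_At (i : Fin (k+1)) : ∑ c, At k i c = if i = Fin.last k then 1 else 0 := by
  have hi := i.isLt
  by_cases h : (i : ℕ) < k
  · rw [if_neg (by intro h'; rw [h'] at h; simp at h)]
    simp only [At, AAk, AA, Matrix.of_apply, dif_pos h, mul_add, Finset.sum_add_distrib]
    rw [Finset.sum_eq_single i, Finset.sum_eq_single (⟨i+1, by omega⟩ : Fin (k+1))]
    · simp [pow_succ]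
    · intro c _ hc
      rw [if_neg (by intro h'; exact hc (Fin.ext h')), mul_zero]
    · simp
    · intro c _ hc
      rw [if_neg (by intro h'; exact hc (Fin.ext h')), mul_zero]
    · simp
  · rw [if_pos (by apply Fin.ext; simp; omega)]
    simp only [At, Matrix.of_apply, dif_neg h]
    simp

lemma row_AA (i : Fin k) : ∑ c, AAk k i c = 0 := by
  have := row_At k i.castSucc
  rw [if_neg (Fin.castSucc_lt_last i).ne] at this
  rw [← this]
  refine Finset.sum_congr rfl fun c _ => ?_
  simp [At]

lemma sum_DD_phi {η η' : Type*} [Fintype η] [Fintype η'] (B : Matrix η η' ℤ) (m : ℕ) (F : R η) :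
    ∑ d, DD (m, d) (phi B F) = ∑ c, ((∑ d, B c d : ℤ) : ℚ) • phi B (DD (m, c) F) := by
  simp only [DD_phi]
  rw [Finset.sum_comm]
  refine Finset.sum_congr rfl fun c _ => ?_
  rw [← Finset.sum_smul]
  push_cast; rfl

lemma ker_easy (F : R (Fin k)) (m : ℕ) : ∑ r, DD (m, r) (phi (AAk k) F) = 0 := by
  have := sum_DD_phi (AAk k) m F
  rw [this]
  refine Finset.sum_eq_zero fun c _ => ?_
  rw [row_AA]; simp

lemma const_phi {η η' : Type*} [Fintype η] [Fintype η'] (B : Matrix η η' ℤ) (F : R η) :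
    MvPolynomial.constantCoeff (phi B F) = MvPolynomial.constantCoeff F := by
  have : (MvPolynomial.constantCoeff (R := ℚ)).comp (phi B).toRingHom
      = MvPolynomial.constantCoeff (R := ℚ) (σ := ℕ × η) := by
    apply MvPolynomial.ringHom_ext
    · intro r; simp
    · intro i
      simp [phi_X]
  exact congrFun (congrArg DFunLike.coe this) F

lemma val_PJ (ν : Multiset (ℕ × Fin (k+1))) : ∀ G : R (Fin (k+1)), (∀ x ∈ ν, 0 < x.1) →
    (∀ m, 0 < m → DD (m, Fin.last k) G = 0) → val (phi (Pm k * Jm k) G) ν = val G ν := by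
  induction ν using Multiset.induction_on with
  | empty => intro G _ _; rw [val_zero, val_zero, const_phi]
  | cons x ν ih =>
    intro G hp hG
    obtain ⟨m, d⟩ := x
    have hm : 0 < m := hp (m, d) (Multiset.mem_cons_self _ _)
    rw [val_cons, val_cons, DD_phi]
    simp only [PJ]
    by_cases hd : d = Fin.last k
    · subst hd
      rw [hG m hm, val_z, Finset.sum_eq_zero, val_z]
      intro c _
      rw [if_neg (by tauto)]; simp
    · rw [Finset.sum_eq_single d, if_pos ⟨rfl, hd⟩]
      · simp only [Int.cast_one, one_smul]
        refine ih _ (fun x hx => hp x (Multiset.mem_cons_of_mem hx)) ?_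
        intro m' hm'
        rw [DD_comm, hG m' hm', map_zero]
      · intro c _ hc
        rw [if_neg (by tauto)]; simp
      · simp

lemma ker_hard {w : ℕ} (F : R (Fin (k+1))) (hF : F ∈ Lat (Fin (k+1)) w)
    (h : ∀ m, 0 < m → ∑ r, DD (m, r) F = 0) :
    ∃ F' ∈ Lat (Fin k) w, F = phi (AAk k) F' := by
  have hu := det_At k
  have h1 : (At k)⁻¹ * At k = 1 := Matrix.nonsing_inv_mul _ hu
  have h2 : At k * (At k)⁻¹ = 1 := Matrix.mul_nonsing_inv _ hu
  set G := phi (At k)⁻¹ F with hGdef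
  have hFG : phi (At k) G = F := by rw [hGdef, phi_comp, h1, phi_id]
  have hGL : G ∈ Lat (Fin (k+1)) w := phi_Lat _ hF
  have hG : ∀ m, 0 < m → DD (m, Fin.last k) G = 0 := by
    intro m hm
    have h3 := h m hm
    rw [← hFG, sum_DD_phi, Finset.sum_eq_single (Fin.last k)] at h3
    · rw [row_At] at h3
      simp only [if_true, Int.cast_one, one_smul] at h3
      have h4 := congrArg (phi (At k)⁻¹) h3
      rwa [phi_comp, h2, phi_id, map_zero] at h4
    · intro c _ hc
      rw [row_At, if_neg hc]; simp
    · simp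
  have h5 : phi (Pm k * Jm k) G = G := by
    rw [← sub_eq_zero]
    refine Lat_val_zero (w := w) (Submodule.sub_mem _ (phi_Lat _ hGL) hGL) ?_
    intro ν hp
    rw [sub_eq_add_neg, ← neg_one_smul ℚ G, val_add, val_smul, val_PJ k ν G hp hG]
    ring
  refine ⟨phi (Pm k) G, phi_Lat _ hGL, ?_⟩
  rw [← JA, ← phi_comp (Jm k) (At k), phi_comp (Pm k) (Jm k), h5, hFG]

lemma phi_AA_inj (F : R (Fin k)) (h : phi (AAk k) F = 0) : F = 0 := by
  have h2 : At k * (At k)⁻¹ = 1 := Matrix.mul_nonsing_inv _ (det_At k)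
  have h3 : AAk k * ((At k)⁻¹ * Pm k) = 1 := by
    rw [← JA, Matrix.mul_assoc, ← Matrix.mul_assoc (At k), h2, Matrix.one_mul, JP]
  have h4 := congrArg (phi ((At k)⁻¹ * Pm k)) h
  rw [phi_comp] at h4
  rw [h3] at h4
  rwa [phi_id, map_zero] at h4

end ker

end CB

namespace CB

lemma exists_cycM {n : ℕ} (ν : Multiset ℕ) (h : ∀ x ∈ ν, 0 < x) (hs : ν.sum = n) :
    ∃ σ : Equiv.Perm (Fin n), cycM σ = ν := by
  have h1 := card_cycM ν h hs
  by_contra hne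
  push Not at hne
  rw [Finset.filter_false_of_mem (fun σ _ => hne σ)] at h1
  simp only [Finset.card_empty, Nat.cast_zero, zero_mul] at h1
  have : (n.factorial : ℚ) ≠ 0 := by exact_mod_cast n.factorial_ne_zero
  exact this h1.symm

/-- `ch` as a linear map -/
def chL (n : ℕ) : R Unit →ₗ[ℤ] (Equiv.Perm (Fin n) → ℚ) where
  toFun F := ch n F
  map_add' F G := by funext σ; exact val_add _ _ _
  map_smul' a F := by
    funext σ
    simp only [ch, zsmul_R, val_smul]
    simp [ch]

lemma ch_zero_of_sp {n : ℕ} (F : R Unit) (h : sp (ch n F) (ch n F) = 0) : ch n F = 0 := by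
  unfold sp at h
  have h0 : (Fintype.card (Equiv.Perm (Fin n)) : ℚ)⁻¹ ≠ 0 :=
    inv_ne_zero (by exact_mod_cast Fintype.card_ne_zero)
  have h1 := (mul_eq_zero.mp h).resolve_left h0
  have h2 : ∀ g, ch n F g⁻¹ = ch n F g := fun g => by unfold ch; rw [cycM_inv]
  simp only [h2] at h1
  have h3 := (Finset.sum_eq_zero_iff_of_nonneg (fun i _ => mul_self_nonneg _)).mp h1
  funext g
  exact mul_self_eq_zero.mp (h3 g (Finset.mem_univ g))

section corr
variable {I : Type*} [Fintype I] {l : ℕ} (col : I → Fin l) (pos pos' : I → ℕ)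

/-- beta numbers from runner positions -/
def bt (γ : I → ℤ) (i : I) : ℤ := l * γ i + (col i : ℕ)

/-- the Schur function of the bead configuration -/
def SS (γ : I → ℤ) : R Unit := TT (fun _ : I => ()) pos' (bt col γ)

/-- bead configurations of weight `w` -/
abbrev Ix (w : ℕ) := {γ : I → ℤ // ∑ i, γ i = w + ∑ i, (pos i : ℤ)}

/-- linear extension of `SS` -/
def tS (w : ℕ) : (Ix pos w →₀ ℤ) →ₗ[ℤ] R Unit := Finsupp.linearCombination ℤ (fun γ => SS col pos' γ.1)

/-- linear extension of `TT` -/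
def tT (w : ℕ) : (Ix pos w →₀ ℤ) →ₗ[ℤ] R (Fin l) := Finsupp.linearCombination ℤ (fun γ => TT col pos γ.1)

lemma bt_nonneg (γ : I → ℤ) (i : I) : 0 ≤ bt col γ i ↔ 0 ≤ γ i := by
  unfold bt
  have := (col i).isLt
  constructor
  · intro h
    by_contra hn
    have h1 : γ i ≤ -1 := by omega
    have h2 : (l : ℤ) * γ i ≤ l * (-1) := mul_le_mul_of_nonneg_left h1 (by omega)
    omega
  · intro h
    positivity

lemma bt_eq (γ γ' : I → ℤ) (i j : I) : bt col γ i = bt col γ' j ↔ col i = col j ∧ γ i = γ' j := by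
  unfold bt
  have h1 := (col i).isLt
  have h2 := (col j).isLt
  constructor
  · intro h
    have hl : (0 : ℤ) < l := by omega
    have e1 : ((l : ℤ) * γ i + (col i : ℕ)) % l = (col i : ℕ) := by
      rw [Int.mul_add_emod_self_left, Int.emod_eq_of_lt (by omega) (by omega)]
    have e2 : ((l : ℤ) * γ' j + (col j : ℕ)) % l = (col j : ℕ) := by
      rw [Int.mul_add_emod_self_left, Int.emod_eq_of_lt (by omega) (by omega)]
    rw [h, e2] at e1
    have e3 : col i = col j := Fin.ext (by omega)
    refine ⟨e3, ?_⟩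
    rw [e3] at h
    exact mul_left_cancel₀ hl.ne' (add_right_cancel h)
  · rintro ⟨h, h'⟩
    rw [h, h']

lemma dl_bt (γ γ' : I → ℤ) : dl (fun _ : I => ()) (bt col γ) (bt col γ') = dl col γ γ' := by
  unfold dl dl'
  simp only [bt_nonneg, bt_eq]
  congr 1
  refine Finset.sum_congr rfl fun π _ => ?_
  congr 1
  rw [eq_iff_iff]
  constructor
  · rintro ⟨_, h⟩
    exact ⟨fun i => (h i).1.symm, fun i => (h i).2⟩
  · rintro ⟨h, h'⟩
    refine ⟨by simp, fun i => ⟨(h i).symm, h' i⟩⟩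

lemma sum_bt (γ : I → ℤ) : ∑ i, bt col γ i = l * ∑ i, γ i + ((∑ i, (col i : ℕ) : ℕ) : ℤ) := by
  unfold bt
  rw [Finset.sum_add_distrib, Finset.mul_sum]; push_cast; rfl

lemma bt_dn (γ : I → ℤ) (i : I) (m : ℕ) :
    bt col (dn γ i m) = fun a => if a = i then bt col γ a - (l * m : ℕ) else bt col γ a := by
  funext a
  unfold bt dn
  split_ifs
  · push_cast; ring
  · rfl

lemma DD_SS (hl : 0 < l) (m : ℕ) (hm : 0 < m) (γ : I → ℤ) :
    DD (l * m, ()) (SS col pos' γ) = ∑ i, SS col pos' (dn γ i m) := by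
  unfold SS
  rw [TT_DD (l * m) (Nat.mul_pos hl hm)]
  refine Finset.sum_congr rfl fun i _ => ?_
  rw [if_pos rfl, bt_dn]

lemma DD_TTs (m : ℕ) (hm : 0 < m) (γ : I → ℤ) :
    ∑ r, DD (m, r) (TT col pos γ) = ∑ i, TT col pos (dn γ i m) := by
  simp only [TT_DD m hm]
  rw [Finset.sum_comm]
  refine Finset.sum_congr rfl fun i _ => ?_
  rw [Finset.sum_eq_single (col i), if_pos rfl]
  · rfl
  · intro r _ hr; rw [if_neg (fun h => hr h.symm)]
  · simp

variable {col pos pos'}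

lemma low_SS (hg : Good col pos) (γ : I → ℤ) (hs : ∑ i, γ i < ∑ i, (pos i : ℤ)) : SS col pos' γ = 0 := by
  by_cases h0 : ∀ i, 0 ≤ γ i
  · obtain ⟨i, j, hij, hc, h⟩ := low_noninj hg γ h0 hs
    exact TT_eq_zero _ i j hij rfl ((bt_eq col γ γ i j).mpr ⟨hc, h⟩)
  · push Not at h0
    obtain ⟨i, hi⟩ := h0
    refine TT_neg _ i ?_
    by_contra hn
    rw [not_lt, bt_nonneg] at hn
    omega

lemma low_TT (hg : Good col pos) (γ : I → ℤ) (hs : ∑ i, γ i < ∑ i, (pos i : ℤ)) : TT col pos γ = 0 := by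
  by_cases h0 : ∀ i, 0 ≤ γ i
  · obtain ⟨i, j, hij, hc, h⟩ := low_noninj hg γ h0 hs
    exact TT_eq_zero _ i j hij hc h
  · push Not at h0
    obtain ⟨i, hi⟩ := h0
    exact TT_neg _ i hi

/-- the shift operator on configurations -/
def dX (pos : I → ℕ) {w w' : ℕ} (m : ℕ) (h : w' + m = w) : (Ix pos w →₀ ℤ) →ₗ[ℤ] (Ix pos w' →₀ ℤ) :=
  Finsupp.linearCombination ℤ (fun γ => ∑ i, Finsupp.single ⟨dn γ.1 i m, by
    rw [sum_dn, γ.2, ← h]; push_cast; ring⟩ 1)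

lemma tS_dX (hl : 0 < l) {w w' : ℕ} (m : ℕ) (hm : 0 < m) (h : w' + m = w) (c : Ix pos w →₀ ℤ) :
    tS col pos pos' w' (dX pos m h c) = DD (l * m, ()) (tS col pos pos' w c) := by
  induction c using Finsupp.induction_linear with
  | zero => simp
  | add f g hf hg => simp only [map_add, hf, hg]
  | single γ a =>
    unfold dX tS
    simp only [Finsupp.linearCombination_single, map_smul, map_sum]
    rw [map_zsmul, DD_SS col pos' hl m hm]
    simp

lemma tT_dX {w w' : ℕ} (m : ℕ) (hm : 0 < m) (h : w' + m = w) (c : Ix pos w →₀ ℤ) :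
    tT col pos w' (dX pos m h c) = ∑ r, DD (m, r) (tT col pos w c) := by
  induction c using Finsupp.induction_linear with
  | zero => simp
  | add f g hf hg => simp only [map_add, hf, hg, Finset.sum_add_distrib]
  | single γ a =>
    unfold dX tT
    simp only [Finsupp.linearCombination_single, map_smul, map_sum]
    simp only [map_zsmul]
    rw [← Finset.smul_sum (r := a) (f := fun r => DD (m, r) (TT col pos γ.1)), DD_TTs col pos m hm]
    simp

lemma tS_low (hg : Good col pos) (hl : 0 < l) {w : ℕ} (m : ℕ) (h : w < m) (c : Ix pos w →₀ ℤ) :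
    DD (l * m, ()) (tS col pos pos' w c) = 0 := by
  induction c using Finsupp.induction_linear with
  | zero => simp
  | add f g hf hg => simp only [map_add, hf, hg, add_zero]
  | single γ a =>
    unfold tS
    simp only [Finsupp.linearCombination_single]
    rw [map_zsmul, DD_SS col pos' hl m (by omega), Finset.sum_eq_zero, smul_zero]
    intro i _
    refine low_SS hg _ ?_
    rw [sum_dn, γ.2]; omega

lemma tT_low (hg : Good col pos) {w : ℕ} (m : ℕ) (h : w < m) (c : Ix pos w →₀ ℤ) :
    ∑ r, DD (m, r) (tT col pos w c) = 0 := by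
  induction c using Finsupp.induction_linear with
  | zero => simp
  | add f g hf hg => simp only [map_add, hf, hg, add_zero, Finset.sum_add_distrib]
  | single γ a =>
    unfold tT
    simp only [Finsupp.linearCombination_single, map_zsmul]
    rw [← Finset.smul_sum, DD_TTs col pos m (by omega), Finset.sum_eq_zero, smul_zero]
    intro i _
    refine low_TT hg _ ?_
    rw [sum_dn, γ.2]; omega

lemma tT_Lat (w : ℕ) (c : Ix pos w →₀ ℤ) : tT col pos w c ∈ Lat (Fin l) w := by
  unfold tT
  rw [Finsupp.linearCombination_apply]
  unfold Finsupp.sum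
  exact Submodule.sum_mem _ fun γ _ => Submodule.smul_mem _ _ (TT_Lat _ _ γ.2)

lemma tT_surj (hg : Good col pos) (w : ℕ) (hcap : ∀ c, w ≤ (Finset.univ.filter fun i => col i = c).card)
    {F : R (Fin l)} (hF : F ∈ Lat (Fin l) w) : ∃ c, tT col pos w c = F := by
  have h1 := Lat_le_span hg.inj w (fun c => (hcap c).trans (le_of_eq (by congr!))) hF
  have h2 : {F | ∃ γ : I → ℤ, (∑ i, γ i = w + ∑ i, (pos i : ℤ)) ∧ F = TT col pos γ}
      = Set.range (fun γ : Ix pos w => TT col pos γ.1) := by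
    ext F
    constructor
    · rintro ⟨γ, h, rfl⟩; exact ⟨⟨γ, h⟩, rfl⟩
    · rintro ⟨γ, rfl⟩; exact ⟨γ.1, γ.2, rfl⟩
  rw [h2, ← Finsupp.range_linearCombination] at h1
  exact h1

lemma gram_eq (hg : Good col pos) (hg' : Good (fun _ : I => ()) pos') (e : ℕ)
    (he : l * ∑ i, pos i + ∑ i, (col i : ℕ) = e + ∑ i, pos' i)
    (w : ℕ) (c c' : Ix pos w →₀ ℤ) :
    ip (l * w + e) (tS col pos pos' w c) (tS col pos pos' w c') = ip w (tT col pos w c) (tT col pos w c') := by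
  have hsum : ∀ γ : Ix pos w, ∑ i, bt col γ.1 i = ((l * w + e : ℕ) : ℤ) + ∑ i, (pos' i : ℤ) := by
    intro γ
    rw [sum_bt, γ.2]
    have : ((l * ∑ i, pos i + ∑ i, (col i : ℕ) : ℕ) : ℤ) = ((e + ∑ i, pos' i : ℕ) : ℤ) := by rw [he]
    push_cast at this ⊢
    linarith
  unfold tS tT
  simp only [Finsupp.linearCombination_apply, Finsupp.sum, ip_sum_left, ip_sum_right, zsmul_R,
    ip_smul_left, ip_smul_right]
  refine Finset.sum_congr rfl fun γ' _ => congrArg _ (Finset.sum_congr rfl fun γ _ => ?_)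
  congr 1
  unfold SS
  rw [orth hg' _ _ _ (hsum γ) (hsum γ'), orth hg _ _ _ γ.2 γ'.2, dl_bt]

lemma zero_iff (hg : Good col pos) (hg' : Good (fun _ : I => ()) pos') (e : ℕ)
    (he : l * ∑ i, pos i + ∑ i, (col i : ℕ) = e + ∑ i, pos' i)
    (w : ℕ) (c : Ix pos w →₀ ℤ) :
    ch (l * w + e) (tS col pos pos' w c) = 0 ↔ tT col pos w c = 0 := by
  have h := gram_eq hg hg' e he w c c
  constructor
  · intro h0
    refine Lat_zero (tT_Lat w c) ?_
    rw [← h, ← sp_ch, h0]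
    simp [sp]
  · intro h0
    rw [h0, ip_zero_left] at h
    exact ch_zero_of_sp _ ((sp_ch _ _ _).trans h)

lemma vanish_iff (hg : Good col pos) (hg' : Good (fun _ : I => ()) pos') (e : ℕ)
    (he : l * ∑ i, pos i + ∑ i, (col i : ℕ) = e + ∑ i, pos' i)
    (hl : 0 < l) (w : ℕ) (c : Ix pos w →₀ ℤ) :
    ch (l * w + e) (tS col pos pos' w c) ∈ VanishSub l (l * w + e)
      ↔ ∀ m, 0 < m → ∑ r, DD (m, r) (tT col pos w c) = 0 := by
  constructor
  · intro hv m hm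
    by_cases hmw : w < m
    · exact tT_low hg m hmw c
    obtain ⟨w', rfl⟩ : ∃ w', w = w' + m := ⟨w - m, by omega⟩
    rw [← tT_dX m hm rfl, ← zero_iff hg hg' e he]
    funext σ
    show val _ _ = 0
    rw [tS_dX hl m hm rfl, ← val_cons]
    have hpos : 0 < l * m := Nat.mul_pos hl hm
    obtain ⟨g, hgc⟩ := exists_cycM (n := l * (w' + m) + e) ((l * m) ::ₘ cycM σ)
      (by
        intro x hx
        rcases Multiset.mem_cons.mp hx with h | h
        · omega
        · exact cycM_pos σ x h)
      (by rw [Multiset.sum_cons, cycM_sum]; ring)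
    have := hv g ⟨l * m, by rw [hgc]; exact Multiset.mem_cons_self _ _, Dvd.intro _ rfl⟩
    unfold ch at this
    rw [hgc] at this
    simpa [uu] using this
  · intro hD g hsing
    obtain ⟨j, hj, m, rfl⟩ := hsing
    obtain ⟨ν, hν⟩ := Multiset.exists_cons_of_mem hj
    have hpos := cycM_pos g
    have hsum := cycM_sum g
    have hm : 0 < m := by
      have := hpos _ hj
      exact Nat.pos_of_ne_zero (by rintro rfl; simp at this)
    show val _ _ = 0
    rw [hν] at hpos hsum ⊢
    unfold uu
    rw [Multiset.map_cons, val_cons]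
    by_cases hmw : w < m
    · rw [tS_low hg hl m hmw, val_z]
    obtain ⟨w', rfl⟩ : ∃ w', w = w' + m := ⟨w - m, by omega⟩
    have h1 := hD m hm
    rw [← tT_dX m hm rfl, ← zero_iff hg hg' e he] at h1
    obtain ⟨σ, hσ⟩ := exists_cycM (n := l * w' + e) ν
      (fun x hx => hpos x (Multiset.mem_cons_of_mem hx))
      (by
        rw [Multiset.sum_cons] at hsum
        have : l * (w' + m) = l * w' + l * m := by ring
        omega)
    have h2 := congrFun h1 σ
    unfold ch at h2
    rw [hσ, tS_dX hl m hm rfl] at h2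
    exact h2

end corr

end CB

namespace CB

lemma Good_of_down {I η : Type*} [Fintype I] {col : I → η} {pos : I → ℕ}
    (hinj : ∀ i j, col i = col j → pos i = pos j → i = j)
    (hdown : ∀ i, 0 < pos i → ∃ j, col j = col i ∧ pos j + 1 = pos i) : Good col pos := by
  have hd : ∀ (d : ℕ) (i : I), ∀ m, m + d = pos i → ∃ j, col j = col i ∧ pos j = m := by
    intro d
    induction d with
    | zero => intro i m h; exact ⟨i, rfl, by omega⟩
    | succ d ih =>
      intro i m h
      obtain ⟨j, hj, hp⟩ := hdown i (by omega)
      obtain ⟨j', hj', hp'⟩ := ih j m (by omega)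
      exact ⟨j', hj'.trans hj, hp'⟩
  have hlt : ∀ i, pos i < (Finset.univ.filter fun j => col j = col i).card := by
    intro i
    have hsub : Finset.range (pos i + 1) ⊆ (Finset.univ.filter fun j => col j = col i).image pos := by
      intro m hm
      rw [Finset.mem_range] at hm
      obtain ⟨j, hj, hp⟩ := hd (pos i - m) i m (by omega)
      exact Finset.mem_image.mpr ⟨j, Finset.mem_filter.mpr ⟨Finset.mem_univ _, hj⟩, hp⟩
    have := (Finset.card_le_card hsub).trans Finset.card_image_le
    rw [Finset.card_range] at this
    omega
  refine ⟨hinj, hlt, ?_⟩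
  intro i m hm
  set s := Finset.univ.filter fun j => col j = col i with hs
  have hinjs : Set.InjOn pos s := by
    intro a ha b hb hab
    have ha' := (Finset.mem_filter.mp ha).2
    have hb' := (Finset.mem_filter.mp hb).2
    exact hinj a b (ha'.trans hb'.symm) hab
  have himg : s.image pos = Finset.range s.card := by
    apply Finset.eq_of_subset_of_card_le
    · intro x hx
      obtain ⟨j, hj, rfl⟩ := Finset.mem_image.mp hx
      rw [Finset.mem_range]
      have h1 := hlt j
      rw [(Finset.mem_filter.mp hj).2] at h1
      exact h1
    · rw [Finset.card_image_of_injOn hinjs, Finset.card_range]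
  have : m ∈ s.image pos := by rw [himg]; exact Finset.mem_range.mpr hm
  obtain ⟨j, hj, rfl⟩ := Finset.mem_image.mp this
  exact ⟨j, (Finset.mem_filter.mp hj).2, rfl⟩

/-- beta numbers -/
def bl (N : ℕ) (lam : Multiset ℕ) (i : Fin N) : ℕ := row lam i + (N - 1 - i)

lemma betaSet_bl (lam : Multiset ℕ) (N : ℕ) :
    betaSet lam N = (Finset.univ : Finset (Fin N)).val.map (bl N lam) := by
  unfold betaSet
  rw [Fin.univ_val_map, List.ofFn_eq_map, ← List.map_coe_finRange_eq_range, List.map_map]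
  congr 1
  refine List.map_congr_left fun i _ => ?_
  have := i.isLt
  simp only [Function.comp, bl, row]
  omega

lemma betaSet_succ (lam : Multiset ℕ) (K : ℕ) (h : Multiset.card lam ≤ K) :
    betaSet lam (K + 1) = 0 ::ₘ (betaSet lam K).map (fun x => x + 1) := by
  have h1 : betaSet lam (K+1) = (Multiset.range (K+1)).map (fun i => row lam i + (K + 1) - 1 - i) := rfl
  have h2 : betaSet lam K = (Multiset.range K).map (fun i => row lam i + K - 1 - i) := rfl
  rw [h1, h2, Multiset.range_succ, Multiset.map_cons, Multiset.map_map, row_zero lam K h]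
  congr 1
  · omega
  · refine Multiset.map_congr rfl fun i hi => ?_
    rw [Multiset.mem_range] at hi
    simp only [Function.comp]
    omega

lemma mod_iff (l : ℕ) (S S' : Multiset ℕ) : S.map (· % l) = S'.map (· % l) ↔
    S.map (fun x : ℕ => (x : ZMod l)) = S'.map (fun x : ℕ => (x : ZMod l)) := by
  constructor
  · intro h
    have := congrArg (Multiset.map (fun x : ℕ => (x : ZMod l))) h
    simpa [Multiset.map_map, Function.comp_def] using this
  · intro h
    have := congrArg (Multiset.map ZMod.val) h
    simpa [Multiset.map_map, Function.comp_def, ZMod.val_natCast] using this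

lemma mod_succ (l : ℕ) (lam mu : Multiset ℕ) (K : ℕ) (h : Multiset.card lam ≤ K)
    (h' : Multiset.card mu ≤ K) :
    (betaSet lam (K+1)).map (· % l) = (betaSet mu (K+1)).map (· % l)
      ↔ (betaSet lam K).map (· % l) = (betaSet mu K).map (· % l) := by
  rw [mod_iff, mod_iff, betaSet_succ _ _ h, betaSet_succ _ _ h', Multiset.map_cons, Multiset.map_cons,
    Multiset.cons_inj_right, Multiset.map_map, Multiset.map_map]
  have e : ∀ S : Multiset ℕ, S.map ((fun x : ℕ => (x : ZMod l)) ∘ fun x => x + 1)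
      = (S.map fun x : ℕ => (x : ZMod l)).map (fun y => y + 1) := by
    intro S
    rw [Multiset.map_map]
    refine Multiset.map_congr rfl fun x _ => ?_
    simp
  rw [e, e]
  exact (Multiset.map_injective (add_left_injective (1 : ZMod l))).eq_iff

lemma sameCore_iff (l : ℕ) (lam rho : Multiset ℕ) (M : ℕ) :
    sameCore l lam rho ↔ (betaSet lam (Multiset.card lam + Multiset.card rho + M)).map (· % l)
      = (betaSet rho (Multiset.card lam + Multiset.card rho + M)).map (· % l) := by
  induction M with
  | zero => rfl
  | succ M ih => rw [ih, ← add_assoc, mod_succ _ _ _ _ (by omega) (by omega)]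

lemma core_add (l : ℕ) (hl : 0 < l) (rho : Multiset ℕ) (h : IsCore l rho) (M : ℕ) :
    ∀ b ∈ betaSet rho (Multiset.card rho + M), l ≤ b → b - l ∈ betaSet rho (Multiset.card rho + M) := by
  induction M with
  | zero => exact h
  | succ M ih =>
    intro b hb hlb
    rw [← add_assoc, betaSet_succ _ _ (by omega)] at hb ⊢
    rcases Multiset.mem_cons.mp hb with rfl | hb
    · omega
    · obtain ⟨b', hb', rfl⟩ := Multiset.mem_map.mp hb
      by_cases h1 : l ≤ b'
      · refine Multiset.mem_cons_of_mem (Multiset.mem_map.mpr ⟨b' - l, ih b' hb' h1, by omega⟩)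
      · rw [show b' + 1 - l = 0 by omega]
        exact Multiset.mem_cons_self _ _

lemma exists_perm_of_map {A B : Type*} [Fintype A] (f g : A → B)
    (h : (Finset.univ : Finset A).val.map f = (Finset.univ : Finset A).val.map g) :
    ∃ π : Equiv.Perm A, ∀ i, f (π i) = g i := by
  have h1 : ∀ b, Fintype.card {a // g a = b} = Fintype.card {a // f a = b} := by
    intro b
    have := congrArg (Multiset.count b) h
    rw [Multiset.count_map, Multiset.count_map] at this
    rw [Fintype.card_subtype, Fintype.card_subtype]
    simp only [eq_comm (a := b)] at this
    refine Eq.trans ?_ (this.symm.trans ?_)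
    · rfl
    · rfl
  let E : ∀ b, {a // g a = b} ≃ {a // f a = b} := fun b => Fintype.equivOfCardEq (h1 b)
  refine ⟨(Equiv.sigmaFiberEquiv g).symm.trans ((Equiv.sigmaCongrRight E).trans (Equiv.sigmaFiberEquiv f)), ?_⟩
  intro i
  simp only [Equiv.trans_apply, Equiv.sigmaFiberEquiv, Equiv.coe_fn_symm_mk, Equiv.coe_fn_mk,
    Equiv.sigmaCongrRight_apply, Sigma.map]
  exact (E (g i) ⟨i, rfl⟩).2

section block
variable (l w e : ℕ) (hl : 0 < l) (rho : Nat.Partition e)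

/-- number of beads -/
abbrev NN : ℕ := Multiset.card rho.parts + (l * w + e)

/-- runner of a bead of the core -/
def bcol : Fin (NN l w e rho) × Unit → Fin l := fun x => ⟨bl _ rho.parts x.1 % l, Nat.mod_lt _ hl⟩

/-- position of a bead of the core -/
def bpos : Fin (NN l w e rho) × Unit → ℕ := fun x => bl _ rho.parts x.1 / l

lemma gam_bl (N : ℕ) (lam : Multiset ℕ) (x : Fin N × Unit) : gam N (fun _ : Unit => lam) x = bl N lam x.1 := by
  unfold gam bl; push_cast; rfl

lemma bl_inj (N : ℕ) (lam : Multiset ℕ) : Function.Injective (bl N lam) := by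
  intro i j h
  have h1 := (gam_anti N (fun _ : Unit => lam) ()).injective
  apply h1
  simp only [gam_bl, h]

lemma bt_pos (x : Fin (NN l w e rho) × Unit) :
    bt (bcol l w e hl rho) (fun x => (bpos l w e rho x : ℤ)) x = bl _ rho.parts x.1 := by
  show (l:ℤ) * ((bl _ rho.parts x.1 / l : ℕ):ℤ) + ((bl _ rho.parts x.1 % l : ℕ):ℤ) = _
  exact_mod_cast Nat.div_add_mod _ _

lemma block_good (h : IsCore l rho.parts) : Good (bcol l w e hl rho) (bpos l w e rho) := by
  apply Good_of_down
  · intro x y hc hp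
    have h1 := (bt_eq (bcol l w e hl rho) (fun x => (bpos l w e rho x : ℤ))
      (fun x => (bpos l w e rho x : ℤ)) x y).mpr ⟨hc, by exact_mod_cast hp⟩
    rw [bt_pos, bt_pos] at h1
    have h2 := bl_inj _ _ (by exact_mod_cast h1)
    exact Prod.ext h2 rfl
  · intro x hx
    have hb : l ≤ bl _ rho.parts x.1 := by
      unfold bpos at hx
      by_contra hn
      rw [Nat.div_eq_of_lt (by omega)] at hx
      omega
    have h1 := core_add l hl rho.parts h (l * w + e) (bl _ rho.parts x.1)
      (by rw [betaSet_bl]; exact Multiset.mem_map_of_mem _ (Finset.mem_univ x.1)) hb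
    rw [betaSet_bl] at h1
    obtain ⟨j, _, hj⟩ := Multiset.mem_map.mp h1
    refine ⟨(j, ()), ?_, ?_⟩
    · apply Fin.ext
      show bl _ rho.parts j % l = bl _ rho.parts x.1 % l
      rw [hj, ← Nat.mod_eq_sub_mod hb]
    · show bl _ rho.parts j / l + 1 = bl _ rho.parts x.1 / l
      rw [hj, Nat.div_eq_sub_div hl hb]

lemma block_cap (c : Fin l) : w ≤ (Finset.univ.filter fun i => bcol l w e hl rho i = c).card := by
  have hsub : Finset.range w ⊆ (Finset.univ.filter fun i => bcol l w e hl rho i = c).image (bpos l w e rho) := by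
    intro j hj
    rw [Finset.mem_range] at hj
    have hc := c.isLt
    have hlt : l * j + c < l * w := by
      calc l * j + c < l * j + l := by omega
        _ = l * (j + 1) := by ring
        _ ≤ l * w := Nat.mul_le_mul_left l hj
    let i : Fin (NN l w e rho) := ⟨NN l w e rho - 1 - (l * j + c), by unfold NN; omega⟩
    have hi : bl _ rho.parts i = l * j + c := by
      unfold bl
      rw [row_zero]
      · show 0 + (NN l w e rho - 1 - (NN l w e rho - 1 - (l * j + c))) = _
        unfold NN; omega
      · show _ ≤ NN l w e rho - 1 - (l * j + c)
        unfold NN; omega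
    refine Finset.mem_image.mpr ⟨(i, ()), Finset.mem_filter.mpr ⟨Finset.mem_univ _, ?_⟩, ?_⟩
    · apply Fin.ext
      show bl _ rho.parts i % l = c
      rw [hi, Nat.mul_add_mod, Nat.mod_eq_of_lt hc]
    · show bl _ rho.parts i / l = j
      rw [hi, Nat.mul_add_div hl, Nat.div_eq_of_lt hc, add_zero]
  have := (Finset.card_le_card hsub).trans Finset.card_image_le
  rwa [Finset.card_range] at this

lemma block_he : l * ∑ i, bpos l w e rho i + ∑ i, (bcol l w e hl rho i : ℕ)
    = e + ∑ i : Fin (NN l w e rho) × Unit, spos (NN l w e rho) i := by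
  have h1 := sum_gam (NN l w e rho) (fun _ : Unit => rho.parts) (fun _ => by unfold NN; omega)
  have h2 := sum_bt (bcol l w e hl rho) (fun x => (bpos l w e rho x : ℤ))
  simp only [bt_pos] at h2
  simp only [gam_bl] at h1
  rw [h1] at h2
  simp only [Finset.univ_unique, Finset.sum_singleton, rho.parts_sum] at h2
  exact_mod_cast h2.symm

lemma spos_good (N : ℕ) : Good (fun _ : Fin N × Unit => ()) (spos N) := sgood N

lemma TN_SS (N : ℕ) (lam : Multiset ℕ) :
    TN N (fun _ : Unit => lam) = TT (fun _ : Fin N × Unit => ()) (spos N) (gam N fun _ => lam) := rfl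

lemma le_NN (lam : Nat.Partition (l * w + e)) : Multiset.card lam.parts ≤ NN l w e rho := by
  have := card_parts_le lam
  unfold NN; omega

lemma same_NN (lam : Nat.Partition (l * w + e)) : sameCore l lam.parts rho.parts ↔
    (Finset.univ : Finset (Fin (NN l w e rho))).val.map (fun i => bl _ lam.parts i % l)
      = (Finset.univ : Finset (Fin (NN l w e rho))).val.map (fun i => bl _ rho.parts i % l) := by
  have h := card_parts_le lam
  rw [sameCore_iff l lam.parts rho.parts (l * w + e - Multiset.card lam.parts)]
  have e1 : Multiset.card lam.parts + Multiset.card rho.parts + (l * w + e - Multiset.card lam.parts)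
      = NN l w e rho := by unfold NN; omega
  rw [e1, betaSet_bl, betaSet_bl, Multiset.map_map, Multiset.map_map]
  rfl

lemma sgn_smul (s : ℤˣ) (F : R Unit) : ((s : ℤ) : ℚ) • F = (s : ℤ) • F := Int.cast_smul_eq_zsmul ℚ _ _

lemma block_a (lam : Nat.Partition (l * w + e)) (h : sameCore l lam.parts rho.parts) :
    sFun lam ∈ LinearMap.range (chL (l * w + e) ∘ₗ
      tS (bcol l w e hl rho) (bpos l w e rho) (spos (NN l w e rho)) w) := by
  rw [same_NN] at h
  obtain ⟨π, hπ⟩ := exists_perm_of_map _ _ h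
  let PP : Equiv.Perm (Fin (NN l w e rho) × Unit) := Equiv.prodCongrLeft fun _ => π
  let γ : Fin (NN l w e rho) × Unit → ℤ := fun x => ((bl _ lam.parts (π x.1) / l : ℕ) : ℤ)
  have hbt : bt (bcol l w e hl rho) γ = fun x => gam _ (fun _ : Unit => lam.parts) (PP x) := by
    funext x
    rw [gam_bl]
    show (l : ℤ) * ((bl _ lam.parts (π x.1) / l : ℕ) : ℤ) + ((bl _ rho.parts x.1 % l : ℕ) : ℤ)
      = ((bl _ lam.parts (π x.1) : ℕ) : ℤ)
    rw [← hπ x.1]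
    exact_mod_cast Nat.div_add_mod _ _
  have hsum : ∑ i, γ i = w + ∑ i, (bpos l w e rho i : ℤ) := by
    have h1 := sum_bt (bcol l w e hl rho) γ
    rw [hbt, Equiv.sum_comp PP (gam _ (fun _ : Unit => lam.parts)),
      sum_gam _ _ (fun _ => le_NN l w e rho lam)] at h1
    simp only [Finset.univ_unique, Finset.sum_singleton, lam.parts_sum] at h1
    have h2 := block_he l w e hl rho
    have h3 : ((l * ∑ i, bpos l w e rho i + ∑ i, (bcol l w e hl rho i : ℕ) : ℕ) : ℤ)
      = ((e + ∑ i : Fin (NN l w e rho) × Unit, spos (NN l w e rho) i : ℕ) : ℤ) := by rw [h2]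
    push_cast at h1 h3
    have hl' : (l : ℤ) ≠ 0 := by omega
    apply mul_left_cancel₀ hl'
    linarith
  refine ⟨Finsupp.single ⟨γ, hsum⟩ ((Equiv.Perm.sign PP : ℤ)), ?_⟩
  rw [LinearMap.comp_apply]
  unfold tS
  rw [Finsupp.linearCombination_single]
  unfold SS
  rw [hbt]
  have h4 := TT_perm (col := fun _ : Fin (NN l w e rho) × Unit => ()) (pos := spos (NN l w e rho))
    (gam _ (fun _ : Unit => lam.parts)) PP (fun _ => rfl)
  rw [h4, sgn_smul, smul_smul]
  have h5 : ((Equiv.Perm.sign PP : ℤ)) * (Equiv.Perm.sign PP : ℤ) = 1 := by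
    rw [← Units.val_mul, Int.units_mul_self]; rfl
  have h6 : ∀ (d d' : DecidableEq (Fin (NN l w e rho) × Unit)),
      ((@Equiv.Perm.sign _ d _ PP : ℤ)) * ((@Equiv.Perm.sign _ d' _ PP : ℤ)) = 1 := by
    intro d d'
    rw [Subsingleton.elim d' d, ← Units.val_mul, Int.units_mul_self]; rfl
  rw [h6, one_smul, sFun_TN lam _ (le_NN l w e rho lam)]
  rfl

lemma block_b (h : IsCore l rho.parts) (γ : Ix (bpos l w e rho) w) :
    ch (l * w + e) (SS (bcol l w e hl rho) (spos (NN l w e rho)) γ.1) ∈ CBlock l (l * w + e) rho.parts := by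
  set N := NN l w e rho with hN
  set β := bt (bcol l w e hl rho) γ.1 with hβ
  have hz : chL (l * w + e) (0 : R Unit) = 0 := map_zero _
  change chL (l * w + e) (TT (fun _ : Fin N × Unit => ()) (spos N) β) ∈ _
  by_cases h0 : ∃ x, β x < 0
  · obtain ⟨x, hx⟩ := h0
    rw [TT_neg β x hx, hz]; exact Submodule.zero_mem _
  push Not at h0
  by_cases hinj : Function.Injective (fun i : Fin N => β (i, ()))
  swap
  · unfold Function.Injective at hinj
    push Not at hinj
    obtain ⟨i, j, h1, h2⟩ := hinj
    rw [TT_eq_zero β (i, ()) (j, ()) (fun h => h2 (Prod.ext_iff.mp h).1) rfl h1, hz]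
    exact Submodule.zero_mem _
  obtain ⟨π, m, lam, hcard, hrow⟩ := strip (fun i : Fin N => β (i, ())) (fun i => h0 _) hinj
  let PP : Equiv.Perm (Fin N × Unit) := Equiv.prodCongrLeft fun _ => π
  have hgam : (fun x => β (PP x)) = gam N (fun _ : Unit => lam.parts) := by
    funext x
    exact hrow x.1
  have hm : m = l * w + e := by
    have h1 := sum_gam N (fun _ : Unit => lam.parts) (fun _ => hcard)
    rw [← hgam, Equiv.sum_comp PP β, hβ, sum_bt, γ.2] at h1
    simp only [Finset.univ_unique, Finset.sum_singleton, lam.parts_sum] at h1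
    have h2 := block_he l w e hl rho
    have h3 : ((l * ∑ i, bpos l w e rho i + ∑ i, (bcol l w e hl rho i : ℕ) : ℕ) : ℤ)
      = ((e + ∑ i : Fin (NN l w e rho) × Unit, spos (NN l w e rho) i : ℕ) : ℤ) := by rw [h2]
    push_cast at h1 h3
    have : (m : ℤ) = l * w + e := by linarith
    exact_mod_cast this
  subst hm
  have h4 := TT_perm (col := fun _ : Fin N × Unit => ()) (pos := spos N) β PP (fun _ => rfl)
  rw [hgam, sgn_smul, ← TN_SS] at h4
  have h6 : ∀ (d d' : DecidableEq (Fin N × Unit)),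
      ((@Equiv.Perm.sign _ d _ PP : ℤ)) * ((@Equiv.Perm.sign _ d' _ PP : ℤ)) = 1 := by
    intro d d'
    rw [Subsingleton.elim d' d, ← Units.val_mul, Int.units_mul_self]; rfl
  have h7 : TT (fun _ : Fin N × Unit => ()) (spos N) β
      = (Equiv.Perm.sign PP : ℤ) • TN N (fun _ : Unit => lam.parts) := by
    rw [h4, smul_smul, h6, one_smul]
  rw [h7, map_smul]
  refine Submodule.smul_mem _ _ ?_
  change ch _ _ ∈ _
  rw [← sFun_TN lam N hcard]
  refine Submodule.subset_span ⟨lam, ⟨h, ?_⟩, rfl⟩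
  rw [same_NN]
  have h8 : ∀ i : Fin N, bl N lam.parts i % l = bl N rho.parts (π i) % l := by
    intro i
    have h9 := hrow i
    have h10 : β (π i, ()) = l * γ.1 (π i, ()) + ((bl N rho.parts (π i) % l : ℕ) : ℤ) := rfl
    have h11 : ((bl N lam.parts i : ℕ) : ℤ) = l * γ.1 (π i, ()) + ((bl N rho.parts (π i) % l : ℕ) : ℤ) := by
      rw [← h10]
      rw [h9]; unfold bl; push_cast; rfl
    have h12 : ((bl N lam.parts i : ℕ) : ℤ) % l = ((bl N rho.parts (π i) % l : ℕ) : ℤ) := by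
      rw [h11, Int.mul_add_emod_self_left]
      exact_mod_cast Nat.mod_mod _ _
    exact_mod_cast h12
  have h13 : (fun i : Fin N => bl N lam.parts i % l) = (fun i => bl N rho.parts i % l) ∘ π := funext h8
  rw [h13, ← Multiset.map_map]
  congr 1
  exact Multiset.map_univ_val_equiv π

lemma block_eq (h : IsCore l rho.parts) : CBlock l (l * w + e) rho.parts
    = LinearMap.range (chL (l * w + e) ∘ₗ
      tS (bcol l w e hl rho) (bpos l w e rho) (spos (NN l w e rho)) w) := by
  apply le_antisymm
  · unfold CBlock
    rw [Submodule.span_le]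
    rintro _ ⟨lam, ⟨_, hs⟩, rfl⟩
    exact block_a l w e hl rho lam hs
  · rintro _ ⟨c, rfl⟩
    rw [LinearMap.comp_apply]
    unfold tS
    rw [Finsupp.linearCombination_apply, Finsupp.sum, map_sum]
    refine Submodule.sum_mem _ fun γ _ => ?_
    rw [map_smul]
    exact Submodule.smul_mem _ _ (block_b l w e hl rho h γ)

end block

end CB

namespace CB

lemma sp_zsmul_left {G : Type*} [Group G] [Fintype G] (a : ℤ) (f h : G → ℚ) :
    sp (a • f) h = a * sp f h := by
  unfold sp
  simp only [Pi.smul_apply, zsmul_eq_mul, Finset.mul_sum]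
  exact Finset.sum_congr rfl fun _ _ => by ring

lemma sp_zsmul_right {G : Type*} [Group G] [Fintype G] (a : ℤ) (f h : G → ℚ) :
    sp f (a • h) = a * sp f h := by
  unfold sp
  simp only [Pi.smul_apply, zsmul_eq_mul, Finset.mul_sum]
  exact Finset.sum_congr rfl fun _ _ => by ring

lemma sp_sum_left {G ι : Type*} [Group G] [Fintype G] (s : Finset ι) (f : ι → G → ℚ) (h : G → ℚ) :
    sp (∑ i ∈ s, f i) h = ∑ i ∈ s, sp (f i) h := by
  induction s using Finset.induction_on with
  | empty => simp [sp]
  | insert a s ha ih => rw [Finset.sum_insert ha, Finset.sum_insert ha, sp_add_left, ih]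

lemma sp_sum_right {G ι : Type*} [Group G] [Fintype G] (s : Finset ι) (f : ι → G → ℚ) (h : G → ℚ) :
    sp h (∑ i ∈ s, f i) = ∑ i ∈ s, sp h (f i) := by
  induction s using Finset.induction_on with
  | empty => simp [sp]
  | insert a s ha ih => rw [Finset.sum_insert ha, Finset.sum_insert ha, sp_add_right, ih]

/-- two bases of the same lattice have equivalent Gram matrices -/
lemma gram_equiv {G T D : Type*} [Group G] [Fintype G] [Fintype T] [Fintype D]
    (bs : T → (G → ℚ)) (f : D → (G → ℚ)) (hb : LinearIndependent ℤ bs) (hf : LinearIndependent ℤ f)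
    (hs : Submodule.span ℤ (Set.range bs) = Submodule.span ℤ (Set.range f)) :
    IntEquiv (Matrix.of fun t q => sp (bs t) (bs q)) (Matrix.of fun t q => sp (f t) (f q)) := by
  let b1 := Module.Basis.span hb
  let b2 := (Module.Basis.span hf).map (LinearEquiv.ofEq _ _ hs.symm)
  have hb1 : ∀ t, ((b1 t : _) : G → ℚ) = bs t := fun t => by
    have := Module.Basis.span_apply hb t
    simp only [b1, this]
  have hb2 : ∀ t, ((b2 t : _) : G → ℚ) = f t := fun t => by
    simp only [b2, Module.Basis.map_apply, LinearEquiv.coe_ofEq_apply]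
    rw [Module.Basis.span_apply hf t]
  let e := b1.indexEquiv b2
  let b3 := b2.reindex e.symm
  have h1 : b1.toMatrix b3 * b3.toMatrix b1 = 1 := Module.Basis.toMatrix_mul_toMatrix_flip _ _
  have h2 : b3.toMatrix b1 * b1.toMatrix b3 = 1 := Module.Basis.toMatrix_mul_toMatrix_flip _ _
  have hu : IsUnit (b1.toMatrix b3) := ⟨⟨_, _, h1, h2⟩, rfl⟩
  have hexp : ∀ t, f (e t) = ∑ s, b1.toMatrix b3 s t • bs s := by
    intro t
    have h := b1.sum_toMatrix_smul_self b3 t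
    have h' := congrArg (fun x : Submodule.span ℤ (Set.range bs) => (x : G → ℚ)) h
    simp only [Submodule.coe_sum, Submodule.coe_smul] at h'
    simp only [hb1] at h'
    rw [h']
    simp only [b3, Module.Basis.reindex_apply, Equiv.symm_symm, hb2]
  refine ⟨e, (b1.toMatrix b3).transpose, b1.toMatrix b3, ?_, hu, ?_⟩
  · exact (Matrix.isUnit_transpose _).2 hu
  · ext t q
    simp only [Matrix.mul_apply, Matrix.map_apply, Matrix.transpose_apply, Matrix.of_apply,
      Matrix.submatrix_apply]
    rw [hexp, hexp, sp_sum_right]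
    refine Finset.sum_congr rfl fun s _ => ?_
    rw [sp_zsmul_right, sp_sum_left, mul_comm]
    congr 1
    refine Finset.sum_congr rfl fun r _ => ?_
    rw [sp_zsmul_left]

lemma Tm_indep2 {k w : ℕ} [i : Fintype (PMapw (Fin k) w)] (a : PMapw (Fin k) w → ℤ)
    (h : ∑ lam, a lam • Tm lam = 0) (mu : PMapw (Fin k) w) : a mu = 0 := by
  refine Tm_indep a ?_ mu
  rw [← h]
  exact Finset.sum_congr (Finset.ext fun _ => by simp) fun _ _ => rfl

lemma Lat_exists2 {k w : ℕ} [i : Fintype (PMapw (Fin k) w)] {F : R (Fin k)} (hF : F ∈ Lat (Fin k) w) :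
    ∃ a : PMapw (Fin k) w → ℤ, F = ∑ lam, a lam • Tm lam := by
  obtain ⟨a, h⟩ := Lat_exists hF
  refine ⟨a, ?_⟩
  rw [h]
  exact Finset.sum_congr (Finset.ext fun _ => by simp) fun _ _ => rfl

theorem main_k (k w : ℕ) (e : ℕ) (rho : Nat.Partition e) (hrho : IsCore (k+1) rho.parts)
    {T : Type*} [Fintype T] (bs : T → (Equiv.Perm (Fin ((k+1) * w + e)) → ℚ))
    (hb1 : LinearIndependent ℤ bs)
    (hb2 : Submodule.span ℤ (Set.range bs)
        = (VirtCharS ((k+1) * w + e) ⊓ VanishSub (k+1) ((k+1) * w + e))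
            ⊓ CBlock (k+1) ((k+1) * w + e) rho.parts) :
    ∃ f : PMapw (Fin k) w → (Equiv.Perm (Fin ((k+1) * w + e)) → ℚ),
      IntEquiv (Matrix.of fun t q => sp (bs t) (bs q)) (Matrix.of fun t q => sp (f t) (f q)) ∧
      ∀ lam mu, sp (f lam) (f mu) = ip w (phi (AAk k) (Tm lam)) (phi (AAk k) (Tm mu)) := by
  have hl : 0 < k + 1 := Nat.succ_pos k
  have hg := block_good (k+1) w e hl rho hrho
  have hg' := spos_good (NN (k+1) w e rho)
  have he := block_he (k+1) w e hl rho
  have hblock := block_eq (k+1) w e hl rho hrho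
  have hc : ∀ lam : PMapw (Fin k) w, ∃ c, tT (bcol (k+1) w e hl rho) (bpos (k+1) w e rho) w c
      = phi (AAk k) (Tm lam) := fun lam =>
    tT_surj hg w (block_cap (k+1) w e hl rho) (phi_Lat (AAk k) (Tm_Lat lam))
  choose c hc using hc
  set S := tS (bcol (k+1) w e hl rho) (bpos (k+1) w e rho) (spos (NN (k+1) w e rho)) w with hS
  set TL := tT (bcol (k+1) w e hl rho) (bpos (k+1) w e rho) w with hTL
  let f : PMapw (Fin k) w → (Equiv.Perm (Fin ((k+1) * w + e)) → ℚ) := fun lam => chL _ (S (c lam))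
  have hz : ∀ x, chL ((k+1)*w+e) (S x) = 0 ↔ TL x = 0 := fun x => zero_iff hg hg' e he w x
  have hv : ∀ x, chL ((k+1)*w+e) (S x) ∈ VanishSub (k+1) ((k+1)*w+e)
      ↔ ∀ m, 0 < m → ∑ r, DD (m, r) (TL x) = 0 := fun x => vanish_iff hg hg' e he hl w x
  have hsumf : ∀ a : PMapw (Fin k) w → ℤ, ∑ lam, a lam • f lam = chL _ (S (∑ lam, a lam • c lam)) := by
    intro a
    simp only [map_sum, map_smul, f]
  have hsumT : ∀ a : PMapw (Fin k) w → ℤ, TL (∑ lam, a lam • c lam)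
      = phi (AAk k) (∑ lam, a lam • Tm lam) := by
    intro a
    simp only [map_sum, map_smul, hc, map_zsmul]
  refine ⟨f, gram_equiv bs f hb1 ?_ ?_, ?_⟩
  · rw [Fintype.linearIndependent_iff]
    intro a ha
    rw [hsumf, hz, hsumT] at ha
    exact Tm_indep2 a (phi_AA_inj k _ ha)
  · rw [hb2]
    apply le_antisymm
    · rintro x ⟨⟨_, hx2⟩, hx3⟩
      rw [SetLike.mem_coe, hblock] at hx3
      obtain ⟨y, rfl⟩ := hx3
      have h1 := (hv y).1 hx2
      obtain ⟨F', hF', h2⟩ := ker_hard k _ (tT_Lat w y) h1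
      obtain ⟨a, rfl⟩ := Lat_exists2 hF'
      have h3 : TL (y - ∑ lam, a lam • c lam) = 0 := by
        rw [map_sub, hsumT, ← h2, sub_self]
      rw [← hz, map_sub, map_sub, ← hsumf, sub_eq_zero] at h3
      change chL _ (S y) ∈ _
      rw [h3]
      exact Submodule.sum_mem _ fun lam _ => Submodule.smul_mem _ _ (Submodule.subset_span ⟨lam, rfl⟩)
    · rw [Submodule.span_le]
      rintro _ ⟨lam, rfl⟩
      have h1 : f lam ∈ CBlock (k+1) ((k+1) * w + e) rho.parts := by
        rw [hblock]; exact ⟨c lam, rfl⟩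
      refine ⟨⟨?_, ?_⟩, h1⟩
      · exact Submodule.span_mono (Set.image_subset_range _ _) h1
      · refine (hv _).2 ?_
        intro m _
        rw [hc]
        exact ker_easy k _ m
  · intro lam mu
    rw [← hc, ← hc, hTL, ← gram_eq hg hg' e he w, ← sp_ch]
    rfl

end CB

/-- **Proposition 3.3.**
Let `ℓ ≥ 2`, `w ≥ 0`, `ρ` an `ℓ`-core with `|ρ| = e`, and `𝓑 = (β_i)_{0 ≤ i ≤ ℓ-2}`.
The Cartan matrix `Cart_ℓ(ℓw + e, ρ)` — the Gram matrix of any `ℤ`-basis of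
`𝒫(S_{ℓw+e}, ρ)` — is equivalent over `ℤ` to the `PMap_w(𝓑) × PMap_w(𝓑)`-matrix with
`(λ̲, μ̲)`-entry `⟨ζ_{λ̲}, ζ_{μ̲}⟩`, the scalar product of class functions on `S_ℓ ≀ S_w`. -/
theorem cartan_block_equiv_wreath_gram (l w : ℕ) (hl : 2 ≤ l) (e : ℕ)
    (rho : Nat.Partition e) (hrho : IsCore l rho.parts)
    {T : Type*} [Fintype T]
    (bs : T → (Equiv.Perm (Fin (l * w + e)) → ℚ))
    (hb1 : LinearIndependent ℤ bs)
    (hb2 : Submodule.span ℤ (Set.range bs)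
        = (VirtCharS (l * w + e) ⊓ VanishSub l (l * w + e))
            ⊓ CBlock l (l * w + e) rho.parts) :
    IntEquiv (Matrix.of fun t q => sp (bs t) (bs q))
      (Matrix.of fun lam mu : PMapw (Fin (l - 1)) w =>
        sp (zetaTuple (fun i => ((lam.1 i).1 : ℕ)) lam.2 (betaChar l)
              (fun i => sFun (lam.1 i).2))
           (zetaTuple (fun i => ((mu.1 i).1 : ℕ)) mu.2 (betaChar l)
              (fun i => sFun (mu.1 i).2))) := by
  obtain ⟨k, rfl⟩ : ∃ k, l = k + 1 := ⟨l - 1, by omega⟩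
  obtain ⟨f, hf, hg⟩ := CB.main_k k w e rho hrho bs hb1 hb2
  have h : (Matrix.of fun lam mu : PMapw (Fin (k + 1 - 1)) w =>
        sp (zetaTuple (fun i => ((lam.1 i).1 : ℕ)) lam.2 (betaChar (k + 1))
              (fun i => sFun (lam.1 i).2))
           (zetaTuple (fun i => ((mu.1 i).1 : ℕ)) mu.2 (betaChar (k + 1))
              (fun i => sFun (mu.1 i).2)))
      = (Matrix.of fun lam mu : PMapw (Fin k) w => sp (f lam) (f mu)) := by
    ext lam mu
    exact (CB.zeta_gram (k + 1) w lam mu).trans (hg lam mu).symm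
  rw [h]
  exact hf

end
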